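/- For every integer d ≥ 1 there exists a constant A ≥ 1 depending only on d with the following property. Let n ≥ 1, let ε ∈ (0,1), let k be an integer with k ≥ A·ε^{-4d·7^d}, and let η > 0 satisfy η ≤ n^{-A·k}·k^{-A·k}. Then for every probability measure μ on ℝ^n that approximately matches the moments of the standard Gaussian up to degree k with slack η, and for every polynomial p in n real variables of total degree at most d, one has |∫ sgn(p(x)) dμ(x) − ∫ sgn(p(y)) dγₙ(y)| ≤ ε/2. -/

import Mathlib

open MeasureTheory ProbabilityTheory

/-- The standard Gaussian measure on `ι → ℝ` (product of `N(0,1)`). -/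
noncomputable def stdGaussianPi (ι : Type) [Fintype ι] : Measure (ι → ℝ) :=
  Measure.pi fun _ => gaussianReal 0 1

/-- `μ` approximately matches the moments of the standard Gaussian up to degree `k`
with slack `η`: all absolute moments of order at most `k` are finite and each moment
of order at most `k` is within `η` of the corresponding Gaussian moment. -/
def MomentMatches {ι : Type} [Fintype ι] (k : ℕ) (η : ℝ)
    (μ : Measure (ι → ℝ)) : Prop :=
  ∀ α : ι → ℕ, (∑ i, α i) ≤ k →
    Integrable (fun x => ∏ i, |x i| ^ α i) μ ∧
    |(∫ x, ∏ i, (x i) ^ α i ∂μ) - ∫ y, ∏ i, (y i) ^ α i ∂(stdGaussianPi ι)| ≤ η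

/-- The sign function: `1` if `0 ≤ t`, `-1` otherwise. -/
noncomputable def sgn (t : ℝ) : ℝ := if 0 ≤ t then 1 else -1

set_option linter.unusedSectionVars false
namespace FP
open MvPolynomial
open Finset (range mul_sum sum_congr sum_nonneg sum_le_sum sum_mul mem_range sum_add_distrib abs_sum_le_sum_abs single_le_sum mem_univ prod_nonneg univ sum_const prod_mul_distrib univ_unique prod_le_one sum_eq_single card_range sum_sub_distrib sum_singleton sum_range_succ' sum_comm prod_le_prod sum_le_card_nsmul sum_insert prod_insert sum_div)
open Real (norm_of_nonneg sq_sqrt norm_eq_abs sqrt_nonneg sqrt_mul sqrt_le_sqrt exp_pos add_one_le_exp one_le_exp rpow_natCast exp_le_exp exp_nat_mul sqrt_one sqrt_sq)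
open Real renaming exp → er, pi → pR
open Complex (norm_real norm_exp_ofReal_mul_I exp_add normSq continuous_ofReal ofReal_re ofReal_add)
open Complex renaming I → Ic, exp → ec
open Polynomial (coeff_eq_zero_of_natDegree_lt natDegree_mul_le eval_finsetSum finsetSum_coeff coeff_divX)
open Polynomial renaming C → PC, X → PX
open Set (Icc indicator_of_mem indicator_of_notMem)
local notation "MP" x:max => MvPolynomial x ℝ
local notation "RR" => ℝ
variable {ι : Type} [Fintype ι]
instance : IsProbabilityMeasure (stdGaussianPi ι) := by
  unfold stdGaussianPi; infer_instance
lemma int_pow (k : ℕ) : Integrable (fun x : RR => x ^ k) (gaussianReal 0 1) := by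
  have h := (memLp_id_gaussianReal (μ := 0) (v := 1) k)
  have h2 := MemLp.integrable_norm_pow' (p := k) (by exact_mod_cast h)
  exact (integrable_norm_iff (by fun_prop)).1 (by simpa using h2)
noncomputable def gm (k : ℕ) : RR := ∫ x, x ^ k ∂(gaussianReal 0 1)
lemma int_pow_exp (k : ℕ) : Integrable (fun x : RR => x ^ k * er (-(1/2) * x ^ 2)) := by
  have := integrable_rpow_mul_exp_neg_mul_sq (b := 1/2) (by norm_num) (s := k)
    (by have : (0:RR) <= k := k.cast_nonneg
        linarith)
  simpa only [rpow_natCast] using this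
lemma gm_eq (k : ℕ) : gm k = (√(2 * pR))⁻¹ * ∫ x : RR, x ^ k * er (-(1/2) * x ^ 2) := by
  rw [gm, integral_gaussianReal_eq_integral_smul (by norm_num), <- integral_const_mul]
  congr with x
  simp only [gaussianPDFReal, smul_eq_mul, NNReal.coe_one, mul_one, sub_zero]
  rw [show -x ^ 2 / 2 = -(1/2) * x ^ 2 by ring]; ring
lemma gm_succ (k : ℕ) : gm (k + 1) = k * gm (k - 1) := by
  have h := integral_mul_deriv_eq_deriv_mul_of_integrable
    (u := fun x : RR => x ^ k) (u' := fun x => k * x ^ (k - 1))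
    (v := fun x : RR => - er (-(1/2) * x ^ 2))
    (v' := fun x : RR => x * er (-(1/2) * x ^ 2))
    (fun x _ => by simpa using hasDerivAt_pow k x)
    (fun x _ => by
      have := (((hasDerivAt_pow 2 x).const_mul (-(1/2))).exp).neg
      exact this.congr_deriv (by simp only [Nat.cast_ofNat]; ring))
    (by convert int_pow_exp (k+1) using 1; ext x; simp; ring)
    (by convert (int_pow_exp (k-1)).const_mul (-(k:RR)) using 1; ext x; simp; ring)
    (by convert (int_pow_exp k).neg using 1; ext x; simp)
  rw [gm_eq, gm_eq, mul_left_comm, <- integral_const_mul (k:RR)]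
  congr 1
  rw [<- integral_neg] at h
  refine Eq.trans ?_ (h.trans ?_)
  · congr with x; ring
  · congr with x; ring
lemma int_mono (α : ι -> ℕ) : Integrable (fun x : ι -> RR => ∏ i, x i ^ α i) (stdGaussianPi ι) :=
  Integrable.fintype_prod (f := fun i (t : RR) => t ^ α i) (fun i => int_pow (α i))
lemma integral_monom (α : ι -> ℕ) :
    ∫ x, ∏ i, x i ^ α i ∂(stdGaussianPi ι) = ∏ i, gm (α i) :=
  integral_fintype_prod_eq_prod (fun i (t : RR) => t ^ α i)
lemma int_poly (f : MP ι) : Integrable (fun x => eval x f) (stdGaussianPi ι) := by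
  simp only [eval_eq']
  exact integrable_finsetSum _ fun m _ => (int_mono _).const_mul _
lemma cont_poly (f : MP ι) : Continuous (fun x => eval x f) := by
  simp only [eval_eq']
  fun_prop
noncomputable def Ex : MP ι →ₗ[RR] RR where
  toFun f := ∫ x, eval x f ∂(stdGaussianPi ι)
  map_add' f g := by simp only [map_add]; exact integral_add (int_poly f) (int_poly g)
  map_smul' c f := by
    simp only [smul_eval, RingHom.id_apply, smul_eq_mul]; exact integral_const_mul _ _
lemma Ex_def (f : MP ι) : Ex f = ∫ x, eval x f ∂(stdGaussianPi ι) := rfl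
lemma Ex_C (c : RR) : Ex (C c : MP ι) = c := by simp [Ex_def]
lemma Ex_one : Ex (1 : MP ι) = 1 := by simp [Ex_def]
lemma Ex_C_mul (c : RR) (f : MP ι) : Ex (C c * f) = c * Ex f := by
  rw [<- smul_eq_C_mul]; simp
lemma Ex_mono {f g : MP ι} (h : ∀ x, eval x f <= eval x g) : Ex f <= Ex g :=
  integral_mono (int_poly f) (int_poly g) h
lemma Ex_nonneg {f : MP ι} (h : ∀ x, 0 <= eval x f) : 0 <= Ex f :=
  integral_nonneg h
lemma Ex_monomial (m : ι →₀ ℕ) (c : RR) : Ex (monomial m c) = c * ∏ i, gm (m i) := by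
  rw [Ex_def]
  simp only [eval_monomial, Finsupp.prod_fintype _ _ (fun _ => pow_zero _)]
  rw [integral_const_mul, integral_monom]
lemma stein (i : ι) (f : MP ι) : Ex (X i * f) = Ex (pderiv i f) := by
  classical
  induction f using MvPolynomial.induction_on' with
  | monomial m c =>
    rw [pderiv_monomial, X, monomial_mul, one_mul, Ex_monomial, Ex_monomial, mul_assoc]
    congr 1
    rw [<- Finset.mul_prod_erase _ _ (mem_univ i), <- Finset.mul_prod_erase univ (fun j => gm ((m - Finsupp.single i 1 : ι →₀ ℕ) j)) (mem_univ i), <- mul_assoc]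
    congr 1
    · simp [add_comm 1 (m i), gm_succ]
    · refine Finset.prod_congr rfl fun j hj => ?_
      have : i ≠ j := (Finset.ne_of_mem_erase hj).symm
      simp [this]
  | add p q hp hq => rw [mul_add, map_add, map_add, map_add, hp, hq]
noncomputable def ds (i : ι) : MP ι →ₗ[RR] MP ι :=
  LinearMap.mulLeft RR (X i) - (pderiv i : Derivation RR (MP ι) (MP ι)).toLinearMap
lemma ds_apply (i : ι) (f : MP ι) : ds i f = X i * f - pderiv i f := rfl
lemma pd_comm (i j : ι) (f : MP ι) : pderiv i (pderiv j f) = pderiv j (pderiv i f) := by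
  classical
  induction f using MvPolynomial.induction_on with
  | C a => simp
  | add p q hp hq => simp [hp, hq]
  | mul_X p k hp =>
    simp only [pderiv_mul, map_add, hp, pderiv_X]
    have h1 : ∀ a b c : ι, pderiv a (Pi.single (M := fun _ => MP ι) b 1 c) = 0 := by
      intro a b c
      by_cases h : c = b
      · subst h; simp
      · simp [Pi.single_eq_of_ne h]
    rw [h1, h1]; ring
lemma pd_X [DecidableEq ι] (i j : ι) : pderiv i (X j : MP ι) = if i = j then 1 else 0 := by
  rw [pderiv_X, Pi.single_apply]; simp [eq_comm]
lemma pd_ds [DecidableEq ι] (i j : ι) (f : MP ι) :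
    pderiv i (ds j f) = ds j (pderiv i f) + if i = j then f else 0 := by
  simp only [ds_apply, map_sub, pderiv_mul, pd_X, pd_comm i j]
  split_ifs <;> ring
lemma ds_comm (i j : ι) (f : MP ι) : ds i (ds j f) = ds j (ds i f) := by
  classical
  simp only [ds_apply, map_sub, pderiv_mul, pd_X, pd_comm i j]
  by_cases h : i = j
  · subst h; ring
  · rw [if_neg h, if_neg (Ne.symm h)]; ring
noncomputable def H : ℕ -> Submodule RR (MP ι)
  | 0 => Submodule.span RR {1}
  | m + 1 => ⨆ i, (H m).map (ds i)
lemma mem_H0 {f : MP ι} : f ∈ H 0 ↔ ∃ c : RR, f = C c := by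
  rw [H, Submodule.mem_span_singleton]
  constructor
  · rintro ⟨c, rfl⟩; exact ⟨c, by rw [smul_eq_C_mul, mul_one]⟩
  · rintro ⟨c, rfl⟩; exact ⟨c, by rw [smul_eq_C_mul, mul_one]⟩
lemma ds_mem {m : ℕ} (i : ι) {f : MP ι} (h : f ∈ H m) : ds i f ∈ H (m + 1) :=
  Submodule.mem_iSup_of_mem i (Submodule.mem_map_of_mem h)
lemma H_ind {m : ℕ} {P : MP ι -> Prop} (h0 : P 0)
    (ha : ∀ f g, P f -> P g -> P (f + g)) (hd : ∀ i, ∀ f ∈ H m, P (ds i f)) :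
    ∀ f ∈ H (m + 1), P f := by
  intro f hf
  refine Submodule.iSup_induction (fun i => (H m).map (ds i)) (motive := P) hf ?_ h0 ha
  rintro i _ ⟨g, hg, rfl⟩
  exact hd i g hg
lemma pd_H0 {f : MP ι} (h : f ∈ H 0) (i : ι) : pderiv i f = 0 := by
  obtain ⟨c, rfl⟩ := mem_H0.1 h; simp
lemma pd_mem {m : ℕ} (i : ι) : ∀ {f : MP ι}, f ∈ H (m + 1) -> pderiv i f ∈ H m := by
  classical
  induction m with
  | zero =>
    intro f hf
    refine H_ind (P := fun f => pderiv i f ∈ H 0) (by simp) (fun f g h1 h2 => by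
      rw [map_add]; exact add_mem h1 h2) (fun j g hg => ?_) f hf
    rw [pd_ds, pd_H0 hg, map_zero, zero_add]
    split_ifs
    exacts [hg, zero_mem _]
  | succ m ih =>
    intro f hf
    refine H_ind (P := fun f => pderiv i f ∈ H (m+1)) (by simp) (fun f g h1 h2 => by
      rw [map_add]; exact add_mem h1 h2) (fun j g hg => ?_) f hf
    rw [pd_ds]
    refine add_mem (ds_mem j (ih hg)) ?_
    split_ifs
    exacts [hg, zero_mem _]
lemma pd_mem' {m : ℕ} (i : ι) {f : MP ι} (h : f ∈ H m) : pderiv i f ∈ H (m - 1) := by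
  cases m with
  | zero => rw [pd_H0 h]; exact zero_mem _
  | succ m => exact pd_mem i h
lemma Nop {m : ℕ} : ∀ {f : MP ι}, f ∈ H m -> ∑ i, ds i (pderiv i f) = C (m : RR) * f := by
  classical
  induction m with
  | zero => intro f hf; simp [pd_H0 hf]
  | succ m ih =>
    intro f hf
    refine H_ind (P := fun f => ∑ i, ds i (pderiv i f) = C ((m + 1 : ℕ) : RR) * f) (by simp)
      (fun f g h1 h2 => by simp only [map_add, sum_add_distrib, h1, h2]; ring)
      (fun j g hg => ?_) f hf
    simp only [pd_ds, map_add, sum_add_distrib, ds_comm _ j]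
    rw [<- map_sum, ih hg]
    have : ∑ i, ds i (if i = j then g else 0) = ds j g := by
      rw [sum_eq_single j] <;> simp +contextual
    rw [this, <- smul_eq_C_mul, map_smul, smul_eq_C_mul]; push_cast; simp; ring
lemma deg_pd (i : ι) {m : ℕ} {f : MP ι} (h : f.totalDegree <= m + 1) :
    (pderiv i f).totalDegree <= m := by
  classical
  rw [f.as_sum, map_sum]
  refine (totalDegree_finsetSum _ _).trans (Finset.sup_le fun s hs => ?_)
  rw [pderiv_monomial]
  by_cases hs0 : s i = 0
  · simp [hs0]
  refine (totalDegree_monomial_le _ _).trans ?_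
  have h1 := le_totalDegree hs
  have h2 : (s - Finsupp.single i 1) + Finsupp.single i 1 = s := by
    ext j
    by_cases hj : i = j
    · subst hj; simp; omega
    · simp [hj]
  have h3 : s.degree <= m + 1 := by
    rw [Finsupp.degree_eq_sum]; rw [Finsupp.sum_fintype _ _ (fun _ => rfl)] at h1; omega
  have h4 := congrArg Finsupp.degree h2
  rw [map_add, Finsupp.degree_single] at h4
  have h5 : (s - Finsupp.single i 1).degree <= m := by omega
  simpa [Finsupp.degree_eq_sum, Finsupp.sum_fintype] using h5
lemma deg_pd' (i : ι) {m : ℕ} {f : MP ι} (h : f.totalDegree <= m) :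
    (pderiv i f).totalDegree <= m - 1 := by
  cases m with
  | zero =>
    rw [totalDegree_eq_zero_iff_eq_C.1 (Nat.le_zero.1 h)]; simp
  | succ m => exact deg_pd i h
lemma deg_H {m : ℕ} : ∀ {f : MP ι}, f ∈ H m -> f.totalDegree <= m := by
  induction m with
  | zero => intro f hf; obtain ⟨c, rfl⟩ := mem_H0.1 hf; simp
  | succ m ih =>
    intro f hf
    refine H_ind (P := fun f => f.totalDegree <= m + 1) (by simp)
      (fun f g h1 h2 => (totalDegree_add _ _).trans (max_le h1 h2)) (fun j g hg => ?_) f hf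
    rw [ds_apply]
    refine (totalDegree_sub _ _).trans (max_le ?_ ?_)
    · refine (totalDegree_mul _ _).trans ?_
      have := ih hg
      rw [totalDegree_X]; omega
    · have := deg_pd' j (ih hg); omega
lemma adj (i : ι) (f g : MP ι) : Ex (ds i f * g) = Ex (f * pderiv i g) := by
  have := stein i (f * g)
  rw [ds_apply, sub_mul, map_sub, mul_assoc, this, pderiv_mul, map_add]; ring
lemma orth_deg {m : ℕ} : ∀ {f g : MP ι}, f ∈ H m -> g.totalDegree < m -> Ex (f * g) = 0 := by
  induction m with
  | zero => intro f g _ h; omega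
  | succ m ih =>
    intro f g hf hg
    refine H_ind (P := fun f => Ex (f * g) = 0) (by simp)
      (fun f g h1 h2 => by simp only [add_mul, map_add, h1, h2, add_zero]) (fun j f' hf' => ?_) f hf
    rw [adj]
    rcases Nat.eq_zero_or_pos m with rfl | hm
    · rw [totalDegree_eq_zero_iff_eq_C.1 (show g.totalDegree = 0 by omega)]; simp
    · exact ih hf' (by have := deg_pd' j (Nat.lt_succ_iff.1 hg); omega)
lemma orth {m l : ℕ} {f g : MP ι} (hf : f ∈ H m) (hg : g ∈ H l) (h : m ≠ l) :
    Ex (f * g) = 0 := by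
  rcases lt_or_gt_of_ne h with h | h
  · rw [mul_comm]; exact orth_deg hg ((deg_H hf).trans_lt h)
  · exact orth_deg hf ((deg_H hg).trans_lt h)
noncomputable def Wm : ℕ -> Submodule RR (MP ι)
  | 0 => H 0
  | m + 1 => Wm m ⊔ H (m + 1)
lemma H_le_Wm (m : ℕ) : (H m : Submodule RR (MP ι)) <= Wm m := by
  cases m with
  | zero => exact le_rfl
  | succ m => exact le_sup_right
lemma Wm_mono {m l : ℕ} (h : m <= l) : (Wm m : Submodule RR (MP ι)) <= Wm l := by
  induction h with
  | refl => exact le_rfl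
  | step _ ih => exact ih.trans le_sup_left
lemma X_mul_H {m : ℕ} (i : ι) {f : MP ι} (h : f ∈ H m) : X i * f ∈ Wm (m + 1) := by
  have : X i * f = ds i f + pderiv i f := by rw [ds_apply]; ring
  rw [this]
  refine add_mem (H_le_Wm _ (ds_mem i h)) ?_
  exact Wm_mono (by omega) (H_le_Wm _ (pd_mem' i h))
lemma X_mul_Wm {m : ℕ} (i : ι) : ∀ {f : MP ι}, f ∈ Wm m -> X i * f ∈ Wm (m + 1) := by
  induction m with
  | zero => intro f hf; exact X_mul_H i hf
  | succ m ih =>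
    intro f hf
    obtain ⟨a, ha, b, hb, rfl⟩ := Submodule.mem_sup.1 hf
    rw [mul_add]
    exact add_mem (Wm_mono (by omega) (ih ha)) (X_mul_H i hb)
lemma C_mem_Wm (m : ℕ) (c : RR) : (C c : MP ι) ∈ Wm m :=
  Wm_mono (Nat.zero_le m) (mem_H0.2 ⟨c, rfl⟩)
lemma monomial_mem_Wm (K : ℕ) : ∀ (s : ι →₀ ℕ) (c : RR), s.degree <= K -> monomial s c ∈ Wm (ι := ι) K := by
  induction K with
  | zero =>
    intro s c h
    rw [(Finsupp.degree_eq_zero_iff s).1 (by omega)]; exact C_mem_Wm 0 c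
  | succ K ih =>
    intro s c h
    by_cases hs : s = 0
    · rw [hs]; exact C_mem_Wm _ c
    obtain ⟨i, hi⟩ : ∃ i, s i ≠ 0 := by
      by_contra hcon; push Not at hcon; exact hs (Finsupp.ext hcon)
    have h2 : Finsupp.single i 1 + (s - Finsupp.single i 1) = s :=
      add_tsub_cancel_of_le (by simpa using Nat.one_le_iff_ne_zero.2 hi)
    have h3 : monomial s c = X i * monomial (s - Finsupp.single i 1) c := by
      rw [X, monomial_mul, one_mul, h2]
    rw [h3]
    refine X_mul_Wm i (ih _ _ ?_)
    have h4 := congrArg Finsupp.degree h2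
    rw [map_add, Finsupp.degree_single] at h4; omega
lemma mem_Wm {K : ℕ} {f : MP ι} (h : f.totalDegree <= K) : f ∈ Wm K := by
  rw [f.as_sum]
  refine sum_mem fun s hs => monomial_mem_Wm K s _ ?_
  refine le_trans ?_ ((le_totalDegree hs).trans h)
  rw [Finsupp.degree_eq_sum, Finsupp.sum_fintype _ _ (fun _ => rfl)]
lemma decomp {K : ℕ} {f : MP ι} (h : f.totalDegree <= K) :
    ∃ c : ℕ -> MP ι, (∀ m, c m ∈ H m) ∧ f = ∑ m ∈ range (K + 1), c m := by
  have : ∀ K, ∀ f ∈ Wm (ι := ι) K, ∃ c : ℕ -> MP ι, (∀ m, c m ∈ H m) ∧ f = ∑ m ∈ range (K + 1), c m := by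
    intro K
    induction K with
    | zero =>
      intro f hf
      refine ⟨fun m => if m = 0 then f else 0, fun m => ?_, by simp⟩
      dsimp only
      split_ifs with h
      · subst h; exact hf
      · exact zero_mem _
    | succ K ih =>
      intro f hf
      obtain ⟨a, ha, b, hb, rfl⟩ := Submodule.mem_sup.1 hf
      obtain ⟨c, hc, hs⟩ := ih a ha
      refine ⟨fun m => if m = K + 1 then b else c m, fun m => ?_, ?_⟩
      · dsimp only
        split_ifs with h
        · subst h; exact hb
        · exact hc m
      · rw [Finset.sum_range_succ, if_pos rfl, hs]
        congr 1
        refine sum_congr rfl fun m hm => ?_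
        rw [if_neg (by have := mem_range.1 hm; omega)]
  exact this K f (mem_Wm h)
lemma H_dir {m : ℕ} {f : MP ι} (hf : f ∈ H m) (g : MP ι) :
    ∑ i, Ex (pderiv i f * pderiv i g) = m * Ex (f * g) := by
  rw [<- Ex_C_mul, <- mul_assoc, <- Nop hf, sum_mul, map_sum]
  exact sum_congr rfl fun i _ => (adj i _ _).symm
lemma Ex_sq_nonneg (f : MP ι) : 0 <= Ex (f * f) :=
  Ex_nonneg fun x => by rw [map_mul]; exact mul_self_nonneg _
noncomputable def nr (f : MP ι) : RR := √(Ex (f * f))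
lemma nr_nonneg (f : MP ι) : 0 <= nr f := sqrt_nonneg _
lemma nr_sq (f : MP ι) : nr f ^ 2 = Ex (f * f) := sq_sqrt (Ex_sq_nonneg f)
lemma nr_zero : nr (0 : MP ι) = 0 := by simp [nr]
lemma nr_C_mul (c : RR) (f : MP ι) : nr (C c * f) = |c| * nr f := by
  rw [nr, show C c * f * (C c * f) = C (c * c) * (f * f) by rw [C_mul]; ring, Ex_C_mul,
    sqrt_mul (mul_self_nonneg c), Real.sqrt_mul_self_eq_abs, nr]
lemma nr_C (c : RR) : nr (C c : MP ι) = |c| := by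
  rw [nr, <- C_mul, Ex_C, Real.sqrt_mul_self_eq_abs]
lemma nr_neg (f : MP ι) : nr (-f) = nr f := by rw [nr, neg_mul_neg, nr]
lemma cs_sq (f g : MP ι) : Ex (f * g) ^ 2 <= Ex (f * f) * Ex (g * g) := by
  have h : ∀ t : RR, 0 <= Ex (g * g) * (t * t) + (2 * Ex (f * g)) * t + Ex (f * f) := by
    intro t
    have := Ex_sq_nonneg (f + C t * g)
    rw [show (f + C t * g) * (f + C t * g) = f * f + C (2 * t) * (f * g) + C (t * t) * (g * g) by
      rw [C_mul, C_mul]; simp only [map_ofNat]; ring] at this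
    rw [map_add, map_add, Ex_C_mul, Ex_C_mul] at this
    linarith
  have := discrim_le_zero h
  rw [discrim] at this
  nlinarith
lemma cs (f g : MP ι) : |Ex (f * g)| <= nr f * nr g := by
  rw [nr, nr, <- sqrt_mul (Ex_sq_nonneg f)]
  exact Real.abs_le_sqrt (cs_sq f g)
lemma nr_add (f g : MP ι) : nr (f + g) <= nr f + nr g := by
  refine abs_le_of_sq_le_sq' ?_ (add_nonneg (nr_nonneg _) (nr_nonneg _)) |>.2
  rw [nr_sq, show (f + g) * (f + g) = f * f + (f * g + f * g) + g * g by ring]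
  simp only [map_add]
  rw [<- nr_sq, <- nr_sq]
  have := (abs_le.1 (cs f g)).2
  nlinarith
lemma nr_sub (f g : MP ι) : nr (f - g) <= nr f + nr g := by
  rw [sub_eq_add_neg, <- nr_neg g]; exact nr_add _ _
lemma Ex_comp_sq {c : ℕ -> MP ι} (hc : ∀ m, c m ∈ H m) (s : Finset ℕ) :
    Ex ((∑ m ∈ s, c m) * ∑ m ∈ s, c m) = ∑ m ∈ s, Ex (c m * c m) := by
  rw [Finset.sum_mul_sum, map_sum]
  refine sum_congr rfl fun m hm => ?_
  rw [map_sum, sum_eq_single m]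
  · intro l _ hl; exact orth (hc m) (hc l) hl.symm
  · exact fun h => absurd hm h
lemma nr_comp_le {c : ℕ -> MP ι} (hc : ∀ m, c m ∈ H m) {s t : Finset ℕ} (h : t ⊆ s) :
    nr (∑ m ∈ t, c m) <= nr (∑ m ∈ s, c m) := by
  refine sqrt_le_sqrt ?_
  rw [Ex_comp_sq hc, Ex_comp_sq hc]
  exact Finset.sum_le_sum_of_subset_of_nonneg h fun _ _ _ => Ex_sq_nonneg _
lemma nr_comp_le' {c : ℕ -> MP ι} (hc : ∀ m, c m ∈ H m) {s : Finset ℕ} {l : ℕ} (h : l ∈ s) :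
    nr (c l) <= nr (∑ m ∈ s, c m) := by
  simpa using nr_comp_le hc (Finset.singleton_subset_iff.2 h)
lemma young {a b : RR} (ha : 0 <= a) (hb : 0 <= b) {T : ℕ} (hT : 1 <= T) :
    T * (a ^ (T - 1) * b) <= (T - 1) * a ^ T + b ^ T := by
  obtain ⟨n, rfl⟩ : ∃ n, T = n + 1 := ⟨T - 1, by omega⟩
  clear hT
  simp only [Nat.add_sub_cancel, Nat.cast_add, Nat.cast_one, add_sub_cancel_right]
  induction n with
  | zero => simp
  | succ n ih =>
    have h2 : 0 <= (a - b) * (a ^ (n + 1) - b ^ (n + 1)) := by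
      rcases le_total a b with h | h
      · exact mul_nonneg_of_nonpos_of_nonpos (by linarith) (by linarith [pow_le_pow_left₀ ha h (n+1)])
      · exact mul_nonneg (by linarith) (by linarith [pow_le_pow_left₀ hb h (n+1)])
    have h3 := mul_le_mul_of_nonneg_left ih ha
    push_cast at *
    simp only [pow_succ] at *
    nlinarith
lemma hyper_step {D : ℕ} {κ : Type} [Fintype κ] (F : κ -> MP ι)
    (hF : ∀ a, F a ∈ H (D + 1)) {T : ℕ} (hT : 1 <= T) :
    (D + 1) * Ex ((∑ a, F a * F a) ^ T) <=
      2 * T * Ex ((∑ a, F a * F a) ^ (T - 1) * ∑ a : κ × ι, pderiv a.2 (F a.1) * pderiv a.2 (F a.1)) := by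
  obtain ⟨n, rfl⟩ : ∃ n, T = n + 1 := ⟨T - 1, by omega⟩
  set u := ∑ a, F a * F a with hu
  set v := ∑ a : κ × ι, pderiv a.2 (F a.1) * pderiv a.2 (F a.1) with hv
  have e1 : (D + 1) * Ex (u ^ (n + 1)) = ∑ a, ∑ i, Ex (pderiv i (F a) * pderiv i (F a * u ^ n)) := by
    have : u ^ (n + 1) = ∑ a, F a * (F a * u ^ n) := by
      rw [pow_succ', hu, sum_mul]
      exact sum_congr rfl fun a _ => by ring
    rw [this, map_sum, mul_sum]
    refine sum_congr rfl fun a _ => ?_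
    rw [H_dir (hF a)]; push_cast; ring
  rw [e1]
  simp only [<- map_sum]
  rw [show 2 * ((n + 1 : ℕ) : RR) * Ex (u ^ (n + 1 - 1) * v) = Ex (C (2 * ((n + 1 : ℕ) : RR)) * (u ^ (n + 1 - 1) * v)) by
    rw [Ex_C_mul]]
  refine Ex_mono fun x => ?_
  have hdu : ∀ i, pderiv i u = 2 * ∑ b, F b * pderiv i (F b) := by
    intro i
    rw [hu, map_sum, mul_sum]
    exact sum_congr rfl fun b _ => by rw [pderiv_mul]; ring
  have hU : eval x u = ∑ a, eval x (F a) ^ 2 := by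
    rw [hu, map_sum]; exact sum_congr rfl fun a _ => by rw [map_mul, sq]
  have hV : eval x v = ∑ i, ∑ a, eval x (pderiv i (F a)) ^ 2 := by
    rw [hv, map_sum, Fintype.sum_prod_type_right]
    exact sum_congr rfl fun i _ => sum_congr rfl fun a _ => by rw [map_mul, sq]
  have hU0 : 0 <= eval x u := hU ▸ sum_nonneg fun a _ => sq_nonneg _
  have hV0 : 0 <= eval x v := hV ▸ sum_nonneg fun i _ => sum_nonneg fun a _ => sq_nonneg _
  have key : eval x (∑ a, ∑ i, pderiv i (F a) * pderiv i (F a * u ^ n)) =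
      eval x u ^ n * eval x v + 2 * n * eval x u ^ (n - 1) * ∑ i, (∑ a, eval x (F a) * eval x (pderiv i (F a))) ^ 2 := by
    rw [sum_comm, map_sum, hV, mul_sum, mul_sum, <- sum_add_distrib]
    refine sum_congr rfl fun i _ => ?_
    rw [map_sum, sq (∑ a, eval x (F a) * eval x (pderiv i (F a)))]
    conv_rhs => rw [sum_mul, mul_sum, mul_sum, <- sum_add_distrib]
    refine sum_congr rfl fun a _ => ?_
    rw [pderiv_mul, pderiv_pow, hdu]
    simp only [map_mul, map_add, map_pow, map_natCast, map_sum, map_ofNat]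
    ring
  rw [key, map_mul, eval_C, map_mul, map_pow, Nat.add_sub_cancel]
  have hcs : ∑ i, (∑ a, eval x (F a) * eval x (pderiv i (F a))) ^ 2 <= eval x u * eval x v := by
    rw [hU, hV, mul_sum]
    exact sum_le_sum fun i _ => Finset.sum_mul_sq_le_sq_mul_sq _ _ _
  rcases Nat.eq_zero_or_pos n with rfl | hn
  · simp; linarith
  · have e2 : eval x u ^ n = eval x u ^ (n - 1) * eval x u := by
      rw [<- pow_succ]; congr 1; omega
    have := mul_le_mul_of_nonneg_left hcs (by positivity : 0 <= 2 * (n:RR) * eval x u ^ (n - 1))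
    have h4 : 0 <= eval x u ^ n * eval x v := by positivity
    push_cast
    calc _ <= eval x u ^ n * eval x v + 2 * n * eval x u ^ (n - 1) * (eval x u * eval x v) := by linarith
      _ = eval x u ^ n * eval x v + 2 * n * (eval x u ^ n * eval x v) := by rw [e2]; ring
      _ <= _ := by linarith
lemma hyper_fam {T : ℕ} (hT : 1 <= T) (D : ℕ) : ∀ {κ : Type} [Fintype κ] (F : κ -> MP ι),
    (∀ a, F a ∈ H D) -> Ex ((∑ a, F a * F a) ^ T) <= ((2 * T) ^ D * Ex (∑ a, F a * F a)) ^ T := by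
  induction D with
  | zero =>
    intro κ _ F hF
    choose c hc using fun a => mem_H0.1 (hF a)
    have : ∑ a, F a * F a = C (∑ a, c a * c a) := by simp [hc]
    rw [this, <- C_pow, Ex_C, Ex_C]; simp
  | succ D ih =>
    intro κ _ F hF
    have h1 := hyper_step F hF hT
    have h2 := ih (fun a : κ × ι => pderiv a.2 (F a.1)) (fun a => pd_mem a.2 (hF a.1))
    have h3 : Ex (∑ a : κ × ι, pderiv a.2 (F a.1) * pderiv a.2 (F a.1)) = (D + 1) * Ex (∑ a, F a * F a) := by
      rw [Fintype.sum_prod_type, map_sum, map_sum, mul_sum]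
      refine sum_congr rfl fun a _ => ?_
      rw [map_sum]
      have := H_dir (hF a) (F a)
      push_cast at this; exact this
    rw [h3] at h2
    set u := ∑ a, F a * F a with hu
    set v := ∑ a : κ × ι, pderiv a.2 (F a.1) * pderiv a.2 (F a.1) with hv
    have hU0 : ∀ x, 0 <= eval x u := fun x => by
      rw [hu, map_sum]; exact sum_nonneg fun a _ => by rw [map_mul]; exact mul_self_nonneg _
    have hV0 : ∀ x, 0 <= eval x v := fun x => by
      rw [hv, map_sum]; exact sum_nonneg fun a _ => by rw [map_mul]; exact mul_self_nonneg _
    set q : RR := 2 * T / (D + 1) with hq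
    have hD : (0:RR) < D + 1 := by positivity
    have hT0 : (0:RR) < T := by exact_mod_cast hT
    have hq0 : 0 < q := by positivity
    have hy : T * (q * Ex (u ^ (T - 1) * v)) <= (T - 1) * Ex (u ^ T) + q ^ T * Ex (v ^ T) := by
      rw [<- Ex_C_mul, <- Ex_C_mul, <- Ex_C_mul, <- Ex_C_mul, <- map_add]
      refine Ex_mono fun x => ?_
      simp only [map_mul, map_add, map_pow, eval_C, <- mul_pow]
      have := young (hU0 x) (mul_nonneg hq0.le (hV0 x)) hT
      linarith
    have h1' : Ex (u ^ T) <= q * Ex (u ^ (T - 1) * v) := by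
      rw [hq, div_mul_eq_mul_div, le_div_iff₀ hD]; linarith
    have h4 : Ex (u ^ T) <= q ^ T * Ex (v ^ T) := by
      nlinarith [mul_le_mul_of_nonneg_left h1' hT0.le]
    refine h4.trans ((mul_le_mul_of_nonneg_left h2 (by positivity)).trans_eq ?_)
    rw [<- mul_pow]; congr 1
    rw [hq]; field_simp; ring
lemma hyper_H {T : ℕ} (hT : 1 <= T) {D : ℕ} {f : MP ι} (hf : f ∈ H D) :
    Ex (f ^ (2 * T)) <= ((2 * T) ^ D * Ex (f * f)) ^ T := by
  have := hyper_fam hT D (fun _ : Unit => f) (fun _ => hf)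
  simpa [<- sq, <- pow_mul] using this
lemma hyper {T : ℕ} (hT : 1 <= T) {K : ℕ} {f : MP ι} (hf : f.totalDegree <= K) :
    Ex (f ^ (2 * T)) <= ((K + 1) ^ 2 * (2 * T) ^ K * Ex (f * f)) ^ T := by
  obtain ⟨c, hc, hs⟩ := decomp hf
  have hT0 : (1:RR) <= T := by exact_mod_cast hT
  have h0 : Ex (f ^ (2 * T)) <= Ex (C ((K + 1 : RR) ^ (2 * T - 1)) * ∑ m ∈ range (K + 1), c m ^ (2 * T)) := by
    refine Ex_mono fun x => ?_
    simp only [map_mul, map_pow, map_sum, map_add, map_natCast, map_one]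
    have h := pow_sum_le_card_mul_sum_pow (s := range (K + 1)) (f := fun m => |eval x (c m)|) (fun i _ => abs_nonneg _) (2 * T - 1)
    rw [show 2 * T - 1 + 1 = 2 * T by omega] at h
    simp only [card_range, Even.pow_abs (even_two_mul T)] at h
    refine le_trans ?_ (by exact_mod_cast h)
    rw [<- Even.pow_abs (even_two_mul T), hs, map_sum]
    exact pow_le_pow_left₀ (abs_nonneg _) (abs_sum_le_sum_abs _ _) _
  rw [Ex_C_mul, map_sum] at h0
  have h1 : ∀ m ∈ range (K + 1), Ex (c m ^ (2 * T)) <= ((2 * T) ^ K * Ex (f * f)) ^ T := by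
    intro m hm
    refine (hyper_H hT (hc m)).trans (pow_le_pow_left₀ (mul_nonneg (by positivity) (Ex_sq_nonneg _)) ?_ _)
    refine mul_le_mul ?_ ?_ (Ex_sq_nonneg _) (by positivity)
    · exact pow_le_pow_right₀ (by linarith) (by have := mem_range.1 hm; omega)
    · rw [hs, Ex_comp_sq hc]
      exact single_le_sum (f := fun m => Ex (c m * c m)) (fun _ _ => Ex_sq_nonneg _) hm
  refine h0.trans ((mul_le_mul_of_nonneg_left (sum_le_sum h1) (by positivity)).trans_eq ?_)
  rw [sum_const, card_range, nsmul_eq_mul, <- mul_assoc]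
  push_cast
  rw [<- pow_succ, show 2 * T - 1 + 1 = 2 * T by omega, pow_mul, <- mul_pow, mul_assoc]
noncomputable def Kc (K : ℕ) : RR := (K + 1) ^ 2 * 4 ^ K
lemma Kc_ge (K : ℕ) : 1 <= Kc K := by
  unfold Kc
  have h1 : (1:RR) <= (K + 1) ^ 2 := one_le_pow₀ (by have : (0:RR) <= K := K.cast_nonneg
                                                     linarith)
  have h2 : (1:RR) <= 4 ^ K := one_le_pow₀ (by norm_num)
  nlinarith
lemma nr_mul {K : ℕ} {f g : MP ι} (hf : f.totalDegree <= K) (hg : g.totalDegree <= K) :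
    nr (f * g) <= Kc K * nr f * nr g := by
  have h4 : ∀ f : MP ι, f.totalDegree <= K -> Ex (f * f * (f * f)) <= (Kc K * nr f ^ 2) ^ 2 := by
    intro f hf
    have := hyper (T := 2) (by norm_num) hf
    rw [show f * f * (f * f) = f ^ (2 * 2) by ring, nr_sq, Kc]
    norm_num at this ⊢
    exact this
  have h := cs (f * f) (g * g)
  have e : Ex (f * f * (g * g)) = nr (f * g) ^ 2 := by rw [nr_sq]; congr 1; ring
  rw [e, abs_of_nonneg (sq_nonneg _)] at h
  have hk := Kc_ge K
  have b : ∀ f : MP ι, f.totalDegree <= K -> nr (f * f) <= Kc K * nr f ^ 2 := fun f hf =>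
    Real.sqrt_le_iff.2 ⟨by have := nr_nonneg f; positivity, h4 f hf⟩
  refine abs_le_of_sq_le_sq' ?_ (mul_nonneg (mul_nonneg (by linarith) (nr_nonneg _)) (nr_nonneg _)) |>.2
  refine h.trans ((mul_le_mul (b f hf) (b g hg) (nr_nonneg _) (by positivity)).trans_eq (by ring))
noncomputable def evx (x : ι -> RR) : MP (ι ⊕ ι) →ₐ[RR] MP ι :=
  aeval (Sum.elim (fun i => C (x i)) X)
lemma evx_inr (x : ι -> RR) (p : MP ι) : evx x (rename Sum.inr p) = p := by
  rw [evx, aeval_rename]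
  exact aeval_X_left_apply p
lemma evx_inl (x : ι -> RR) (p : MP ι) : evx x (rename Sum.inl p) = C (eval x p) := by
  rw [evx, aeval_rename]
  induction p using MvPolynomial.induction_on with
  | C a => simp
  | add p q hp hq => rw [map_add, hp, hq, map_add, C_add]
  | mul_X p k hp => rw [map_mul, hp, map_mul, C_mul]; simp
lemma exists_Ey (G : MP (ι ⊕ ι)) :
    ∃ g : MP ι, (∀ x, eval x g = Ex (evx x G)) ∧ Ex g = Ex G := by
  classical
  induction G using MvPolynomial.induction_on' with
  | add p q hp hq =>
    obtain ⟨a, ha, ha'⟩ := hp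
    obtain ⟨b, hb, hb'⟩ := hq
    exact ⟨a + b, fun x => by simp [ha, hb], by simp [ha', hb']⟩
  | monomial m c =>
    refine ⟨monomial (Finsupp.equivFunOnFinite.symm fun i => m (Sum.inl i)) (c * ∏ i, gm (m (Sum.inr i))), fun x => ?_, ?_⟩
    · have : evx x (monomial m c) = monomial (Finsupp.equivFunOnFinite.symm fun i => m (Sum.inr i)) (c * ∏ i, x i ^ m (Sum.inl i)) := by
        rw [evx, aeval_monomial, Finsupp.prod_fintype _ _ (fun _ => pow_zero _), Fintype.prod_sum_type,
          monomial_eq, Finsupp.prod_fintype _ _ (fun _ => pow_zero _)]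
        simp [mul_assoc, map_prod]
      rw [this, Ex_monomial, eval_monomial, Finsupp.prod_fintype _ _ (fun _ => pow_zero _)]
      simp; ring
    · rw [Ex_monomial, Ex_monomial, Fintype.prod_sum_type]
      simp; ring
noncomputable def Ey (G : MP (ι ⊕ ι)) : MP ι := (exists_Ey G).choose
lemma eval_Ey (G : MP (ι ⊕ ι)) (x : ι -> RR) : eval x (Ey G) = Ex (evx x G) :=
  (exists_Ey G).choose_spec.1 x
lemma Ex_Ey (G : MP (ι ⊕ ι)) : Ex (Ey G) = Ex G := (exists_Ey G).choose_spec.2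
noncomputable def rot (c s : RR) : MP ι →ₐ[RR] MP (ι ⊕ ι) :=
  aeval fun i => C c * X (Sum.inl i) + C s * X (Sum.inr i)
lemma rot_X (c s : RR) (i : ι) : rot c s (X i) = C c * X (Sum.inl i) + C s * X (Sum.inr i) := by
  simp [rot]
lemma pd_rot_inr (c s : RR) (i : ι) (f : MP ι) :
    pderiv (Sum.inr i) (rot c s f) = C s * rot c s (pderiv i f) := by
  classical
  induction f using MvPolynomial.induction_on with
  | C a => simp [rot]
  | add p q hp hq => simp [hp, hq, mul_add]
  | mul_X p k hp =>
    simp only [map_mul, map_add, pderiv_mul, hp, rot_X, pd_X, pderiv_C]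
    by_cases h : i = k <;> simp [h] <;> ring
lemma pd_rot_inl (c s : RR) (i : ι) (f : MP ι) :
    pderiv (Sum.inl i) (rot c s f) = C c * rot c s (pderiv i f) := by
  classical
  induction f using MvPolynomial.induction_on with
  | C a => simp [rot]
  | add p q hp hq => simp [hp, hq, mul_add]
  | mul_X p k hp =>
    simp only [map_mul, map_add, pderiv_mul, hp, rot_X, pd_X, pderiv_C]
    by_cases h : i = k <;> simp [h] <;> ring
lemma Ex_H_pos {m : ℕ} (hm : m ≠ 0) {f : MP ι} (hf : f ∈ H m) : Ex f = 0 := by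
  rw [<- mul_one f]; exact orth hf (mem_H0.2 ⟨1, rfl⟩) hm
lemma rot_inv {c s : RR} (h : c ^ 2 + s ^ 2 = 1) (f : MP ι) : Ex (rot c s f) = Ex f := by
  obtain ⟨a, ha, hs⟩ := decomp (le_refl f.totalDegree)
  rw [hs, map_sum, map_sum, map_sum]
  refine sum_congr rfl fun m _ => ?_
  cases m with
  | zero => obtain ⟨b, hb⟩ := mem_H0.1 (ha 0); rw [hb]; simp [rot, Ex_C]
  | succ m =>
    rw [Ex_H_pos (Nat.succ_ne_zero m) (ha _)]
    refine H_ind (P := fun f => Ex (rot c s f) = 0) (by simp)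
      (fun f g h1 h2 => by simp only [map_add, h1, h2, add_zero]) (fun i q _ => ?_) _ (ha (m + 1))
    rw [ds_apply, map_sub, map_mul, rot_X, map_sub, add_mul, map_add, mul_assoc, mul_assoc,
      Ex_C_mul, Ex_C_mul, stein, stein, pd_rot_inr, pd_rot_inl, Ex_C_mul, Ex_C_mul]
    linear_combination (Ex (rot c s (pderiv i q))) * h
lemma mehler {c s : RR} (h : c ^ 2 + s ^ 2 = 1) (d : ℕ) : ∀ {p : MP ι}, p ∈ H d ->
    ∀ f, Ex (rename Sum.inr p * rot c s f) = s ^ d * Ex (p * f) := by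
  induction d with
  | zero =>
    intro p hp f
    obtain ⟨b, rfl⟩ := mem_H0.1 hp
    rw [rename_C, Ex_C_mul, Ex_C_mul, rot_inv h]; ring
  | succ d ih =>
    intro p hp f
    refine H_ind (P := fun p => Ex (rename Sum.inr p * rot c s f) = s ^ (d + 1) * Ex (p * f)) (by simp)
      (fun f g h1 h2 => by simp only [map_add, add_mul, h1, h2]; ring) (fun i q hq => ?_) p hp
    have : rename (Sum.inr : ι -> ι ⊕ ι) (ds i q) = ds (Sum.inr i) (rename Sum.inr q) := by
      rw [ds_apply, ds_apply, map_sub, map_mul, rename_X, pderiv_rename Sum.inr_injective]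
    rw [this, adj, pd_rot_inr, mul_left_comm, Ex_C_mul, ih hq, adj]; ring
structure RotP (d : ℕ) (p : MP ι) (P : Polynomial (MP (ι ⊕ ι))) : Prop where
  deg : P.natDegree <= d
  top : P.coeff d = rename Sum.inr p
  bot : P.coeff 0 = rename Sum.inl p
  ydeg : ∀ x j, (evx x (P.coeff j)).totalDegree <= j
  ev : ∀ t S : RR, S ≠ 0 -> S ^ 2 = 1 + t ^ 2 -> P.eval (C t) = C (S ^ d) * rot S⁻¹ (t * S⁻¹) p
lemma RotP.add {d : ℕ} {p q : MP ι} {P Q} (hP : RotP d p P) (hQ : RotP d q Q) :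
    RotP d (p + q) (P + Q) where
  deg := (Polynomial.natDegree_add_le _ _).trans (max_le hP.deg hQ.deg)
  top := by simp [hP.top, hQ.top]
  bot := by rw [Polynomial.coeff_add, hP.bot, hQ.bot, map_add]
  ydeg x j := by
    rw [Polynomial.coeff_add, map_add]
    exact (totalDegree_add _ _).trans (max_le (hP.ydeg x j) (hQ.ydeg x j))
  ev t S h1 h2 := by rw [Polynomial.eval_add, hP.ev t S h1 h2, hQ.ev t S h1 h2, map_add]; ring
lemma RotP.zero (d : ℕ) : RotP d (0 : MP ι) 0 where
  deg := by simp
  top := by simp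
  bot := by simp
  ydeg x j := by simp
  ev t S h1 h2 := by simp
lemma ydeg_mul {P Q : Polynomial (MP (ι ⊕ ι))}
    (hP : ∀ x j, (evx x (P.coeff j)).totalDegree <= j) (hQ : ∀ x j, (evx x (Q.coeff j)).totalDegree <= j) :
    ∀ x j, (evx x ((P * Q).coeff j)).totalDegree <= j := by
  intro x j
  rw [Polynomial.coeff_mul, map_sum]
  refine totalDegree_finsetSum_le fun a ha => ?_
  rw [map_mul]
  refine (totalDegree_mul _ _).trans ?_
  have := hP x a.1; have := hQ x a.2; have := Finset.HasAntidiagonal.mem_antidiagonal.1 ha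
  omega
lemma RotP.step {d : ℕ} {q : MP ι} {P Q} (i : ι) (hP : RotP d q P)
    (hQ : (∃ e, d = e + 1 ∧ RotP e (pderiv i q) Q) ∨ (d = 0 ∧ Q = 0 ∧ pderiv i q = 0)) :
    RotP (d + 1) (ds i q) ((PC (X (Sum.inl i)) + PX * PC (X (Sum.inr i))) * P
      - (1 + PX ^ 2) * Q) := by
  set A : Polynomial (MP (ι ⊕ ι)) :=
    PC (X (Sum.inl i)) + PX * PC (X (Sum.inr i)) with hA
  have e1 : ∀ j, (A * P).coeff (j + 1) = X (Sum.inl i) * P.coeff (j + 1) + X (Sum.inr i) * P.coeff j := by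
    intro j
    rw [hA, add_mul, mul_assoc, Polynomial.coeff_add, Polynomial.coeff_C_mul, Polynomial.coeff_X_mul,
      Polynomial.coeff_C_mul]
  have e1' : (A * P).coeff 0 = X (Sum.inl i) * P.coeff 0 := by
    rw [hA, add_mul, mul_assoc, Polynomial.coeff_add, Polynomial.coeff_C_mul]; simp
  have dA : A.natDegree <= 1 := by rw [hA]; compute_degree
  have gA : ∀ x j, (evx x (A.coeff j)).totalDegree <= j := by
    intro x j
    rw [hA, Polynomial.coeff_add]
    rcases j with _ | _ | j
    · simp [evx]
    · simp [evx, Polynomial.coeff_C]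
    · simp [evx, Polynomial.coeff_C]
  have g1 : ∀ x j, (evx x ((1 + PX ^ 2 : Polynomial (MP (ι ⊕ ι))).coeff j)).totalDegree <= j := by
    intro x j
    rw [Polynomial.coeff_add, Polynomial.coeff_one, Polynomial.coeff_X_pow]
    split_ifs <;> simp
    exact (totalDegree_add _ _).trans (by simp)
  have d1 : (1 + PX ^ 2 : Polynomial (MP (ι ⊕ ι))).natDegree <= 2 := by compute_degree
  have pr : ∀ f : MP ι, rename (Sum.inr : ι -> ι ⊕ ι) (ds i f) = X (Sum.inr i) * rename Sum.inr f - rename Sum.inr (pderiv i f) := by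
    intro f; rw [ds_apply, map_sub, map_mul, rename_X]
  have pl : ∀ f : MP ι, rename (Sum.inl : ι -> ι ⊕ ι) (ds i f) = X (Sum.inl i) * rename Sum.inl f - rename Sum.inl (pderiv i f) := by
    intro f; rw [ds_apply, map_sub, map_mul, rename_X]
  have hz : P.coeff (d + 1) = 0 := coeff_eq_zero_of_natDegree_lt (by have := hP.deg; omega)
  have hAe : ∀ t : RR, A.eval (C t) = X (Sum.inl i) + C t * X (Sum.inr i) := by intro t; rw [hA]; simp only [Polynomial.eval_add, Polynomial.eval_mul, Polynomial.eval_C, Polynomial.eval_X]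
  rcases hQ with ⟨e, rfl, hQ⟩ | ⟨rfl, rfl, h0⟩
  · have hz2 : Q.coeff (e + 2) = 0 := coeff_eq_zero_of_natDegree_lt (by have := hQ.deg; omega)
    refine ⟨?_, ?_, ?_, ?_, ?_⟩
    · refine (Polynomial.natDegree_sub_le _ _).trans (max_le ?_ ?_)
      · exact natDegree_mul_le.trans (by have := hP.deg; omega)
      · exact natDegree_mul_le.trans (by have := hQ.deg; omega)
    · rw [Polynomial.coeff_sub, e1, hz, hP.top, add_mul, one_mul, Polynomial.coeff_add,
        mul_comm (PX ^ 2), Polynomial.coeff_mul_X_pow, hz2, hQ.top, pr]; ring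
    · rw [Polynomial.coeff_sub, e1', hP.bot, Polynomial.mul_coeff_zero, hQ.bot, pl]; simp
    · intro x j
      rw [Polynomial.coeff_sub, map_sub]
      exact (totalDegree_sub _ _).trans (max_le (ydeg_mul gA hP.ydeg x j) (ydeg_mul g1 hQ.ydeg x j))
    · intro t S h1 h2
      rw [Polynomial.eval_sub, Polynomial.eval_mul, Polynomial.eval_mul, hP.ev t S h1 h2, hQ.ev t S h1 h2,
        hAe, ds_apply, map_sub, map_mul, rot_X]
      simp only [Polynomial.eval_add, Polynomial.eval_one, Polynomial.eval_pow, Polynomial.eval_X]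
      rw [show (1 + C t ^ 2 : MP (ι ⊕ ι)) = C (S ^ 2) by rw [h2]; simp]
      have h3 : (C S * C S⁻¹ : MP (ι ⊕ ι)) = 1 := by rw [<- C_mul, mul_inv_cancel₀ h1, C_1]
      simp only [C_mul, C_pow]
      linear_combination (-(C S ^ (e+1)) * X (Sum.inl i) * (rot S⁻¹ (t * S⁻¹)) q
        - (C S ^ (e+1)) * C t * X (Sum.inr i) * (rot S⁻¹ (t * S⁻¹)) q) * h3
  · refine ⟨?_, ?_, ?_, ?_, ?_⟩
    · rw [mul_zero, sub_zero]
      exact natDegree_mul_le.trans (by have := hP.deg; omega)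
    · rw [mul_zero, sub_zero, e1, hz, hP.top, pr, h0]; simp
    · rw [mul_zero, sub_zero, e1', hP.bot, pl, h0]; simp
    · rw [mul_zero, sub_zero]; exact ydeg_mul gA hP.ydeg
    · intro t S h1 h2
      rw [mul_zero, sub_zero, Polynomial.eval_mul, hP.ev t S h1 h2, hAe, ds_apply, h0, sub_zero, map_mul, rot_X]
      have h3 : (C S * C S⁻¹ : MP (ι ⊕ ι)) = 1 := by rw [<- C_mul, mul_inv_cancel₀ h1, C_1]
      simp only [C_mul, C_pow]
      linear_combination (- X (Sum.inl i) * (rot S⁻¹ (t * S⁻¹)) q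
        - C t * X (Sum.inr i) * (rot S⁻¹ (t * S⁻¹)) q) * h3
lemma exists_RotP (d : ℕ) : ∀ {p : MP ι}, p ∈ H d -> ∃ P, RotP d p P := by
  induction d using Nat.strong_induction_on with
  | _ d ih =>
    intro p hp
    cases d with
    | zero =>
      obtain ⟨b, rfl⟩ := mem_H0.1 hp
      refine ⟨PC (C b), ?_, ?_, ?_, ?_, ?_⟩
      · simp
      · simp
      · simp
      · intro x j; rcases j with _ | j <;> simp [evx, Polynomial.coeff_C]
      · intro t S _ _; simp [rot]
    | succ d =>
      refine H_ind (P := fun p => ∃ P, RotP (d + 1) p P) ⟨0, RotP.zero _⟩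
        (fun f g ⟨P, hP⟩ ⟨Q, hQ⟩ => ⟨P + Q, hP.add hQ⟩) (fun i q hq => ?_) p hp
      obtain ⟨P, hP⟩ := ih d (by omega) hq
      cases d with
      | zero => exact ⟨_, hP.step i (Q := 0) (Or.inr ⟨rfl, rfl, pd_H0 hq i⟩)⟩
      | succ e =>
        obtain ⟨Q, hQ⟩ := ih e (by omega) (pd_mem i hq)
        exact ⟨_, hP.step i (Or.inl ⟨e, rfl, hQ⟩)⟩
lemma lagr {d : ℕ} (v : Fin (d + 1) -> RR) (hv : Function.Injective v) : ∃ M : Fin (d + 1) -> Fin (d + 1) -> RR,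
    ∀ (R : Type) [CommRing R] [Algebra RR R] (P : Polynomial R), P.natDegree <= d ->
      ∀ j : Fin (d + 1), P.coeff j = ∑ a, algebraMap RR R (M j a) * P.eval (algebraMap RR R (v a)) := by
  have hdet : IsUnit (Matrix.vandermonde v).det :=
    isUnit_iff_ne_zero.2 (Matrix.det_vandermonde_ne_zero_iff.2 hv)
  refine ⟨fun j a => (Matrix.vandermonde v)⁻¹ j a, fun R _ _ P hP j => ?_⟩
  have hM := Matrix.nonsing_inv_mul _ hdet
  have h2 : ∀ k : Fin (d + 1), ∑ a, (Matrix.vandermonde v)⁻¹ j a * v a ^ (k : ℕ) = if j = k then 1 else 0 := by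
    intro k
    have := congrFun (congrFun hM j) k
    rw [Matrix.mul_apply, Matrix.one_apply] at this
    simpa [Matrix.vandermonde_apply] using this
  have h3 : ∀ a, P.eval (algebraMap RR R (v a)) = ∑ k : Fin (d + 1), P.coeff k * algebraMap RR R (v a ^ (k:ℕ)) := by
    intro a
    rw [Polynomial.eval_eq_sum_range' (Nat.lt_succ_of_le hP), Finset.sum_range]
    simp
  simp only [h3, mul_sum]
  rw [sum_comm]
  have h4 : ∀ k : Fin (d + 1), ∑ a, algebraMap RR R ((Matrix.vandermonde v)⁻¹ j a) * (P.coeff k * algebraMap RR R (v a ^ (k:ℕ)))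
      = P.coeff k * algebraMap RR R (if j = k then 1 else 0) := by
    intro k
    rw [<- h2 k, map_sum, mul_sum]
    refine sum_congr rfl fun a _ => ?_
    rw [map_mul]; ring
  simp only [h4]
  simp
lemma jensen {g : MP ι} (hg : ∀ x, 0 <= eval x g) {T : ℕ} (hT : 1 <= T) : (Ex g) ^ T <= Ex (g ^ T) := by
  set a := Ex g with ha
  have ha0 : 0 <= a := Ex_nonneg hg
  have h := Ex_mono (f := C ((T:RR) * a ^ (T-1)) * g) (g := C (((T:RR) - 1) * a ^ T) + g ^ T) (fun x => by
    have := young ha0 (hg x) hT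
    simp only [map_mul, map_add, eval_C, map_pow]
    linarith)
  rw [Ex_C_mul, map_add, Ex_C, <- ha, mul_assoc, <- pow_succ, Nat.sub_add_cancel hT] at h
  linarith
lemma pow_pm {α : Type*} (s : Finset α) (z : α -> RR) (hz : ∀ i ∈ s, 0 <= z i) {n : ℕ} (hn : 1 <= n) {N : RR} (hN : (s.card : RR) <= N) (hN1 : 1 <= N) :
    (∑ a ∈ s, z a) ^ n <= N ^ n * ∑ a ∈ s, z a ^ n := by
  obtain ⟨n, rfl⟩ : ∃ m, n = m + 1 := ⟨n - 1, by omega⟩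
  refine (pow_sum_le_card_mul_sum_pow hz n).trans ?_
  refine mul_le_mul_of_nonneg_right ?_ (sum_nonneg fun i hi => pow_nonneg (hz i hi) _)
  exact (pow_le_pow_left₀ (by positivity) hN n).trans (pow_le_pow_right₀ hN1 (by omega))
lemma sum_pow_le {α : Type*} (s : Finset α) (z : α -> RR) (hz : ∀ i ∈ s, 0 <= z i) {n : ℕ} (hn : 1 <= n) :
    ∑ a ∈ s, z a ^ n <= (∑ a ∈ s, z a) ^ n := by
  obtain ⟨n, rfl⟩ : ∃ m, n = m + 1 := ⟨n - 1, by omega⟩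
  rw [pow_succ, mul_sum]
  refine sum_le_sum fun i hi => ?_
  rw [pow_succ]
  exact mul_le_mul_of_nonneg_right (pow_le_pow_left₀ (hz i hi) (single_le_sum hz hi) n) (hz i hi)
lemma rotc_bd (d : ℕ) : ∃ K : RR, 1 <= K ∧ ∀ (ι : Type) [Fintype ι] (p : MP ι) P, RotP d p P ->
    ∀ j ≤ d, ∀ T : ℕ, 1 <= T -> Ex ((P.coeff j) ^ (2 * T)) <= K ^ (2 * T) * Ex (p ^ (2 * T)) := by
  obtain ⟨M, hM⟩ := lagr (d := d) (fun a => (a : RR)) (fun a b h => by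
    have h' : ((a:ℕ):RR) = (b:ℕ) := h
    ext; exact_mod_cast h')
  set b : Fin (d+1) -> Fin (d+1) -> RR := fun j a => M j a * √(1 + (a:RR)^2) ^ d with hb
  have hK0 : 0 <= ∑ j, ∑ a, |b j a| := sum_nonneg fun _ _ => sum_nonneg fun _ _ => abs_nonneg _
  refine ⟨1 + (d+1) * ∑ j, ∑ a, |b j a|, by nlinarith [Nat.cast_nonneg (α := RR) d], ?_⟩
  set S := ∑ j, ∑ a, |b j a| with hS
  intro ι _ p P hP j hj T hT
  have h1 := hM _ P hP.deg ⟨j, by omega⟩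
  simp only at h1
  have h2 : ∀ a : Fin (d+1), algebraMap RR (MP (ι ⊕ ι)) (M ⟨j, by omega⟩ a) * P.eval (algebraMap RR _ (a:RR))
      = C (b ⟨j, by omega⟩ a) * rot (√(1 + (a:RR)^2))⁻¹ ((a:RR) * (√(1 + (a:RR)^2))⁻¹) p := by
    intro a
    rw [algebraMap_eq, hP.ev (a:RR) (√(1 + (a:RR)^2)) (by positivity) (sq_sqrt (by positivity)), <- mul_assoc, <- C_mul]
  simp only [h2] at h1
  rw [h1]
  have hE : 0 <= Ex (p ^ (2*T)) := Ex_nonneg fun x => by rw [map_pow, pow_mul]; positivity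
  have h3 : Ex ((∑ a, C (b ⟨j, by omega⟩ a) * rot (√(1 + (a:RR)^2))⁻¹ ((a:RR) * (√(1 + (a:RR)^2))⁻¹) p) ^ (2 * T))
      <= Ex (C (((d:RR)+1)^(2*T)) * ∑ a : Fin (d+1), C (b ⟨j, by omega⟩ a ^ (2*T)) * rot (√(1 + (a:RR)^2))⁻¹ ((a:RR) * (√(1 + (a:RR)^2))⁻¹) (p ^ (2*T))) := by
    refine Ex_mono fun x => ?_
    simp only [map_mul, map_sum, map_pow, eval_C]
    set z : Fin (d+1) -> RR := fun a => b ⟨j, by omega⟩ a * eval x (rot (√(1 + (a:RR)^2))⁻¹ ((a:RR) * (√(1 + (a:RR)^2))⁻¹) p) with hz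
    have h4 : (∑ a, z a)^(2*T) <= (∑ a, |z a|)^(2*T) := by
      rw [pow_mul, pow_mul]
      exact pow_le_pow_left₀ (sq_nonneg _) (sq_le_sq.2 ((abs_sum_le_sum_abs _ _).trans (le_abs_self _))) T
    have h5 := pow_pm univ (fun a => |z a|) (fun _ _ => abs_nonneg _) (n := 2 * T) (by omega) (N := d + 1) (by simp) (by linarith [Nat.cast_nonneg (α := RR) d])
    refine h4.trans (h5.trans (le_of_eq ?_))
    simp only [pow_mul, sq_abs]
    simp only [hz, mul_pow]
  refine h3.trans ?_
  rw [Ex_C_mul, map_sum]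
  have h6 : ∀ a : Fin (d+1), Ex (C (b ⟨j, by omega⟩ a ^ (2*T)) * rot (√(1 + (a:RR)^2))⁻¹ ((a:RR) * (√(1 + (a:RR)^2))⁻¹) (p ^ (2*T)))
     = b ⟨j, by omega⟩ a ^ (2*T) * Ex (p^(2*T)) := by
    intro a
    rw [Ex_C_mul, rot_inv]
    have := sq_sqrt (show (0:RR) <= 1 + (a:RR)^2 by positivity)
    rw [mul_pow, inv_pow, this]; field_simp
  simp only [h6]
  rw [<- sum_mul, <- mul_assoc]
  refine mul_le_mul_of_nonneg_right ?_ hE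
  have h7 : ∑ a : Fin (d+1), b ⟨j, by omega⟩ a ^ (2*T) <= S ^ (2*T) := by
    have : ∀ a : Fin (d+1), b ⟨j, by omega⟩ a ^ (2*T) = |b ⟨j, by omega⟩ a| ^ (2*T) := fun a => by
      rw [pow_mul, pow_mul, sq_abs]
    simp only [this]
    refine (sum_pow_le _ _ (fun _ _ => abs_nonneg _) (by omega)).trans ?_
    refine pow_le_pow_left₀ (sum_nonneg fun _ _ => abs_nonneg _) ?_ _
    exact single_le_sum (f := fun j => ∑ a, |b j a|) (fun _ _ => sum_nonneg fun _ _ => abs_nonneg _) (mem_univ _)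
  calc ((d:RR)+1)^(2*T) * _ <= ((d:RR)+1)^(2*T) * S^(2*T) := by gcongr
    _ = ((d+1) * S)^(2*T) := by rw [mul_pow]
    _ <= _ := by gcongr; linarith
lemma coef_id {d : ℕ} {p : MP ι} {P} (hp : p ∈ H d) (hP : RotP d p P) {T : ℕ} (hT : 1 <= T) :
    Ex (p ^ (2 * T)) = Ex (rename Sum.inr p * (P ^ (2 * T - 1)).coeff d) := by
  set N := 2 * T - 1 with hN
  set Φ : Polynomial RR := ∑ j ∈ range ((P ^ N).natDegree + 1),
    PC (Ex (rename Sum.inr p * (P ^ N).coeff j)) * PX ^ j with hΦ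
  have h1 : Φ = PX ^ d * ((1 + PX ^ 2) ^ (d * (T - 1)) * PC (Ex (p ^ (2 * T)))) := by
    refine Polynomial.funext fun τ => ?_
    have e1 : Φ.eval τ = Ex (rename Sum.inr p * (P.eval (C τ)) ^ N) := by
      rw [<- Polynomial.eval_pow, Polynomial.eval_eq_sum_range (p := P ^ N), mul_sum, map_sum, hΦ, eval_finsetSum]
      refine sum_congr rfl fun j _ => ?_
      rw [<- C_pow, <- mul_assoc, mul_comm _ (C (τ ^ j)), Ex_C_mul]
      rw [Polynomial.eval_mul, Polynomial.eval_C, Polynomial.eval_pow, Polynomial.eval_X, mul_comm]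
    have hS0 : √(1 + τ ^ 2) ≠ 0 := by positivity
    have hS2 : √(1 + τ ^ 2) ^ 2 = 1 + τ ^ 2 := sq_sqrt (by positivity)
    rw [e1, hP.ev τ _ hS0 hS2]
    set S := √(1 + τ ^ 2) with hS
    rw [mul_pow, <- C_pow, <- map_pow, mul_left_comm, Ex_C_mul, mehler (by
      rw [mul_pow, inv_pow, hS2]; field_simp) d hp, <- pow_succ', show N + 1 = 2 * T by omega]
    simp only [Polynomial.eval_mul, Polynomial.eval_pow, Polynomial.eval_add, Polynomial.eval_X,
      Polynomial.eval_one, Polynomial.eval_C]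
    rw [<- hS2, <- mul_assoc, <- mul_assoc]
    congr 1
    have : d * N = d + 2 * (d * (T-1)) := by
      obtain ⟨t, rfl⟩ : ∃ t, T = t + 1 := ⟨T - 1, by omega⟩
      rw [hN, show 2 * (t + 1) - 1 = 2 * t + 1 by omega, show t + 1 - 1 = t by omega]; ring
    rw [<- pow_mul S d N, this, pow_add, pow_mul S 2, mul_pow, inv_pow]
    field_simp
  have h2 : Φ.coeff d = _ := congrArg (fun q => Polynomial.coeff q d) h1
  rw [Polynomial.coeff_X_pow_mul', if_pos le_rfl, Nat.sub_self, Polynomial.mul_coeff_zero] at h2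
  have h3 : Φ.coeff d = Ex (rename Sum.inr p * (P ^ N).coeff d) := by
    rw [hΦ, finsetSum_coeff]
    simp only [Polynomial.coeff_C_mul, Polynomial.coeff_X_pow, mul_ite, mul_one, mul_zero, Finset.sum_ite_eq,
      mem_range]
    split_ifs with hd
    · rfl
    · rw [coeff_eq_zero_of_natDegree_lt (p := P ^ N) (by omega)]; simp
  rw [h3] at h2
  rw [h2, Polynomial.coeff_zero_eq_eval_zero]; simp
lemma coef_exp {R : Type*} [CommRing R] (P : Polynomial R) (N d : ℕ) :
    (P ^ N).coeff d = ∑ l ∈ range (N + 1), if l <= d then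
      (N.choose l : R) * (P.coeff 0 ^ (N - l) * (P.divX ^ l).coeff (d - l)) else 0 := by
  conv_lhs => rw [<- Polynomial.divX_mul_X_add P]
  rw [add_pow, finsetSum_coeff]
  refine sum_congr rfl fun l _ => ?_
  rw [mul_pow, <- Polynomial.C_pow, mul_assoc, mul_assoc, <- Polynomial.C_eq_natCast, <- Polynomial.C_mul,
    mul_comm (PX ^ l), <- mul_assoc, Polynomial.coeff_mul_X_pow', Polynomial.coeff_mul_C]
  split_ifs
  · ring
  · rfl
lemma coef_pow {R : Type*} [CommRing R] (V : Polynomial R) (d l m : ℕ) (hV : V.natDegree <= d) :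
    (V ^ l).coeff m = ∑ f ∈ Fintype.piFinset (fun _ : Fin l => range (d + 1)),
      if m = ∑ i, f i then ∏ i, V.coeff (f i) else 0 := by
  have h1 : V ^ l = ∏ _i : Fin l, ∑ j ∈ range (d + 1), PC (V.coeff j) * PX ^ j := by
    rw [<- Polynomial.as_sum_range_C_mul_X_pow' V (Nat.lt_succ_of_le hV)]; simp
  rw [h1, Finset.prod_univ_sum, finsetSum_coeff]
  refine sum_congr rfl fun f _ => ?_
  rw [prod_mul_distrib, Finset.prod_pow_eq_pow_sum, <- map_prod, Polynomial.coeff_C_mul_X_pow]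
lemma uv_bd {u v : RR} (hu : 0 <= u) (hv : 0 <= v) {a l n : ℕ} (h : a + l <= n) : u ^ a * v ^ l <= 1 + u ^ n + v ^ n := by
  set M := max 1 (max u v) with hM
  have h1 : u <= M := (le_max_left _ _).trans (le_max_right _ _)
  have h2 : v <= M := (le_max_right _ _).trans (le_max_right _ _)
  have h3 : 1 <= M := le_max_left _ _
  calc u ^ a * v ^ l <= M ^ a * M ^ l := by gcongr
    _ = M ^ (a + l) := by rw [pow_add]
    _ <= M ^ n := pow_le_pow_right₀ h3 h
    _ <= _ := by
      have hu' := pow_nonneg hu n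
      have hv' := pow_nonneg hv n
      rcases max_choice 1 (max u v) with h | h
      · rw [hM, h, one_pow]; linarith
      · rcases max_choice u v with h' | h' <;> rw [hM, h, h'] <;> linarith
def BlockHyp (d T : ℕ) (B : RR) (p : MP ι) : Prop :=
  ∀ l, 2 <= l -> l <= d -> ∀ (j : Fin l -> ℕ) (f : Fin l -> MP ι), (∀ i, 1 <= j i) ->
    (∀ i, (f i).totalDegree <= j i) -> ∑ i, j i = d -> |Ex (p * ∏ i, f i)| * (T:RR) ^ l <= B * √T * ∏ i, nr (f i)
lemma Gl_bd {d T : ℕ} (hT : 1 <= T) {B : RR} (hB : 0 <= B) {p : MP ι} {P} (hP : RotP d p P)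
    (hb : BlockHyp d T B p) {l : ℕ} (hl2 : 2 <= l) (hld : l <= d) (x : ι -> RR) {V : RR} (hV0 : 0 <= V)
    (hV : ∀ j, nr (evx x (P.coeff j)) <= V) (N : ℕ) (hN : N <= 2 * T) :
    eval x (Ey (rename Sum.inr p * ((N.choose l : MP (ι ⊕ ι)) *
      (P.coeff 0 ^ (N - l) * (P.divX ^ l).coeff (d - l))))) <=
      (2 * (d + 1)) ^ d * B * √T * (|eval x p| ^ (N - l) * V ^ l) := by
  rw [eval_Ey, map_mul (evx x), evx_inr, map_mul (evx x), map_mul (evx x), map_natCast, map_pow, hP.bot, evx_inl, <- C_pow,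
    show (N.choose l : MP ι) = C (N.choose l : RR) by simp,
    mul_left_comm, Ex_C_mul, mul_left_comm, Ex_C_mul]
  set W := Ex (p * evx x ((P.divX ^ l).coeff (d - l))) with hW
  have hT0 : (0:RR) < (T:RR) ^ l := by positivity
  have h1 : |W| * (T:RR) ^ l <= (d + 1) ^ l * (B * √T * V ^ l) := by
    rw [hW, coef_pow P.divX d l (d - l) (Polynomial.natDegree_divX_le.trans hP.deg), map_sum, mul_sum, map_sum]
    refine (mul_le_mul_of_nonneg_right (abs_sum_le_sum_abs _ _) hT0.le).trans ?_
    rw [sum_mul]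
    have h2 : ∀ f ∈ Fintype.piFinset (fun _ : Fin l => range (d + 1)),
        |Ex (p * evx x (if d - l = ∑ i, f i then ∏ i, P.divX.coeff (f i) else 0))| * (T:RR) ^ l <= B * √T * V ^ l := by
      intro f _
      have h0 : 0 <= B * √T * V ^ l := by positivity
      split_ifs with hf
      · rw [map_prod]
        refine (hb l hl2 hld (fun i => f i + 1) _ (fun i => by omega) (fun i => ?_) ?_).trans ?_
        · rw [coeff_divX]; exact hP.ydeg _ _
        · rw [sum_add_distrib]; simp; omega
        · refine mul_le_mul_of_nonneg_left ?_ (by positivity)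
          calc _ <= ∏ _i : Fin l, V := prod_le_prod (fun _ _ => nr_nonneg _) (fun i _ => by
                rw [coeff_divX]; exact hV _)
            _ = V ^ l := by simp
      · simpa using h0
    refine (sum_le_sum h2).trans (le_of_eq ?_)
    rw [sum_const, Fintype.card_piFinset]
    simp
  have h3 : (N.choose l : RR) <= (2:RR)^l * (T:RR)^l := by
    rw [<- mul_pow]
    calc (N.choose l : RR) <= ((N ^ l : ℕ) : RR) := by exact_mod_cast Nat.choose_le_pow N l
      _ <= _ := by
        push_cast
        have : (N:RR) <= 2 * T := by exact_mod_cast hN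
        gcongr
  have hd1 : (1:RR) <= 2 * (d+1) := by linarith [Nat.cast_nonneg (α := RR) d]
  calc (N.choose l : RR) * (eval x p ^ (N-l) * W) <= |(N.choose l : RR) * (eval x p ^ (N-l) * W)| := le_abs_self _
    _ = N.choose l * (|eval x p| ^ (N-l) * |W|) := by rw [abs_mul, abs_mul, abs_pow, Nat.abs_cast]
    _ <= 2^l * T^l * (|eval x p| ^ (N-l) * |W|) := by gcongr
    _ = 2^l * |eval x p| ^ (N-l) * (|W| * T^l) := by ring
    _ <= 2^l * |eval x p| ^ (N-l) * ((d + 1) ^ l * (B * √T * V ^ l)) := by gcongr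
    _ = (2*(d+1))^l * B * √T * (|eval x p| ^ (N - l) * V ^ l) := by rw [mul_pow]; ring
    _ <= _ := by gcongr
lemma moment (d : ℕ) (hd : 1 <= d) (B : RR) (hB : 0 <= B) : ∃ K : RR, 1 <= K ∧ ∀ (ι : Type) [Fintype ι] (T : ℕ), 1 <= T ->
    ∀ p : MP ι, p ∈ H d -> nr p <= 1 -> BlockHyp d T B p -> Ex (p ^ (2 * T)) <= (K * T) ^ T := by
  obtain ⟨C₀, hC0, hC⟩ := rotc_bd d
  set C₁ := (d + 1) * C₀ with hC1
  have hd0 : (0:RR) <= d := Nat.cast_nonneg _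
  have hC11 : 1 <= C₁ := by nlinarith
  set K₂ := 3 * ((2 * (d + 1)) ^ d * B * C₁ ^ d) with hK2
  have hK20 : 0 <= K₂ := by positivity
  set K₃ := (d + 1) * K₂ with hK3
  have hK30 : 0 <= K₃ := by positivity
  refine ⟨(K₃ + 2) ^ 2, by nlinarith, ?_⟩
  intro ι _ T hT p hp hp1 hb
  have hTr : (1:RR) <= T := by exact_mod_cast hT
  set E := Ex (p ^ (2 * T)) with hE
  have hE0 : 0 <= E := Ex_nonneg fun x => by rw [map_pow, pow_mul]; positivity
  rcases hE0.eq_or_lt with h0 | hEpos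
  · rw [<- h0]; positivity
  obtain ⟨P, hP⟩ := exists_RotP d hp
  set X₀ := E ^ ((1:RR) / (2 * T : ℕ)) with hX
  have hX0 : 0 < X₀ := Real.rpow_pos_of_pos hEpos _
  have hXE : X₀ ^ (2 * T) = E := by
    rw [hX, one_div]; exact Real.rpow_inv_natCast_pow hE0 (by omega)
  set U : MP ι := Ey (∑ j ∈ range (d + 1), P.coeff j ^ 2) with hU
  have hUx : ∀ x, eval x U = ∑ j ∈ range (d+1), nr (evx x (P.coeff j)) ^ 2 := by
    intro x
    rw [hU, eval_Ey, map_sum, map_sum]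
    refine sum_congr rfl fun j _ => ?_
    rw [nr_sq, map_pow, sq]
  have hU0 : ∀ x, 0 <= eval x U := fun x => by rw [hUx]; positivity
  have hUT : Ex (U ^ T) <= C₁ ^ (2 * T) * E := by
    have a1 : Ex (U ^ T) <= Ex (Ey ((∑ j ∈ range (d + 1), P.coeff j ^ 2) ^ T)) := by
      refine Ex_mono fun x => ?_
      rw [map_pow, hU, eval_Ey, eval_Ey, map_pow]
      refine jensen (fun y => ?_) hT
      rw [map_sum, map_sum]
      exact sum_nonneg fun j _ => by rw [map_pow, map_pow]; positivity
    refine a1.trans ?_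
    rw [Ex_Ey]
    have a2 : Ex ((∑ j ∈ range (d + 1), P.coeff j ^ 2) ^ T) <=
        Ex (C ((d+1:RR)^T) * ∑ j ∈ range (d + 1), P.coeff j ^ (2 * T)) := by
      refine Ex_mono fun x => ?_
      simp only [map_mul, map_sum, map_pow, eval_C, pow_mul]
      exact pow_pm _ _ (fun _ _ => sq_nonneg _) hT (by simp) (by linarith)
    refine a2.trans ?_
    rw [Ex_C_mul, map_sum]
    calc (d+1:RR)^T * ∑ j ∈ range (d + 1), Ex (P.coeff j ^ (2 * T))
        <= (d+1:RR)^T * ∑ j ∈ range (d + 1), C₀ ^ (2*T) * E := by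
          gcongr with j hj
          exact hC ι p P hP j (by simpa [Nat.lt_succ_iff] using hj) T hT
      _ = (d+1:RR)^(T+1) * (C₀ ^ (2*T) * E) := by simp; ring
      _ <= (d+1:RR)^(2*T) * (C₀ ^ (2*T) * E) := by
          gcongr
          · linarith
          · omega
      _ = _ := by rw [hC1, mul_pow]; ring
  have hV : ∀ x j, nr (evx x (P.coeff j)) <= √(eval x U) := by
    intro x j
    by_cases hj : j <= d
    · refine Real.le_sqrt_of_sq_le ?_
      rw [hUx]
      exact single_le_sum (f := fun j => nr (evx x (P.coeff j)) ^ 2) (fun _ _ => sq_nonneg _) (by simp; omega)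
    · rw [coeff_eq_zero_of_natDegree_lt (by have := hP.deg; omega), map_zero, nr_zero]
      positivity
  set N := 2 * T - 1 with hN
  have key : ∀ a l : ℕ, a + l <= 2 * T -> ∀ x, |eval x p| ^ a * √(eval x U) ^ l <=
      X₀ ^ a * (C₁ * X₀) ^ l * (1 + E⁻¹ * (eval x p) ^ (2*T) + (C₁ ^ (2*T) * E)⁻¹ * (eval x U) ^ T) := by
    intro a l hal x
    have := uv_bd (u := |eval x p| / X₀) (v := √(eval x U) / (C₁ * X₀)) (by positivity) (by positivity) hal
    rw [div_pow, div_pow, div_pow, div_pow, mul_pow C₁ X₀ (2*T), hXE, pow_mul |_|, sq_abs, <- pow_mul, pow_mul √_,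
      sq_sqrt (hU0 x)] at this
    calc _ = X₀ ^ a * (C₁ * X₀) ^ l * (|eval x p| ^ a / X₀ ^ a * (√(eval x U) ^ l / (C₁ * X₀) ^ l)) := by
          field_simp
      _ <= X₀ ^ a * (C₁ * X₀) ^ l * (1 + (eval x p) ^ (2*T) / E + (eval x U) ^ T / (C₁ ^ (2*T) * E)) := by gcongr
      _ = _ := by field_simp
  set Z : MP ι := 1 + C E⁻¹ * p ^ (2*T) + C (C₁ ^ (2*T) * E)⁻¹ * U ^ T with hZ
  have hZx : ∀ x, eval x Z = 1 + E⁻¹ * (eval x p) ^ (2*T) + (C₁ ^ (2*T) * E)⁻¹ * (eval x U) ^ T := by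
    intro x; simp [hZ]
  have hZE : Ex Z <= 3 := by
    rw [hZ, map_add, map_add, Ex_one, Ex_C_mul, Ex_C_mul, <- hE, inv_mul_cancel₀ hEpos.ne']
    have : (C₁ ^ (2*T) * E)⁻¹ * Ex (U ^ T) <= 1 := by
      rw [inv_mul_le_iff₀ (by positivity)]; linarith
    linarith
  have hmain : E <= ∑ l ∈ range (N + 1), if l <= d then
      ((if l = 1 then 4 * T * X₀ ^ (2 * T - 2) else 0) + K₂ * √T * X₀ ^ (2 * T - 1)) else 0 := by
    rw [hE, coef_id hp hP hT, coef_exp, mul_sum, map_sum]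
    refine sum_le_sum fun l hlN => ?_
    have hlN' : l <= N := by simpa [Nat.lt_succ_iff] using hlN
    split_ifs with hld hl1 
    · subst hl1
      rw [<- Ex_Ey]
      have c1 : Ex (Ey (rename Sum.inr p * ((N.choose 1 : MP (ι ⊕ ι)) *
          (P.coeff 0 ^ (N - 1) * (P.divX ^ 1).coeff (d - 1))))) <= Ex (C (2 * T : RR) * p ^ (2 * T - 2)) := by
        refine Ex_mono fun x => ?_
        rw [pow_one, coeff_divX, Nat.sub_add_cancel hd, hP.top, eval_Ey, map_mul (evx x), evx_inr, map_mul (evx x), map_mul (evx x), map_natCast, map_pow, hP.bot, evx_inl, <- C_pow,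
          show (N.choose 1 : MP ι) = C (N.choose 1 : RR) by simp, 
          evx_inr, mul_left_comm, Ex_C_mul, mul_left_comm, Ex_C_mul, <- nr_sq, map_mul (eval x), eval_C, map_pow,
          show N - 1 = 2 * (T - 1) by omega, show 2 * T - 2 = 2 * (T - 1) by omega, Nat.choose_one_right]
        have : nr p ^ 2 <= 1 := pow_le_one₀ (nr_nonneg p) hp1
        have h5 : (0:RR) <= eval x p ^ (2 * (T-1)) := by rw [pow_mul]; positivity
        have h6 : (N:RR) <= 2 * T := by exact_mod_cast (show N <= 2 * T by omega)
        calc (N:RR) * (eval x p ^ (2 * (T-1)) * nr p ^ 2) <= (2 * T) * (eval x p ^ (2 * (T-1)) * 1) := by gcongr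
          _ = _ := by ring
      refine c1.trans ?_
      have c2 : Ex (p ^ (2 * T - 2)) <= Ex (C (X₀ ^ (2*T-2)) * (1 + C E⁻¹ * p ^ (2*T))) := by
        refine Ex_mono fun x => ?_
        have := uv_bd (u := |eval x p| / X₀) (v := 0) (by positivity) le_rfl (a := 2*T-2) (l := 0) (n := 2*T) (by omega)
        rw [div_pow, div_pow, hXE, pow_zero, mul_one, zero_pow (by omega), add_zero, pow_mul |_|, sq_abs, <- pow_mul,
          show 2 * T - 2 = 2 * (T - 1) by omega, pow_mul |_|, sq_abs, <- pow_mul, div_le_iff₀ (by positivity)] at this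
        simp only [map_mul, map_pow, map_add, eval_C, map_one]
        rw [show 2 * T - 2 = 2 * (T - 1) by omega]
        calc _ <= _ := this
          _ = _ := by ring
      rw [Ex_C_mul, map_add, Ex_one, Ex_C_mul, <- hE, inv_mul_cancel₀ hEpos.ne'] at c2
      rw [Ex_C_mul]
      have : 0 <= K₂ * √T * X₀ ^ (2 * T - 1) := by positivity
      calc (2 * T : RR) * Ex (p ^ (2 * T - 2)) <= 2 * T * (X₀ ^ (2*T-2) * (1 + 1)) := by gcongr
        _ <= _ := by linarith
    · rw [zero_add]
      have hpos : 0 <= K₂ * √T * X₀ ^ (2 * T - 1) := by positivity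
      rcases Nat.eq_zero_or_pos l with rfl | hlp
      · rw [pow_zero, Polynomial.coeff_one, if_neg (by omega)]; simpa using hpos
      have hl2 : 2 <= l := by omega
      rw [<- Ex_Ey]
      have c1 := Ex_mono (f := Ey (rename Sum.inr p * ((N.choose l : MP (ι ⊕ ι)) *
          (P.coeff 0 ^ (N - l) * (P.divX ^ l).coeff (d - l))))) (g := C ((2 * (d + 1)) ^ d * B * √T * (X₀ ^ (N - l) * (C₁ * X₀) ^ l)) * Z) (fun x => by
        refine (Gl_bd hT hB hP hb hl2 hld x (sqrt_nonneg _) (hV x) N (by omega)).trans ?_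
        rw [map_mul, eval_C, hZx, mul_assoc (_ * B * √(T:RR))]
        refine mul_le_mul_of_nonneg_left (key _ _ (by omega) x) (by positivity))
      refine c1.trans ?_
      rw [Ex_C_mul]
      calc _ <= (2 * (d + 1)) ^ d * B * √T * (X₀ ^ (N - l) * (C₁ * X₀) ^ l) * 3 := by gcongr
        _ = (2 * (d + 1)) ^ d * B * √T * (C₁ ^ l * X₀ ^ (N - l + l)) * 3 := by rw [pow_add, mul_pow]; ring
        _ = (2 * (d + 1)) ^ d * B * √T * (C₁ ^ l * X₀ ^ (2 * T - 1)) * 3 := by rw [Nat.sub_add_cancel hlN']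
        _ <= (2 * (d + 1)) ^ d * B * √T * (C₁ ^ d * X₀ ^ (2 * T - 1)) * 3 := by gcongr
        _ = _ := by rw [hK2]; ring
    · simp
  have hsum : E <= 4 * T * X₀ ^ (2 * T - 2) + K₃ * √T * X₀ ^ (2 * T - 1) := by
    refine hmain.trans ?_
    rw [<- Finset.sum_filter]
    calc _ <= ∑ l ∈ range (d + 1), ((if l = 1 then 4 * T * X₀ ^ (2 * T - 2) else 0) + K₂ * √T * X₀ ^ (2 * T - 1)) := by
          refine Finset.sum_le_sum_of_subset_of_nonneg (fun l hl => ?_) (fun l _ _ => ?_)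
          · simp at hl ⊢; omega
          · split_ifs <;> positivity
      _ = _ := by
          rw [sum_add_distrib, Finset.sum_ite_eq']
          simp [show 0 < d by omega, hK3]; ring
  have hX2 : X₀ ^ 2 <= 4 * T + K₃ * √T * X₀ := by
    rw [<- hXE] at hsum
    have e1 : X₀ ^ (2 * T) = X₀ ^ (2 * T - 2) * X₀ ^ 2 := by rw [<- pow_add]; congr 1; omega
    have e2 : X₀ ^ (2 * T - 1) = X₀ ^ (2 * T - 2) * X₀ := by rw [<- pow_succ]; congr 1; omega
    rw [e1, e2] at hsum
    have : 0 < X₀ ^ (2 * T - 2) := by positivity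
    refine le_of_mul_le_mul_left ?_ this
    linarith
  have hs : √(T:RR) ^ 2 = T := sq_sqrt (by positivity)
  have hs0 : 0 < √(T:RR) := by positivity
  have hXb : X₀ <= (K₃ + 2) * √T := by
    by_contra hcon
    push Not at hcon
    have : (K₃ + 2) * √T * X₀ <= X₀ ^ 2 := by rw [sq]; gcongr
    have : √T * ((K₃ + 2) * √T) < √T * X₀ := mul_lt_mul_of_pos_left hcon hs0
    nlinarith
  rw [<- hXE, pow_mul]
  refine pow_le_pow_left₀ (by positivity) ?_ T
  calc X₀ ^ 2 <= ((K₃ + 2) * √T) ^ 2 := by gcongr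
    _ = _ := by rw [mul_pow, hs]
lemma gamma_id {a b c : ℕ} {f A B : MP ι} (hf : f ∈ H c) (hA : A ∈ H a) (hB : B ∈ H b) :
    ((a:RR) + b - c) * Ex (f * A * B) = 2 * ∑ k, Ex (f * pderiv k A * pderiv k B) := by
  have h1 := H_dir hf (A * B)
  have h2 : ∀ (g : MP ι) k, Ex (pderiv k f * pderiv k g) = Ex (f * ds k (pderiv k g)) := by
    intro g k
    rw [mul_comm f, adj, mul_comm]
  have h3 : ∀ k, ds k (pderiv k (A * B)) = ds k (pderiv k A) * B + A * ds k (pderiv k B) - 2 * (pderiv k A * pderiv k B) := by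
    intro k
    simp only [ds_apply, pderiv_mul, map_add]
    ring
  simp only [h2, h3, mul_sub, mul_add, map_sub, map_add] at h1
  rw [sum_sub_distrib, sum_add_distrib, <- map_sum, <- map_sum, <- mul_sum, <- mul_sum,
    <- sum_mul, <- mul_sum, Nop hA, Nop hB,
    show f * (C (a:RR) * A * B) = C (a:RR) * (f * A * B) by ring, show f * (A * (C (b:RR) * B)) = C (b:RR) * (f * A * B) by ring,
    Ex_C_mul, Ex_C_mul] at h1
  have h4 : ∑ k, Ex (f * (2 * (pderiv k A * pderiv k B))) = 2 * ∑ k, Ex (f * pderiv k A * pderiv k B) := by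
    rw [mul_sum]
    refine sum_congr rfl fun k _ => ?_
    rw [<- Ex_C_mul]; congr 1; rw [show (C (2:RR) : MP ι) = 2 from map_ofNat C 2]; ring
  rw [h4, <- mul_assoc] at h1
  linarith
lemma sum_pd_sq {a : ℕ} {A : MP ι} (hA : A ∈ H a) : ∑ k, nr (pderiv k A) ^ 2 = a * nr A ^ 2 := by
  simp only [nr_sq]; exact H_dir hA A
lemma sum_pd_mul {a b m : ℕ} {A B : MP ι} (hA : A ∈ H a) (hB : B ∈ H b) (ha : a <= m) (hb : b <= m) :
    ∑ k, nr (pderiv k A) * nr (pderiv k B) <= m * nr A * nr B := by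
  have h := Finset.sum_mul_sq_le_sq_mul_sq univ (fun k => nr (pderiv k A)) (fun k => nr (pderiv k B))
  rw [sum_pd_sq hA, sum_pd_sq hB] at h
  have h1 := nr_nonneg A
  have h2 := nr_nonneg B
  refine abs_le_of_sq_le_sq' ?_ (by positivity) |>.2
  have ha' : (a:RR) <= m := by exact_mod_cast ha
  have hb' : (b:RR) <= m := by exact_mod_cast hb
  calc _ <= _ := h
    _ <= m * nr A ^ 2 * (m * nr B ^ 2) := by gcongr
    _ = _ := by ring
lemma comp_bd (m r : ℕ) {θ : RR} (hθ : 0 <= θ) {p : MP ι} {c : ℕ -> MP ι} (hc : ∀ j, c j ∈ H j)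
    (hp : p = ∑ j ∈ range (m + 1), c j)
    (hpb : ∀ a b (A B : MP ι), a + r <= m -> b + r <= m -> a + b <= m -> A.totalDegree <= a -> B.totalDegree <= b ->
      |Ex (p * A * B)| <= θ * nr A * nr B) :
    ∀ s ≤ m, ∀ a b, a + b = s -> a + r <= m -> b + r <= m -> ∀ A B, A ∈ H a -> B ∈ H b -> ∀ j ≤ m,
      |Ex (c j * A * B)| <= (2 * (m:RR) ^ 2 + 2) ^ (s + 1) * θ * nr A * nr B := by
  intro s
  set D : RR := 2 * (m:RR)^2 + 2 with hD
  have hD1 : 1 <= D := by nlinarith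
  induction s using Nat.strong_induction_on with
  | _ s ih =>
    intro hs a b hab ha hb A B hA hB
    have nA := nr_nonneg A
    have nB := nr_nonneg B
    have hne : ∀ j ≤ m, j ≠ s -> |Ex (c j * A * B)| <= 2 * m * D ^ s * θ * nr A * nr B := by
      intro j hj hjs
      rcases lt_or_gt_of_ne hjs with h | h
      · have h1 := gamma_id (hc j) hA hB
        have h2 : |∑ k, Ex (c j * pderiv k A * pderiv k B)| <= D ^ s * θ * (m * nr A * nr B) := by
          refine (abs_sum_le_sum_abs _ _).trans ?_
          refine le_trans ?_ (mul_le_mul_of_nonneg_left (sum_pd_mul hA hB (show a <= m by omega) (by omega)) (by positivity))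
          rw [mul_sum]
          refine sum_le_sum fun k _ => ?_
          rcases Nat.eq_zero_or_pos a with rfl | ha0
          · rw [pd_H0 hA]; simp [nr_zero]
          rcases Nat.eq_zero_or_pos b with rfl | hb0
          · rw [pd_H0 hB]; simp [nr_zero]
          refine (ih (s - 2) (by omega) (by omega) (a-1) (b-1) (by omega) (by omega) (by omega) _ _ (pd_mem' k hA) (pd_mem' k hB) j hj).trans ?_
          rw [mul_assoc]
          refine mul_le_mul_of_nonneg_right ?_ (mul_nonneg (nr_nonneg _) (nr_nonneg _))
          gcongr
          omega
        have h3 : (1:RR) <= (a:RR) + b - j := by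
          have : j + 1 <= a + b := by omega
          have : ((j + 1 : ℕ):RR) <= ((a + b : ℕ) : RR) := by exact_mod_cast this
          push_cast at this; linarith
        have h4 := congrArg abs h1
        rw [abs_mul, abs_mul, abs_of_pos (show (0:RR) < (a:RR) + b - j by linarith), abs_two] at h4
        have h5 := mul_le_mul_of_nonneg_right h3 (abs_nonneg (Ex (c j * A * B)))
        calc _ <= 2 * |∑ k, Ex (c j * pderiv k A * pderiv k B)| := by linarith
          _ <= 2 * (D ^ s * θ * (m * nr A * nr B)) := by gcongr
          _ = _ := by ring
      · rw [mul_assoc, orth_deg (hc j) ((totalDegree_mul _ _).trans_lt (by have := deg_H hA; have := deg_H hB; omega)), abs_zero]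
        positivity
    have hmono : 2 * m * D ^ s * θ * nr A * nr B <= D ^ (s + 1) * θ * nr A * nr B := by
      rw [pow_succ']
      have : 2 * (m:RR) <= D := by nlinarith [sq_nonneg ((m:RR) - 1)]
      gcongr
    intro j hj
    by_cases hjs : j = s
    · subst hjs
      have h1 : Ex (c j * A * B) = Ex (p * A * B) - ∑ i ∈ (range (m+1)).erase j, Ex (c i * A * B) := by
        rw [hp, sum_mul, sum_mul, map_sum, <- Finset.add_sum_erase _ _ (show j ∈ range (m+1) by simp; omega)]
        ring
      have h2 : |∑ i ∈ (range (m+1)).erase j, Ex (c i * A * B)| <= m * (2 * m * D ^ j * θ * nr A * nr B) := by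
        refine (abs_sum_le_sum_abs _ _).trans ?_
        refine (sum_le_card_nsmul _ _ (2 * m * D ^ j * θ * nr A * nr B) (fun i hi => ?_)).trans (le_of_eq ?_)
        · rw [Finset.mem_erase, mem_range] at hi; exact hne i (by omega) hi.1
        · rw [Finset.card_erase_of_mem (by simp; omega)]; simp
      have h3 := hpb a b A B ha hb (by omega) (deg_H hA) (deg_H hB)
      rw [h1]
      refine (abs_sub _ _).trans ?_
      have hDs : 1 <= D ^ j := one_le_pow₀ hD1
      have hq : 0 <= θ * nr A * nr B := by positivity
      calc _ <= θ * nr A * nr B + m * (2 * m * D ^ j * θ * nr A * nr B) := add_le_add h3 h2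
        _ = (1 + 2 * m ^ 2 * D ^ j) * (θ * nr A * nr B) := by ring
        _ <= D ^ (j+1) * (θ * nr A * nr B) := by
          gcongr
          have e : D ^ (j+1) = D ^ j * D := pow_succ _ _
          rw [e]; nlinarith
        _ = _ := by ring
    · exact (hne j hj hjs).trans hmono
lemma top_bd (m r : ℕ) {θ : RR} (hθ : 0 <= θ) {f : MP ι} (hf : f ∈ H m)
    (h : ∀ a b, a + b = m -> a + r <= m -> b + r <= m -> ∀ A B, A ∈ H a -> B ∈ H b ->
      |Ex (f * A * B)| <= θ * nr A * nr B) {a b : ℕ} (hab : a + b = m) (ha : r <= a) (hb : r <= b) {A B : MP ι}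
    (hA : A.totalDegree <= a) (hB : B.totalDegree <= b) : |Ex (f * A * B)| <= θ * nr A * nr B := by
  obtain ⟨cA, hcA, eA⟩ := decomp hA
  obtain ⟨cB, hcB, eB⟩ := decomp hB
  have h1 : Ex (f * A * B) = Ex (f * cA a * cB b) := by
    rw [show f * A * B = ∑ i ∈ range (a + 1), f * (cA i * B) by rw [eA, mul_sum, sum_mul]; simp only [mul_assoc],
      map_sum, sum_eq_single a]
    · rw [show f * (cA a * B) = ∑ i ∈ range (b + 1), f * (cA a * cB i) by rw [eB, mul_sum, mul_sum],
        map_sum, sum_eq_single b, mul_assoc]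
      · intro i hi hib
        rw [mem_range] at hi
        exact orth_deg hf ((totalDegree_mul _ _).trans_lt (by have := deg_H (hcA a); have := deg_H (hcB i); omega))
      · simp
    · intro i hi hib
      rw [mem_range] at hi
      exact orth_deg hf ((totalDegree_mul _ _).trans_lt (by have := deg_H (hcA i); omega))
    · simp
  rw [h1]
  have hn1 : nr (cA a) <= nr A := by rw [eA]; exact nr_comp_le' hcA (by simp)
  have hn2 : nr (cB b) <= nr B := by rw [eB]; exact nr_comp_le' hcB (by simp)
  refine (h a b hab (by omega) (by omega) _ _ (hcA a) (hcB b)).trans ?_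
  have := nr_nonneg (cA a)
  have := nr_nonneg (cB b)
  have := nr_nonneg A
  gcongr
lemma nr_prod {α : Type*} (S : Finset α) (f : α -> MP ι) (j : α -> ℕ) (d : ℕ) (hf : ∀ i, (f i).totalDegree <= j i)
    (hS : ∑ i ∈ S, j i <= d) : nr (∏ i ∈ S, f i) <= Kc d ^ S.card * ∏ i ∈ S, nr (f i) ∧ (∏ i ∈ S, f i).totalDegree <= ∑ i ∈ S, j i := by
  classical
  induction S using Finset.induction_on with
  | empty => simp [nr, Ex_one]
  | insert a S ha ih =>
    rw [sum_insert ha] at hS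
    obtain ⟨h1, h2⟩ := ih (by omega)
    rw [prod_insert ha, prod_insert ha, Finset.card_insert_of_notMem ha, sum_insert ha]
    constructor
    · refine (nr_mul (K := d) ((hf a).trans (by omega)) (h2.trans (by omega))).trans ?_
      have := Kc_ge d
      have := nr_nonneg (f a)
      calc _ <= Kc d * nr (f a) * (Kc d ^ S.card * ∏ i ∈ S, nr (f i)) := by gcongr
        _ = _ := by rw [pow_succ]; ring
    · exact (totalDegree_mul _ _).trans (by have := hf a; omega)
def lam (m r : ℕ) : ℕ := if r = 1 then (if m = 3 then 3 else 2) else 2 * r + 1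
lemma group {l d : ℕ} (hl : 2 <= l) (hld : l <= d) (j : Fin l -> ℕ) (hj : ∀ i, 1 <= j i) (hs : ∑ i, j i = d) :
    ∃ S : Finset (Fin l), ∃ r, 1 <= r ∧ r <= ∑ i ∈ S, j i ∧ r <= ∑ i ∈ Sᶜ, j i ∧ l <= lam d r := by
  have hc : ∀ S : Finset (Fin l), S.card <= ∑ i ∈ S, j i := fun S => by
    simpa using sum_le_sum (s := S) (fun i _ => hj i)
  by_cases h : l = 3 ∧ 4 <= d
  · obtain ⟨rfl, hd⟩ := h
    have : ∃ i, 2 <= j i := by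
      by_contra hcon
      push Not at hcon
      have : ∑ i, j i <= ∑ i : Fin 3, 1 := sum_le_sum fun i _ => by have := hcon i; omega
      simp at this; omega
    obtain ⟨i, hi⟩ := this
    refine ⟨{i}, 2, by omega, by simpa using hi, ?_, by simp [lam]⟩
    refine le_trans ?_ (hc _)
    rw [Finset.card_compl]; simp
  · obtain ⟨S, -, hS⟩ := Finset.exists_subset_card_eq (s := (univ : Finset (Fin l))) (n := l / 2) (by simp; omega)
    refine ⟨S, l / 2, by omega, hS ▸ hc S, le_trans ?_ (hc _), ?_⟩
    · rw [Finset.card_compl, hS]; simp; omega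
    · unfold lam; split_ifs <;> omega
noncomputable def th (m T r : ℕ) : RR := √T / (T:RR) ^ lam m r
lemma block_of_two {d T : ℕ} (hT : 1 <= T) {K : RR} (hK : 0 <= K) {p : MP ι}
    (h : ∀ r, 1 <= r -> ∀ a b, a + b = d -> r <= a -> r <= b -> ∀ A B : MP ι, A.totalDegree <= a -> B.totalDegree <= b ->
      |Ex (p * A * B)| <= K * th d T r * nr A * nr B) : BlockHyp d T (K * Kc d ^ d) p := by
  intro l hl2 hld j f hj hf hs
  obtain ⟨S, r, hr, h1, h2, h3⟩ := group hl2 hld j hj hs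
  have hsum : ∑ i ∈ S, j i + ∑ i ∈ Sᶜ, j i = d := by rw [Finset.sum_add_sum_compl, hs]
  obtain ⟨a1, a2⟩ := nr_prod S f j d hf (by omega)
  obtain ⟨b1, b2⟩ := nr_prod Sᶜ f j d hf (by omega)
  have h4 := h r hr _ _ hsum h1 h2 _ _ a2 b2
  rw [mul_assoc p, Finset.prod_mul_prod_compl] at h4
  have hK1 := Kc_ge d
  have hTr : (1:RR) <= T := by exact_mod_cast hT
  have hth : 0 <= th d T r := by unfold th; positivity
  have h6 : th d T r * (T:RR) ^ l <= √T := by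
    unfold th
    rw [div_mul_eq_mul_div, div_le_iff₀ (by positivity)]
    gcongr
  have hp : 0 <= ∏ i ∈ S, nr (f i) := prod_nonneg fun _ _ => nr_nonneg _
  have hp' : 0 <= ∏ i ∈ Sᶜ, nr (f i) := prod_nonneg fun _ _ => nr_nonneg _
  have n1 := nr_nonneg (∏ i ∈ S, f i)
  have n2 := nr_nonneg (∏ i ∈ Sᶜ, f i)
  have hpp : (∏ i ∈ S, nr (f i)) * ∏ i ∈ Sᶜ, nr (f i) = ∏ i, nr (f i) := Finset.prod_mul_prod_compl _ _
  have hcard : S.card + Sᶜ.card <= d := by rw [Finset.card_add_card_compl, Fintype.card_fin]; exact hld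
  rw [<- hpp]
  clear hpp h1 h2 h3 hs hsum hf hj a2 b2
  generalize Kc d = k at *
  generalize nr (∏ i ∈ S, f i) = x at *
  generalize nr (∏ i ∈ Sᶜ, f i) = y at *
  generalize (∏ i ∈ S, nr (f i)) = X at *
  generalize (∏ i ∈ Sᶜ, nr (f i)) = Y at *
  generalize |Ex (p * ∏ i, f i)| = E at *
  generalize th d T r = t at *
  have h7 : x * y <= k ^ d * (X * Y) := by
    calc x * y <= (k ^ S.card * X) * (k ^ Sᶜ.card * Y) := mul_le_mul a1 b1 n2 (n1.trans a1)
      _ = k ^ (S.card + Sᶜ.card) * (X * Y) := by rw [pow_add]; ring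
      _ <= _ := mul_le_mul_of_nonneg_right (pow_le_pow_right₀ hK1 hcard) (mul_nonneg hp hp')
  have h8 : 0 <= k ^ d * (X * Y) := (mul_nonneg n1 n2).trans h7
  calc E * (T:RR) ^ l <= (K * t * x * y) * (T:RR) ^ l := mul_le_mul_of_nonneg_right h4 (by positivity)
    _ = (t * (T:RR) ^ l) * (K * (x * y)) := by ring
    _ <= √T * (K * (k ^ d * (X * Y))) := mul_le_mul h6 (mul_le_mul_of_nonneg_left h7 hK) (by positivity) (by positivity)
    _ = _ := by ring
def PB (m : ℕ) (θ : ℕ -> RR) (p : MP ι) : Prop :=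
  ∀ r a b (A B : MP ι), 1 <= r -> a + r <= m -> b + r <= m -> a + b <= m -> A.totalDegree <= a -> B.totalDegree <= b ->
      |Ex (p * A * B)| <= θ r * nr A * nr B
lemma greedy (m : ℕ) (θ : ℕ -> RR) {t : RR} (ht : 0 < t) (hθ : ∀ r, 1 <= r -> r <= m -> t <= θ r) (n : ℕ) :
    ∀ p : MP ι, p.totalDegree <= m -> nr p ^ 2 * Kc m ^ 2 <= n * t ^ 2 ->
    ∃ (τ : Type) (_ : Fintype τ) (c : τ -> RR) (A B : τ -> MP ι) (r : τ -> ℕ) (p' : MP ι),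
      p = p' + ∑ e, C (c e) * (A e * B e) ∧ p'.totalDegree <= m ∧ PB m θ p' ∧
      (∀ e, 1 <= r e ∧ r e <= m ∧ (A e).totalDegree <= m - r e ∧ (B e).totalDegree <= m - r e ∧ nr (A e) <= 1 ∧ nr (B e) <= 1) ∧
      nr p' ^ 2 + ∑ e, c e ^ 2 <= nr p ^ 2 ∧ nr p' ^ 2 * Kc m ^ 2 + ∑ e, θ (r e) ^ 2 <= nr p ^ 2 * Kc m ^ 2 := by
  induction n with
  | zero =>
    intro p hp hn
    refine ⟨Empty, inferInstance, fun e => e.elim, fun e => e.elim, fun e => e.elim, fun e => e.elim, p, by simp, hp, ?_, by simp, by simp, by simp⟩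
    have hp0 : nr p = 0 := by
      have h1 := Kc_ge m
      have h2 := nr_nonneg p
      by_contra h0
      have : 0 < nr p ^ 2 * Kc m ^ 2 := by positivity
      simp at hn; linarith
    intro r a b A B hr ha hb _ _ _
    have h3 := cs p (A * B)
    rw [hp0, zero_mul, <- mul_assoc] at h3
    have := ht.trans_le (hθ r hr (by omega))
    have := nr_nonneg A
    have := nr_nonneg B
    exact h3.trans (by positivity)
  | succ n ih =>
    intro p hp hn
    by_cases hPB : PB m θ p
    · exact ⟨Empty, inferInstance, fun e => e.elim, fun e => e.elim, fun e => e.elim, fun e => e.elim, p, by simp, hp, hPB, by simp, by simp, by simp⟩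
    unfold PB at hPB
    push Not at hPB
    obtain ⟨r, a, b, A₀, B₀, hr, ha, hb, hab, hA, hB, hbig⟩ := hPB
    have hK := Kc_ge m
    have hK0 : 0 < Kc m := by linarith
    have hθr := hθ r hr (by omega)
    have hθ0 : 0 < θ r := ht.trans_le hθr
    have hup : |Ex (p * A₀ * B₀)| <= nr p * (Kc m * nr A₀ * nr B₀) := by
      rw [mul_assoc]
      exact (cs _ _).trans (mul_le_mul_of_nonneg_left (nr_mul (hA.trans (by omega)) (hB.trans (by omega))) (nr_nonneg p))
    have hAp : 0 < nr A₀ := by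
      rcases (nr_nonneg A₀).eq_or_lt with h | h
      · rw [<- h] at hup hbig; simp at hup hbig; exact absurd hup hbig
      · exact h
    have hBp : 0 < nr B₀ := by
      rcases (nr_nonneg B₀).eq_or_lt with h | h
      · rw [<- h] at hup hbig; simp at hup hbig; exact absurd hup hbig
      · exact h
    set A := C (nr A₀)⁻¹ * A₀ with hAdef
    set B := C (nr B₀)⁻¹ * B₀ with hBdef
    have nA : nr A = 1 := by rw [hAdef, nr_C_mul, abs_of_pos (by positivity), inv_mul_cancel₀ hAp.ne']
    have nB : nr B = 1 := by rw [hBdef, nr_C_mul, abs_of_pos (by positivity), inv_mul_cancel₀ hBp.ne']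
    have dC : ∀ (c : RR) (f : MP ι), (C c * f).totalDegree <= f.totalDegree := fun c f =>
      (totalDegree_mul _ _).trans (by simp)
    have dA : A.totalDegree <= a := (dC _ _).trans hA
    have dB : B.totalDegree <= b := (dC _ _).trans hB
    set g := Ex (p * (A * B)) with hg
    have hgb : θ r < |g| := by
      have : g = (nr A₀)⁻¹ * (nr B₀)⁻¹ * Ex (p * A₀ * B₀) := by
        rw [<- Ex_C_mul, hg, hAdef, hBdef, C_mul]; congr 1; ring
      rw [this, abs_mul, abs_of_pos (by positivity : 0 < (nr A₀)⁻¹ * (nr B₀)⁻¹)]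
      calc θ r = (nr A₀)⁻¹ * (nr B₀)⁻¹ * (θ r * nr A₀ * nr B₀) := by field_simp
        _ < _ := by gcongr
    set c := g / Kc m ^ 2 with hc
    have hnAB : nr (A * B) <= Kc m := by
      have := nr_mul (K := m) (dA.trans (by omega)) (dB.trans (by omega))
      rwa [nA, nB, mul_one, mul_one] at this
    have hdec : nr (p - C c * (A * B)) ^ 2 <= nr p ^ 2 - c ^ 2 * Kc m ^ 2 := by
      have e : (p - C c * (A * B)) * (p - C c * (A * B)) = p * p - C (2 * c) * (p * (A * B)) + C (c^2) * ((A * B) * (A * B)) := by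
        rw [C_mul, C_pow, show (C (2:RR) : MP ι) = 2 from map_ofNat C 2]; ring
      rw [nr_sq, e, map_add, map_sub, Ex_C_mul, Ex_C_mul, <- nr_sq, <- nr_sq, <- hg]
      have h1 : g = c * Kc m ^ 2 := by rw [hc]; field_simp
      have h2 : nr (A * B) ^ 2 <= Kc m ^ 2 := pow_le_pow_left₀ (nr_nonneg _) hnAB 2
      rw [h1]
      nlinarith [mul_le_mul_of_nonneg_left h2 (sq_nonneg c)]
    have hcK : c ^ 2 * Kc m ^ 2 * Kc m ^ 2 = g ^ 2 := by rw [hc]; field_simp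
    have hg2 : θ r ^ 2 <= g ^ 2 := by rw [<- sq_abs g]; gcongr
    have ht2 : t ^ 2 <= θ r ^ 2 := by gcongr
    have hK2 : 1 <= Kc m ^ 2 := one_le_pow₀ hK
    have hdK := mul_le_mul_of_nonneg_right hdec (show 0 <= Kc m ^ 2 by positivity)
    rw [sub_mul, hcK] at hdK
    have hdeg : (p - C c * (A * B)).totalDegree <= m :=
      (totalDegree_sub _ _).trans (max_le hp ((dC _ _).trans ((totalDegree_mul _ _).trans (by omega))))
    obtain ⟨τ, hτ, c', A', B', r', p', h1, h2, h3, h4, h5, h6⟩ := ih (p - C c * (A * B)) hdeg (by push_cast at hn; linarith)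
    refine ⟨Option τ, inferInstance, fun e => e.elim c c', fun e => e.elim A A', fun e => e.elim B B', fun e => e.elim r r', p', ?_, h2, h3, ?_, ?_, ?_⟩
    · rw [Fintype.sum_option]
      simp only [Option.elim_none, Option.elim_some]
      linear_combination h1
    · rintro (_ | e)
      · show 1 <= r ∧ r <= m ∧ A.totalDegree <= m - r ∧ B.totalDegree <= m - r ∧ nr A <= 1 ∧ nr B <= 1
        exact ⟨hr, by omega, dA.trans (by omega), dB.trans (by omega), nA.le, nB.le⟩
      · exact h4 e
    · rw [Fintype.sum_option]
      simp only [Option.elim_none, Option.elim_some]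
      have := mul_le_mul_of_nonneg_left hK2 (sq_nonneg c)
      linarith
    · rw [Fintype.sum_option]
      simp only [Option.elim_none, Option.elim_some]
      linarith
lemma deg_C_mul (c : RR) (f : MP ι) : (C c * f).totalDegree <= f.totalDegree :=
  (totalDegree_mul _ _).trans (by simp)
lemma half_node {A B : MP ι} {r : ℕ} (hA : A.totalDegree <= r) (hB : B.totalDegree <= r) (nA : nr A <= 1) (nB : nr B <= 1) :
    ((C (1/2) * (A + B)).totalDegree <= r ∧ nr (C (1/2) * (A + B)) <= 1) ∧
    ((C (1/2) * (A - B)).totalDegree <= r ∧ nr (C (1/2) * (A - B)) <= 1) := by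
  refine ⟨⟨(deg_C_mul _ _).trans ((totalDegree_add _ _).trans (max_le hA hB)), ?_⟩,
    ⟨(deg_C_mul _ _).trans ((totalDegree_sub _ _).trans (max_le hA hB)), ?_⟩⟩
  · rw [nr_C_mul, abs_of_pos (by norm_num)]; have := nr_add A B; linarith
  · rw [nr_C_mul, abs_of_pos (by norm_num)]; have := nr_sub A B; linarith
lemma half_id (A B : MP ι) : A * B = (C (1/2) * (A + B)) ^ 2 - (C (1/2) * (A - B)) ^ 2 := by
  have h : (4 : MP ι) * C (1/2) ^ 2 = 1 := by
    rw [<- C_pow, <- map_ofNat C 4, <- C_mul]; norm_num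
  linear_combination (-(A * B)) * h
lemma RL (m : ℕ) (hm : 1 <= m) : ∃ K : RR, 1 <= K ∧ ∀ (ι : Type) [Fintype ι] (T : ℕ), 1 <= T -> ∀ Q : MP ι,
    Q.totalDegree <= m -> nr Q <= 1 ->
    ∃ (τ : Type) (_ : Fintype τ) (c : τ -> RR) (q : τ -> MP ι) (r : τ -> ℕ) (Q' : MP ι) (c0 : RR),
      Q = Q' + ∑ e, C (c e) * q e ^ 2 + C c0 ∧ (∀ e, r e < m ∧ (q e).totalDegree <= r e ∧ nr (q e) <= 1) ∧
      ∑ e, c e ^ 2 <= 7 ∧ Q'.totalDegree <= m ∧ Ex (Q' ^ (2 * T)) <= (K * T) ^ T ∧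
      ∀ j, ∑ e, (if r e = j then (1:RR) else 0) <= K * (T:RR) ^ (2 * lam m (m - j) - 1) := by
  set D : RR := 2 * (m:RR) ^ 2 + 2 with hD
  have hD0 : 0 < D := by positivity
  have hKc := Kc_ge m
  obtain ⟨K0, hK0, hmom⟩ := moment m hm (D ^ (m+1) * Kc m ^ m) (by positivity)
  refine ⟨K0 + 2 * Kc m ^ 2 + 2, by nlinarith, ?_⟩
  intro ι _ T hT Q hQ nQ
  have hT1 : (1:RR) <= T := by exact_mod_cast hT
  have hT0 : (0:RR) < T := by linarith
  have hsq : 0 < √(T:RR) := Real.sqrt_pos.2 hT0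
  have hth0 : ∀ r, 0 < th m T r := fun r => by unfold th; positivity
  have ht : 0 < √(T:RR) / (T:RR) ^ (2 * m + 1) := by positivity
  obtain ⟨n, hn⟩ := exists_nat_ge (nr Q ^ 2 * Kc m ^ 2 / (√(T:RR) / (T:RR) ^ (2 * m + 1)) ^ 2)
  rw [div_le_iff₀ (by positivity)] at hn
  obtain ⟨τ, hτ, c, A, B, r, p', e1, e2, e3, e4, e5, e6⟩ := greedy m (th m T) ht (by
    intro r h1 h2
    unfold th
    gcongr
    unfold lam; split_ifs <;> omega) n Q hQ hn
  have hp'1 : nr p' <= 1 := by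
    have h1 : 0 <= ∑ e, c e ^ 2 := by positivity
    have h2 := nr_nonneg Q
    have h3 := nr_nonneg p'
    nlinarith
  obtain ⟨f, hf, ef⟩ := decomp e2
  have nf : nr (f m) <= 1 := (by rw [ef]; exact nr_comp_le' hf (by simp) : nr (f m) <= nr p').trans hp'1
  have nlow : nr (∑ j ∈ range m, f j) <= 1 :=
    (by rw [ef]; exact nr_comp_le hf (Finset.range_subset_range.2 (by omega)) : _ <= nr p').trans hp'1
  set low := ∑ j ∈ range m, f j with hlow
  have dlow : low.totalDegree <= m - 1 := totalDegree_finsetSum_le fun j hj => by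
    rw [mem_range] at hj
    exact (deg_H (hf j)).trans (by omega)
  have hblk : BlockHyp m T (D ^ (m+1) * Kc m ^ m) (f m) := by
    refine block_of_two hT (by positivity) ?_
    intro r hr a b hab ha hb A B hA hB
    refine top_bd m r (θ := D ^ (m+1) * th m T r) (by have := hth0 r; positivity) (hf m) ?_ hab ha hb hA hB
    intro a b hab ha hb A B hA hB
    exact comp_bd m r (hth0 r).le hf ef (fun a b A B h1 h2 h3 h4 h5 => e3 r a b A B hr h1 h2 h3 h4 h5) m le_rfl a b hab ha hb A B hA hB m le_rfl
  have hM := hmom ι T hT (f m) (hf m) nf hblk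
  have n1 : nr (1 : MP ι) <= 1 := by have := nr_C (ι := ι) 1; rw [C_1] at this; rw [this]; simp
  have hcount : ∀ j, ∑ e, (if m - r e = j then (1:RR) else 0) <= Kc m ^ 2 * (T:RR) ^ (2 * lam m (m - j) - 1) := by
    intro j
    have hs : ∑ e, (if m - r e = j then th m T (m - j) ^ 2 else 0) <= Kc m ^ 2 := by
      calc _ <= ∑ e, th m T (r e) ^ 2 := by
            refine sum_le_sum fun e _ => ?_
            split_ifs with h
            · have := (e4 e).2.1
              rw [show m - j = r e by omega]
            · positivity
        _ <= nr Q ^ 2 * Kc m ^ 2 := by have := sq_nonneg (nr p'); nlinarith [sq_nonneg (Kc m), mul_nonneg this (sq_nonneg (Kc m))]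
        _ <= 1 * Kc m ^ 2 := by gcongr; exact pow_le_one₀ (nr_nonneg Q) nQ
        _ = _ := one_mul _
    have hlam : 1 <= lam m (m - j) := by unfold lam; split_ifs <;> omega
    have hthsq : th m T (m-j) ^ 2 * (T:RR) ^ (2 * lam m (m - j) - 1) = 1 := by
      unfold th
      rw [div_pow, sq_sqrt hT0.le, <- pow_mul, div_mul_eq_mul_div, <- pow_succ', div_eq_one_iff_eq (by positivity)]
      congr 1; omega
    calc _ = (∑ e, (if m - r e = j then th m T (m - j) ^ 2 else 0)) * (T:RR) ^ (2 * lam m (m - j) - 1) := by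
          rw [sum_mul]; refine sum_congr rfl fun e _ => ?_
          split_ifs
          · exact hthsq.symm
          · simp
      _ <= _ := by gcongr
  have hN := fun e => half_node (e4 e).2.2.1 (e4 e).2.2.2.1 (e4 e).2.2.2.2.1 (e4 e).2.2.2.2.2
  have hL := half_node dlow (show (1 : MP ι).totalDegree <= m - 1 by simp) nlow n1
  refine ⟨(Unit ⊕ Unit) ⊕ (τ ⊕ τ), inferInstance,
    Sum.elim (Sum.elim (fun _ => 2) (fun _ => -(1/2))) (Sum.elim c (fun e => - c e)),
    Sum.elim (Sum.elim (fun _ => C (1/2) * (low + 1)) (fun _ => low)) (Sum.elim (fun e => C (1/2) * (A e + B e)) (fun e => C (1/2) * (A e - B e))),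
    Sum.elim (Sum.elim (fun _ => m - 1) (fun _ => m - 1)) (Sum.elim (fun e => m - r e) (fun e => m - r e)), f m, -(1/2), ?_, ?_, ?_, deg_H (hf m), ?_, ?_⟩
  · simp only [Fintype.sum_sum_type, Sum.elim_inl, Sum.elim_inr, univ_unique, sum_singleton, C_neg]
    have h1 : p' = low + f m := by rw [ef, Finset.sum_range_succ]
    have h2 : ∑ e, C (c e) * (A e * B e) = ∑ e, C (c e) * (C (1/2) * (A e + B e)) ^ 2 + ∑ e, -C (c e) * (C (1/2) * (A e - B e)) ^ 2 := by
      rw [<- sum_add_distrib]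
      refine sum_congr rfl fun e _ => ?_
      rw [half_id]; ring
    rw [e1, h2, h1]
    have h3 : (2 : MP ι) * C (1/2) = 1 := by rw [<- map_ofNat C 2, <- C_mul]; norm_num
    rw [show (C (2:RR) : MP ι) = 2 from map_ofNat C 2]
    linear_combination (-(C (1/2)) * (low + 1) ^ 2 - low) * h3
  · rintro ((_ | _) | (e | e))
    · exact ⟨show m - 1 < m by omega, hL.1⟩
    · exact ⟨show m - 1 < m by omega, dlow, nlow⟩
    · exact ⟨show m - r e < m by have := (e4 e).1; omega, (hN e).1⟩
    · exact ⟨show m - r e < m by have := (e4 e).1; omega, (hN e).2⟩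
  · simp only [Fintype.sum_sum_type, Sum.elim_inl, Sum.elim_inr, univ_unique, sum_singleton, neg_sq]
    have h1 := sq_nonneg (nr p')
    have h2 : nr Q ^ 2 <= 1 := pow_le_one₀ (nr_nonneg Q) nQ
    linarith
  · refine hM.trans ?_
    gcongr
    nlinarith
  · intro j
    simp only [Fintype.sum_sum_type, Sum.elim_inl, Sum.elim_inr, univ_unique, sum_singleton]
    have h1 := hcount j
    have h2 : (1:RR) <= (T:RR) ^ (2 * lam m (m - j) - 1) := one_le_pow₀ hT1
    have h3 : (if m - 1 = j then (1:RR) else 0) <= 1 := by split_ifs <;> norm_num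
    have h4 : 0 <= K0 * (T:RR) ^ (2 * lam m (m - j) - 1) := by positivity
    rw [add_mul, add_mul]
    refine (add_le_add (add_le_add h3 h3) (add_le_add h1 h1)).trans ?_
    linarith
lemma lin_bd (K : ℕ) : ∀ m, ∀ k η (L : MP ι →ₗ[RR] RR), 0 <= η -> m <= k -> k <= K ->
    (∀ α : ι →₀ ℕ, ∑ i, α i <= k -> |L (monomial α 1)| <= η) -> ∀ f ∈ H m,
    |L f| <= ((Fintype.card ι : RR) * (K + 1)) ^ m * η * nr f := by
  classical
  intro m
  induction m with
  | zero =>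
    intro k η L hη _ _ hL f hf
    obtain ⟨c, rfl⟩ := mem_H0.1 hf
    have h := hL 0 (by simp)
    rw [nr_C, show (C c : MP ι) = c • monomial 0 1 by rw [smul_monomial]; simp, map_smul, smul_eq_mul, abs_mul]
    nlinarith [abs_nonneg c]
  | succ m ih =>
    intro k η L hη hm hk hL f hf
    have h1 : ∀ i, |L (ds i (pderiv i f))| <= ((Fintype.card ι : RR) * (K + 1)) ^ m * ((K + 1) * η) * ((m + 1) * nr f) := by
      intro i
      have h := ih (k - 1) ((K + 1) * η) (L ∘ₗ ds i) (by positivity) (by omega) (by omega) ?_ (pderiv i f) (pd_mem i hf)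
      · refine h.trans ?_
        have h3 : nr (pderiv i f) <= (m + 1) * nr f := by
          have h4 : nr (pderiv i f) ^ 2 <= ∑ k, nr (pderiv k f) ^ 2 := single_le_sum (f := fun k => nr (pderiv k f) ^ 2) (fun _ _ => sq_nonneg _) (mem_univ i)
          rw [sum_pd_sq hf] at h4
          have := nr_nonneg f
          refine abs_le_of_sq_le_sq' (h4.trans ?_) (by positivity) |>.2
          push_cast
          rw [mul_pow]
          gcongr
          nlinarith [(Nat.cast_nonneg m : (0:RR) <= m)]
        gcongr
      · intro α hα
        have e1 : (X i * monomial α 1 : MP ι) = monomial (Finsupp.single i 1 + α) 1 := by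
          rw [X, monomial_mul, one_mul]
        have e2 : pderiv i (monomial α (1:RR)) = (α i : RR) • monomial (α - Finsupp.single i 1) 1 := by
          rw [pderiv_monomial, smul_monomial]; simp
        rw [LinearMap.comp_apply, ds_apply, e1, e2, map_sub, map_smul, smul_eq_mul]
        refine (abs_sub _ _).trans ?_
        rw [abs_mul, abs_of_nonneg (Nat.cast_nonneg (α i) : (0:RR) <= α i)]
        have b1 := hL (Finsupp.single i 1 + α) (by
          simp only [Finsupp.add_apply, sum_add_distrib, Finsupp.single_apply]
          simp; omega)
        have b2 := hL (α - Finsupp.single i 1) (le_trans (sum_le_sum (g := fun j => α j) fun j _ => by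
          rw [Finsupp.tsub_apply]; exact Nat.sub_le _ _) (show ∑ j, α j <= k by omega))
        have b3 : (α i : RR) <= K := by
          have : α i <= ∑ j, α j := single_le_sum (f := fun j => α j) (fun _ _ => Nat.zero_le _) (mem_univ i)
          exact_mod_cast (show α i <= K by omega)
        have b4 := mul_le_mul b3 b2 (abs_nonneg _) (Nat.cast_nonneg K)
        linarith
    have h2 : ((m:RR) + 1) * L f = ∑ i, L (ds i (pderiv i f)) := by
      rw [<- map_sum, Nop hf, C_mul', map_smul]; simp
    have h3 : ((m:RR) + 1) * |L f| <= ∑ i : ι, ((Fintype.card ι : RR) * (K + 1)) ^ m * ((K + 1) * η) * ((m + 1) * nr f) := by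
      rw [<- abs_of_pos (show (0:RR) < m + 1 by positivity), <- abs_mul, h2]
      refine (abs_sum_le_sum_abs _ _).trans ?_
      rw [abs_of_pos (show (0:RR) < m + 1 by positivity)]
      exact sum_le_sum fun i _ => h1 i
    rw [sum_const, Finset.card_univ, nsmul_eq_mul] at h3
    refine le_of_mul_le_mul_left (h3.trans (le_of_eq ?_)) (show (0:RR) < m + 1 by positivity)
    rw [pow_succ]; ring
lemma lin_bd' {K : ℕ} (hι : 1 <= Fintype.card ι) {η : RR} (L : MP ι →ₗ[RR] RR) (hη : 0 <= η)
    (hL : ∀ α : ι →₀ ℕ, ∑ i, α i <= K -> |L (monomial α 1)| <= η) {f : MP ι} (hf : f.totalDegree <= K) :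
    |L f| <= (K + 1) * ((Fintype.card ι : RR) * (K + 1)) ^ K * η * nr f := by
  obtain ⟨c, hc, e⟩ := decomp hf
  have h1 : (1:RR) <= (Fintype.card ι : RR) * (K + 1) := by
    have : (1:RR) <= Fintype.card ι := by exact_mod_cast hι
    nlinarith [(Nat.cast_nonneg K : (0:RR) <= K)]
  have h2 : ∀ j ∈ range (K + 1), |L (c j)| <= ((Fintype.card ι : RR) * (K + 1)) ^ K * η * nr f := by
    intro j hj
    have hn : nr (c j) <= nr f := by rw [e]; exact nr_comp_le' hc hj
    rw [mem_range] at hj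
    refine (lin_bd K j K η L hη (by omega) le_rfl hL _ (hc j)).trans ?_
    have := nr_nonneg (c j)
    gcongr
    omega
  calc |L f| = |∑ j ∈ range (K+1), L (c j)| := by rw [<- map_sum, <- e]
    _ <= _ := (abs_sum_le_sum_abs _ _).trans (sum_le_card_nsmul _ _ _ h2)
    _ = _ := by simp; ring
def Good (K : ℕ) (ρ : RR) (μ : Measure (ι -> RR)) : Prop :=
  ∀ g : MP ι, g.totalDegree <= K -> Integrable (fun x => eval x g) μ ∧
    |∫ x, eval x g ∂μ - Ex g| <= ρ * nr g ∧ Integrable (fun x => eval x g ^ 2) μ ∧ ∫ x, eval x g ^ 2 ∂μ <= 2 * nr g ^ 2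
lemma good_of_mm (hι : 1 <= Fintype.card ι) {μ : Measure (ι -> RR)} {k : ℕ} {η : RR} (hη : 0 <= η) (hμ : MomentMatches k η μ)
    {K : ℕ} {ρ : RR} (hK : 2 * K <= k) (h1 : (k + 1) * ((Fintype.card ι : RR) * (k + 1)) ^ k * η <= ρ) (h2 : ρ * Kc K <= 1) :
    Good K ρ μ := by
  classical
  have hdeg : ∀ g : MP ι, g.totalDegree <= k -> ∀ α ∈ g.support, ∑ i, α i <= k := by
    intro g hg α hα
    have := (le_totalDegree hα).trans hg
    rwa [Finsupp.sum_fintype _ _ (by simp)] at this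
  have hm : ∀ α : ι →₀ ℕ, ∑ i, α i <= k -> Integrable (fun x : ι -> RR => ∏ i, x i ^ α i) μ := by
    intro α hα
    have := (hμ α hα).1
    refine (integrable_norm_iff ?_).1 (by simpa [Finset.abs_prod, abs_pow] using this)
    exact (by fun_prop : Continuous fun x : ι -> RR => ∏ i, x i ^ α i).aestronglyMeasurable
  have hI : ∀ g : MP ι, g.totalDegree <= k -> Integrable (fun x => eval x g) μ := by
    intro g hg
    simp only [eval_eq']
    exact integrable_finsetSum _ fun α hα => (hm α (hdeg g hg α hα)).const_mul _
  set L : MP ι →ₗ[RR] RR := (basisMonomials ι RR).constr RR (fun α : ι →₀ ℕ => if ∑ i, α i <= k then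
    (∫ x, ∏ i, (x i) ^ α i ∂μ) - ∫ y, ∏ i, (y i) ^ α i ∂(stdGaussianPi ι) else 0) with hLdef
  have hLm : ∀ α : ι →₀ ℕ, ∑ i, α i <= k -> L (monomial α 1) = (∫ x, ∏ i, (x i) ^ α i ∂μ) - ∫ y, ∏ i, (y i) ^ α i ∂(stdGaussianPi ι) := by
    intro α hα
    have := (basisMonomials ι RR).constr_basis RR (fun α : ι →₀ ℕ => if ∑ i, α i <= k then
      (∫ x, ∏ i, (x i) ^ α i ∂μ) - ∫ y, ∏ i, (y i) ^ α i ∂(stdGaussianPi ι) else 0) α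
    rw [coe_basisMonomials, <- hLdef] at this
    rw [this, if_pos hα]
  have hL : ∀ g : MP ι, g.totalDegree <= k -> L g = ∫ x, eval x g ∂μ - Ex g := by
    intro g hg
    rw [Ex_def]
    simp only [eval_eq']
    rw [integral_finsetSum _ fun α hα => (hm α (hdeg g hg α hα)).const_mul _, integral_finsetSum _ fun α _ => (int_mono _).const_mul _,
      <- sum_sub_distrib]
    conv_lhs => rw [g.as_sum, map_sum]
    refine sum_congr rfl fun α hα => ?_
    rw [integral_const_mul, integral_const_mul, <- mul_sub, <- hLm α (hdeg g hg α hα), <- smul_eq_mul, <- map_smul, smul_monomial]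
    simp
  have hbd : ∀ g : MP ι, g.totalDegree <= k -> |∫ x, eval x g ∂μ - Ex g| <= ρ * nr g := by
    intro g hg
    rw [<- hL g hg]
    refine (lin_bd' hι L hη (fun α hα => ?_) hg).trans (mul_le_mul_of_nonneg_right h1 (nr_nonneg g))
    rw [hLm α hα]; exact (hμ α hα).2
  intro g hg
  have hgg : (g * g).totalDegree <= k := (totalDegree_mul _ _).trans (by omega)
  have e : (fun x => eval x g ^ 2) = fun x => eval x (g * g) := by ext x; rw [map_mul (eval x)]; ring
  refine ⟨hI g (by omega), hbd g (by omega), ?_, ?_⟩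
  · rw [e]; exact hI _ hgg
  · rw [e]
    have h3 := (abs_le.1 (hbd _ hgg)).2
    have h4 := nr_mul hg hg
    have h5 := nr_nonneg g
    have h6 : 0 <= ρ := le_trans (by positivity) h1
    have h7 := mul_le_mul_of_nonneg_left h4 h6
    rw [<- nr_sq] at h3
    have h8 : ρ * (Kc K * nr g * nr g) <= 1 * nr g ^ 2 := by
      calc _ = ρ * Kc K * nr g ^ 2 := by ring
        _ <= _ := by gcongr
    linarith
lemma eq_zero_of_nr {p : MP ι} (h : nr p = 0) : p = 0 := by
  classical
  by_cases hι : 1 <= Fintype.card ι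
  · ext α
    have := lin_bd' (K := p.totalDegree) hι (η := 1) ((basisMonomials ι RR).coord α) zero_le_one (fun β _ => ?_) le_rfl
    · rw [h, mul_zero] at this
      have := abs_nonpos_iff.1 this
      rw [coeff_zero]; exact this
    · have : (basisMonomials ι RR).coord α (monomial β 1) = if β = α then 1 else 0 := by
        rw [<- coeff_monomial]; rfl
      rw [this]; split_ifs <;> simp
  · have : IsEmpty ι := Fintype.card_eq_zero_iff.1 (by omega)
    rw [eq_C_of_isEmpty p, nr_C] at h
    rw [eq_C_of_isEmpty p, abs_eq_zero.1 h, C_0]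
lemma term1 {b : ℂ} (hb : 0 < b.re) : ∃ ω : RR -> ℂ, Continuous ω ∧
    (∀ t : RR, Integrable (fun ζ : RR => ω ζ * ec (Ic * ζ * t)) ∧
      ∫ ζ : RR, ω ζ * ec (Ic * ζ * t) = ec (-b * t ^ 2)) ∧
    ∀ v : RR, v <= b.re / (4 * normSq b) -> Integrable (fun ζ => ‖ω ζ‖ * er (v * ζ ^ 2 / 2)) ∧
      ∫ ζ, ‖ω ζ‖ * er (v * ζ ^ 2 / 2) <= √(2 * ‖b‖ / b.re) := by
  have hb0 : b ≠ 0 := by rintro rfl; simp at hb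
  have hn : 0 < ‖b‖ := norm_pos_iff.2 hb0
  have hns : 0 < normSq b := Complex.normSq_pos.2 hb0
  set β : ℂ := (4 * b)⁻¹ with hβ
  have hβ0 : β ≠ 0 := inv_ne_zero (mul_ne_zero (by norm_num) hb0)
  have hβr : β.re = b.re / (4 * normSq b) := by
    rw [hβ, Complex.inv_re, Complex.normSq_mul]
    simp [Complex.normSq_apply]
    field_simp
  have hβp : 0 < β.re := by rw [hβr]; positivity
  have hβn : ‖β‖ = 1 / (4 * ‖b‖) := by rw [hβ]; simp
  set z : ℂ := (pR / β) ^ (1 / 2 : ℂ) with hz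
  have hz2 : z ^ 2 = pR / β := by
    rw [hz, <- Complex.cpow_nat_mul]; norm_num
  have hz0 : z ≠ 0 := by
    intro h; rw [h] at hz2
    have : (pR : ℂ) / β ≠ 0 := div_ne_zero (by exact_mod_cast Real.pi_ne_zero) hβ0
    exact this (by rw [<- hz2]; simp)
  have hzn : ‖z‖ = √(pR / ‖β‖) := by
    rw [eq_comm, Real.sqrt_eq_iff_mul_self_eq (by positivity) (norm_nonneg _), <- sq, <- norm_pow, hz2, norm_div, norm_real,
      norm_of_nonneg Real.pi_pos.le]
  have hω : ∀ ζ : RR, ‖z⁻¹ * ec (-β * ζ ^ 2)‖ = √(‖β‖ / pR) * er (-β.re * ζ ^ 2) := by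
    intro ζ
    rw [norm_mul, norm_inv, hzn, Complex.norm_exp, <- Real.sqrt_inv, inv_div]
    congr 2
    rw [<- Complex.ofReal_pow, Complex.mul_re, ofReal_re, Complex.ofReal_im, Complex.neg_re, mul_zero, sub_zero]
  have hig : ∀ a : RR, 0 < a -> Integrable (fun ζ : RR => er (-a * ζ ^ 2)) := fun a ha => integrable_exp_neg_mul_sq ha
  refine ⟨fun ζ => z⁻¹ * ec (-β * ζ ^ 2), by fun_prop, fun t => ⟨?_, ?_⟩, fun v hv => ?_⟩
  · refine ((hig β.re hβp).const_mul (√(‖β‖ / pR))).mono' (by fun_prop) (Filter.Eventually.of_forall fun ζ => ?_)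
    rw [norm_mul, hω, show Ic * ζ * t = ((ζ * t : RR) : ℂ) * Ic by push_cast; ring, norm_exp_ofReal_mul_I, mul_one]
  · have h := integral_cexp_quadratic (b := -β) (by simpa using hβp) (Ic * t) 0
    rw [neg_neg, <- hz] at h
    have e : ∀ ζ : RR, z⁻¹ * ec (-β * ζ ^ 2) * ec (Ic * ζ * t) =
        z⁻¹ * ec (-β * ζ ^ 2 + Ic * t * ζ + 0) := by
      intro ζ; rw [mul_assoc, <- exp_add]; congr 2; ring
    simp only [e]
    rw [integral_const_mul, h, inv_mul_cancel_left₀ hz0]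
    congr 1
    rw [hβ, mul_pow, Complex.I_sq]; field_simp; ring
  · rw [<- hβr] at hv
    have hle : ∀ ζ : RR, ‖z⁻¹ * ec (-β * ζ ^ 2)‖ * er (v * ζ ^ 2 / 2) <= √(‖β‖ / pR) * er (-(β.re / 2) * ζ ^ 2) := by
      intro ζ
      rw [hω, mul_assoc, <- Real.exp_add]
      gcongr
      nlinarith [sq_nonneg ζ, mul_le_mul_of_nonneg_right hv (sq_nonneg ζ)]
    have hI := (hig (β.re / 2) (by positivity)).const_mul (√(‖β‖ / pR))
    have hI2 : Integrable (fun ζ : RR => ‖z⁻¹ * ec (-β * ζ ^ 2)‖ * er (v * ζ ^ 2 / 2)) := by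
      refine hI.mono' (by fun_prop) (Filter.Eventually.of_forall fun ζ => ?_)
      rw [norm_of_nonneg (by positivity)]; exact hle ζ
    refine ⟨hI2, (integral_mono hI2 hI hle).trans (le_of_eq ?_)⟩
    rw [integral_const_mul, integral_gaussian, <- sqrt_mul (by positivity)]
    congr 1
    have hb2 : normSq b = ‖b‖ ^ 2 := Complex.normSq_eq_norm_sq b
    rw [hβn, hβr, hb2]; field_simp
noncomputable def chi (s : RR) (J : ℕ) (t : RR) : RR := 1 - (1 - er (-(s * t ^ 2))) ^ J
lemma chi_aux {s : RR} (hs : 0 <= s) (t : RR) : 0 <= 1 - er (-(s * t ^ 2)) ∧ 1 - er (-(s * t ^ 2)) <= 1 ∧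
    1 - er (-(s * t ^ 2)) <= s * t ^ 2 := by
  have h1 := add_one_le_exp (-(s * t ^ 2))
  have h2 : er (-(s * t ^ 2)) <= 1 := Real.exp_le_one_iff.2 (by have := sq_nonneg t; nlinarith [mul_nonneg hs this])
  have h3 := exp_pos (-(s * t ^ 2))
  exact ⟨by linarith, by linarith, by linarith⟩
lemma chi_mem {s : RR} (hs : 0 <= s) (J : ℕ) (t : RR) : 0 <= chi s J t ∧ chi s J t <= 1 := by
  obtain ⟨h1, h2, _⟩ := chi_aux hs t
  have h3 := pow_le_one₀ (n := J) h1 h2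
  have h4 := pow_nonneg h1 J
  unfold chi; constructor <;> linarith
lemma chi_sub {s : RR} (hs : 0 <= s) (J : ℕ) (t : RR) : 1 - chi s J t <= s ^ J * (t ^ J) ^ 2 := by
  obtain ⟨h1, h2, h3⟩ := chi_aux hs t
  unfold chi
  rw [sub_sub_cancel]
  calc _ <= (s * t ^ 2) ^ J := pow_le_pow_left₀ h1 h3 J
    _ = _ := by rw [mul_pow, <- pow_mul, <- pow_mul, mul_comm 2 J]
lemma chi_cont (s : RR) (J : ℕ) : Continuous (chi s J) := by unfold chi; fun_prop
noncomputable def nf (s : RR) (J : ℕ) (c t : RR) : ℂ := ec (Ic * c * t ^ 2) * chi s J t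
lemma nf_norm {s : RR} (hs : 0 <= s) (J : ℕ) (c t : RR) : ‖nf s J c t‖ <= 1 := by
  unfold nf
  rw [norm_mul, show Ic * c * t ^ 2 = ((c * t ^ 2 : RR) : ℂ) * Ic by push_cast; ring, norm_exp_ofReal_mul_I, one_mul,
    norm_real, norm_of_nonneg (chi_mem hs J t).1]
  exact (chi_mem hs J t).2
lemma nf_cont (s : RR) (J : ℕ) (c : RR) : Continuous (nf s J c) := by
  have := chi_cont s J
  unfold nf; fun_prop
noncomputable def vv (s : RR) (J : ℕ) (c : RR) : RR := s / (4 * ((J:RR) ^ 2 * s ^ 2 + c ^ 2))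
lemma node {s : RR} (hs : 0 < s) (J : ℕ) (c : RR) : ∃ ω : RR -> ℂ, Continuous ω ∧
    (∀ t : RR, ∫ ζ : RR, ω ζ * ec (Ic * ζ * t) = nf s J c t) ∧
    Integrable (fun ζ => ‖ω ζ‖ * er (vv s J c * ζ ^ 2 / 2)) ∧
    ∫ ζ, ‖ω ζ‖ * er (vv s J c * ζ ^ 2 / 2) <= 2 ^ J * √(2 + 2 * |c| / s) := by
  have hre : ∀ a : ℕ, (((a + 1 : ℕ) * s : RR) - Ic * c : ℂ).re = (a + 1) * s := by intro a; simp
  have him : ∀ a : ℕ, (((a + 1 : ℕ) * s : RR) - Ic * c : ℂ).im = - c := by intro a; simp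
  choose w hw1 hw2 hw3 using fun a : ℕ => term1 (b := (((a + 1 : ℕ) * s : RR) - Ic * c : ℂ)) (by rw [hre]; positivity)
  set k : ℕ -> RR := fun a => (-1) ^ a * (J.choose (a + 1) : RR) with hk
  have hv : ∀ a ∈ range J, vv s J c <= (((a + 1 : ℕ) * s : RR) - Ic * c : ℂ).re / (4 * normSq (((a + 1 : ℕ) * s : RR) - Ic * c : ℂ)) := by
    intro a ha
    have ha' : ((a:RR) + 1) <= J := by exact_mod_cast mem_range.1 ha
    have ha0 : (0:RR) <= a := a.cast_nonneg
    rw [Complex.normSq_apply, hre, him, vv]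
    have h1 : ((a:RR) + 1) ^ 2 * s ^ 2 <= (J:RR) ^ 2 * s ^ 2 := by gcongr
    rw [show (((a:RR) + 1) * s) * (((a:RR) + 1) * s) + -c * -c = ((a:RR) + 1) ^ 2 * s ^ 2 + c ^ 2 by ring]
    apply div_le_div₀ (by positivity) _ (by positivity) (by gcongr)
    nlinarith
  have hI : ∀ a ∈ range J, Integrable (fun ζ => |k a| * (‖w a ζ‖ * er (vv s J c * ζ ^ 2 / 2))) := fun a ha =>
    ((hw3 a _ (hv a ha)).1).const_mul _
  have hle : ∀ ζ : RR, ‖∑ a ∈ range J, (k a : ℂ) * w a ζ‖ * er (vv s J c * ζ ^ 2 / 2) <=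
      ∑ a ∈ range J, |k a| * (‖w a ζ‖ * er (vv s J c * ζ ^ 2 / 2)) := by
    intro ζ
    simp only [<- mul_assoc]
    rw [<- sum_mul]
    gcongr
    refine (norm_sum_le _ _).trans (le_of_eq (sum_congr rfl fun a _ => ?_))
    rw [norm_mul, norm_real, norm_eq_abs]
  have hc : Continuous fun ζ => ∑ a ∈ range J, (k a : ℂ) * w a ζ := by
    refine continuous_finsetSum _ fun a _ => (hw1 a).const_mul _
  have hI2 : Integrable (fun ζ : RR => ‖∑ a ∈ range J, (k a : ℂ) * w a ζ‖ * er (vv s J c * ζ ^ 2 / 2)) := by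
    refine (integrable_finsetSum _ hI).mono' (by fun_prop) (Filter.Eventually.of_forall fun ζ => ?_)
    rw [norm_of_nonneg (by positivity)]; exact hle ζ
  refine ⟨fun ζ => ∑ a ∈ range J, (k a : ℂ) * w a ζ, hc, fun t => ?_, hI2, ?_⟩
  · simp only [sum_mul, mul_assoc (Complex.ofReal _)]
    rw [integral_finsetSum _ fun a _ => ((hw2 a t).1).const_mul _]
    simp only [integral_const_mul, (hw2 _ t).2]
    have h1 : (chi s J t : ℂ) = ∑ a ∈ range J, (k a : ℂ) * ec (-(s * t ^ 2)) ^ (a + 1) := by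
      have h2 := add_pow (-ec (-(s * t ^ 2))) 1 J
      rw [sum_range_succ'] at h2
      unfold chi
      push_cast
      rw [sub_eq_neg_add (1:ℂ) (ec _), h2]
      simp only [one_pow, mul_one, pow_zero, Nat.choose_zero_right, Nat.cast_one, sub_add_cancel_right]
      rw [<- Finset.sum_neg_distrib]
      refine sum_congr rfl fun a _ => ?_
      rw [hk, neg_pow (ec _)]; push_cast; rw [pow_succ (-1 : ℂ)]; ring
    rw [nf, h1, mul_sum]
    refine sum_congr rfl fun a _ => ?_
    rw [<- Complex.exp_nat_mul, mul_left_comm, <- exp_add]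
    congr 2; push_cast; ring
  · refine (integral_mono hI2 (integrable_finsetSum _ hI) hle).trans ?_
    rw [integral_finsetSum _ hI]
    have h3 : ∀ a ∈ range J, ∫ ζ, |k a| * (‖w a ζ‖ * er (vv s J c * ζ ^ 2 / 2)) <= (J.choose (a+1) : RR) * √(2 + 2 * |c| / s) := by
      intro a ha
      rw [integral_const_mul]
      have h4 : |k a| = J.choose (a+1) := by rw [hk]; simp
      rw [h4]
      gcongr
      refine ((hw3 a _ (hv a ha)).2).trans (sqrt_le_sqrt ?_)
      have h5 := Complex.norm_le_abs_re_add_abs_im (((a + 1 : ℕ) * s : RR) - Ic * c : ℂ)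
      rw [hre, him, abs_neg, abs_of_pos (by positivity : 0 < ((a:RR)+1) * s)] at h5
      rw [hre, div_le_iff₀ (by positivity)]
      have h6 : 2 * |c| / s * ((a + 1) * s) = 2 * |c| * (a + 1) := by field_simp
      rw [add_mul, h6]
      nlinarith [abs_nonneg c, (Nat.cast_nonneg a : (0:RR) <= a), mul_nonneg (abs_nonneg c) (Nat.cast_nonneg a : (0:RR) <= a)]
    refine (sum_le_sum h3).trans ?_
    rw [<- sum_mul]
    gcongr
    have h7 := Nat.sum_range_choose J
    rw [sum_range_succ'] at h7
    have : ∑ a ∈ range J, J.choose (a + 1) <= 2 ^ J := by omega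
    exact_mod_cast this
lemma superpos {X : Type} [MeasurableSpace X] (μ : Measure X) [IsFiniteMeasure μ] {σ : Type} [Fintype σ] (ω : σ -> RR -> ℂ)
    (hc : ∀ i, Continuous (ω i)) (hI : ∀ i, Integrable (ω i)) (Q : σ -> X -> RR) (hQ : ∀ i, Measurable (Q i)) (F : X -> ℂ) (hF : Integrable F μ) :
    Integrable (fun z : σ -> RR => (∏ i, ω i (z i)) * ∫ x, F x * ec (Ic * ∑ i, (z i : ℂ) * Q i x) ∂μ) ∧
    ∫ x, F x * ∏ i, (∫ ζ : RR, ω i ζ * ec (Ic * ζ * Q i x)) ∂μ =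
      ∫ z : σ -> RR, (∏ i, ω i (z i)) * ∫ x, F x * ec (Ic * ∑ i, (z i : ℂ) * Q i x) ∂μ := by
  have hP : Integrable (fun z : σ -> RR => ∏ i, ω i (z i)) := Integrable.fintype_prod (f := ω) hI
  have hint : Integrable (Function.uncurry fun (x : X) (z : σ -> RR) => F x * ((∏ i, ω i (z i)) * ec (Ic * ∑ i, (z i : ℂ) * Q i x)))
      (μ.prod volume) := by
    refine (hF.mul_prod hP).mono ?_ (Filter.Eventually.of_forall fun ⟨x, z⟩ => ?_)
    · refine hF.aestronglyMeasurable.comp_fst.mul (AEStronglyMeasurable.mul ?_ ?_)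
      · exact (by fun_prop : Continuous fun z : σ -> RR => ∏ i, ω i (z i)).aestronglyMeasurable.comp_snd
      · refine Measurable.aestronglyMeasurable ?_
        fun_prop
    · simp only [Function.uncurry, norm_mul]
      rw [show Ic * ∑ i, (z i : ℂ) * Q i x = ((∑ i, z i * Q i x : RR) : ℂ) * Ic by push_cast; ring, norm_exp_ofReal_mul_I, mul_one]
  have e1 : ∀ x, F x * ∏ i, (∫ ζ : RR, ω i ζ * ec (Ic * ζ * Q i x)) =
      ∫ z : σ -> RR, F x * ((∏ i, ω i (z i)) * ec (Ic * ∑ i, (z i : ℂ) * Q i x)) := by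
    intro x
    rw [<- integral_fintype_prod_volume_eq_prod (fun i (ζ : RR) => ω i ζ * ec (Ic * ζ * Q i x)), integral_const_mul]
    congr 2
    ext z
    rw [prod_mul_distrib, <- Complex.exp_sum, mul_sum]
    simp only [mul_assoc]
  have e2 : ∀ z : σ -> RR, (∏ i, ω i (z i)) * ∫ x, F x * ec (Ic * ∑ i, (z i : ℂ) * Q i x) ∂μ =
      ∫ x, F x * ((∏ i, ω i (z i)) * ec (Ic * ∑ i, (z i : ℂ) * Q i x)) ∂μ := by
    intro z; rw [<- integral_const_mul]; congr 1; ext x; ring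
  simp only [e1, e2]
  exact ⟨hint.integral_prod_right, integral_integral_swap hint⟩
noncomputable def DD (μ : Measure (ι -> RR)) (F : (ι -> RR) -> ℂ) : ℂ := ∫ x, F x ∂μ - ∫ x, F x ∂(stdGaussianPi ι)
lemma superpos_bd (μ : Measure (ι -> RR)) [IsFiniteMeasure μ] {σ : Type} [Fintype σ] (ω : σ -> RR -> ℂ)
    (hc : ∀ i, Continuous (ω i)) (v : σ -> RR) (hv : ∀ i, 0 <= v i) {W : RR}
    (hI : ∀ i, Integrable (fun ζ => ‖ω i ζ‖ * er (v i * ζ ^ 2 / 2)))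
    (hW : ∀ i, ∫ ζ, ‖ω i ζ‖ * er (v i * ζ ^ 2 / 2) <= W)
    (Q : σ -> (ι -> RR) -> RR) (hQ : ∀ i, Measurable (Q i)) (F : (ι -> RR) -> ℂ) (hF : Integrable F μ) (hF' : Integrable F (stdGaussianPi ι))
    {E : RR} (hE : 0 <= E)
    (hb : ∀ z : σ -> RR, ‖DD μ (fun x => F x * ec (Ic * ∑ i, (z i : ℂ) * Q i x))‖ <= E * er (∑ i, v i * z i ^ 2 / 2)) :
    ‖DD μ (fun x => F x * ∏ i, (∫ ζ : RR, ω i ζ * ec (Ic * ζ * Q i x)))‖ <= E * W ^ (Fintype.card σ) := by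
  have hI' : ∀ i, Integrable (ω i) := fun i => by
    refine (hI i).mono' (hc i).aestronglyMeasurable (Filter.Eventually.of_forall fun ζ => ?_)
    refine le_mul_of_one_le_right (norm_nonneg _) (one_le_exp ?_)
    have := hv i; positivity
  obtain ⟨a1, a2⟩ := superpos μ ω hc hI' Q hQ F hF
  obtain ⟨b1, b2⟩ := superpos (stdGaussianPi ι) ω hc hI' Q hQ F hF'
  rw [DD, a2, b2, <- integral_sub a1 b1]
  have hJ : Integrable (fun z : σ -> RR => ∏ i, (‖ω i (z i)‖ * er (v i * z i ^ 2 / 2))) := Integrable.fintype_prod hI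
  calc _ <= ∫ z : σ -> RR, E * ∏ i, (‖ω i (z i)‖ * er (v i * z i ^ 2 / 2)) := by
        refine norm_integral_le_of_norm_le (hJ.const_mul E) (Filter.Eventually.of_forall fun z => ?_)
        rw [<- mul_sub, norm_mul, norm_prod, prod_mul_distrib, <- Real.exp_sum]
        refine (mul_le_mul_of_nonneg_left (hb z) (prod_nonneg fun _ _ => norm_nonneg _)).trans (le_of_eq (by ring))
    _ = E * ∏ i, ∫ ζ, ‖ω i ζ‖ * er (v i * ζ ^ 2 / 2) := by
        rw [integral_const_mul]
        congr 1
        exact integral_fintype_prod_volume_eq_prod (fun i (ζ : RR) => ‖ω i ζ‖ * er (v i * ζ ^ 2 / 2))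
    _ <= E * W ^ (Fintype.card σ) := by
        gcongr
        calc _ <= ∏ i : σ, W := prod_le_prod (fun i _ => integral_nonneg fun ζ => by positivity) fun i _ => hW i
          _ = _ := by simp
lemma exp_tay {u : ℂ} (hu : u.re = 0) (hn : ‖u‖ = 1) (T : ℕ) : ∀ y : RR, 0 <= y ->
    ‖ec (u * y) - ∑ j ∈ range T, (u * y) ^ j / (j.factorial : ℂ)‖ <= y ^ T / T.factorial := by
  induction T with
  | zero => intro y _; simp [Complex.norm_exp, hu]
  | succ T ih =>
    intro y hy
    have hd : ∀ x : RR, HasDerivAt (fun x : RR => ec (u * x) - ∑ j ∈ range (T+1), (u * x) ^ j / (j.factorial : ℂ))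
        (u * (ec (u * x) - ∑ j ∈ range T, (u * x) ^ j / (j.factorial : ℂ))) x := by
      intro x
      have h1 : HasDerivAt (fun x : RR => u * (x : ℂ)) u x := by simpa using (Complex.ofRealCLM.hasDerivAt (x := x)).const_mul u
      have h2 : ∀ j ∈ range T, HasDerivAt (fun x : RR => (u * (x : ℂ)) ^ (j+1) / ((j+1).factorial : ℂ)) (u * ((u * x) ^ j / (j.factorial : ℂ))) x := by
        intro j _
        refine ((h1.pow (j+1)).div_const _).congr_deriv ?_
        rw [Nat.factorial_succ]; push_cast
        have : (j.factorial : ℂ) ≠ 0 := by exact_mod_cast j.factorial_ne_zero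
        have : (j:ℂ) + 1 ≠ 0 := by exact_mod_cast j.succ_ne_zero
        field_simp
      simp only [sum_range_succ' _ T, pow_zero]
      refine (h1.cexp.fun_sub ((HasDerivAt.fun_sum h2).add_const (1 / ((Nat.factorial 0 : ℕ) : ℂ)))).congr_deriv ?_
      rw [mul_sub, mul_sum]; ring
    have hB : ∀ x : RR, HasDerivAt (fun x : RR => x ^ (T+1) / ((T+1).factorial : RR)) (x ^ T / T.factorial) x := by
      intro x
      refine ((hasDerivAt_pow (T+1) x).div_const _).congr_deriv ?_
      rw [Nat.factorial_succ]; push_cast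
      have : (T.factorial : RR) ≠ 0 := by exact_mod_cast T.factorial_ne_zero
      field_simp
    refine image_norm_le_of_norm_deriv_right_le_deriv_boundary (a := 0) (b := y) (fun x _ => (hd x).continuousAt.continuousWithinAt)
      (fun x _ => (hd x).hasDerivWithinAt) ?_ hB ?_ ⟨hy, le_rfl⟩
    · rw [sum_range_succ']; simp
    · intro x hx
      rw [norm_mul, hn, one_mul]; exact ih x hx.1
lemma exp_tay' (T : ℕ) (y : RR) :
    ‖ec (Ic * y) - ∑ j ∈ range T, (Ic * y) ^ j / (j.factorial : ℂ)‖ <= |y| ^ T / T.factorial := by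
  rcases le_total 0 y with h | h
  · rw [abs_of_nonneg h]; exact exp_tay (by simp) (by simp) T y h
  · have := exp_tay (u := -Ic) (by simp) (by simp) T (-y) (by linarith)
    rw [abs_of_nonpos h]; simpa using this
lemma good_gauss (g : MP ι) : Integrable (fun x => eval x g ^ 2) (stdGaussianPi ι) ∧ ∫ x, eval x g ^ 2 ∂(stdGaussianPi ι) = nr g ^ 2 := by
  have e : (fun x => eval x g ^ 2) = fun x => eval x (g * g) := by ext x; rw [map_mul (eval x)]; ring
  rw [e, nr_sq]; exact ⟨int_poly _, rfl⟩
lemma cs_int {X : Type} [MeasurableSpace X] (μ : Measure X) {f g : X -> RR} (hfm : AEStronglyMeasurable f μ) (hgm : AEStronglyMeasurable g μ) (hf : Integrable (fun x => f x ^ 2) μ)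
    (hg : Integrable (fun x => g x ^ 2) μ) {a b : RR} (ha : 0 <= a) (hb : 0 <= b) (h1 : ∫ x, f x ^ 2 ∂μ <= a ^ 2) (h2 : ∫ x, g x ^ 2 ∂μ <= b ^ 2) :
    Integrable (fun x => |f x| * |g x|) μ ∧ ∫ x, |f x| * |g x| ∂μ <= a * b := by
  have hI : Integrable (fun x => |f x| * |g x|) μ := by
    refine (hf.add hg).mono' (hfm.norm.mul hgm.norm) (Filter.Eventually.of_forall fun x => ?_)
    rw [norm_of_nonneg (by positivity)]
    simp only [Pi.add_apply]
    nlinarith [sq_nonneg (|f x| - |g x|), sq_abs (f x), sq_abs (g x)]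
  refine ⟨hI, ?_⟩
  refine le_of_forall_pos_le_add fun e he => ?_
  have key : ∀ t : RR, 0 < t -> ∫ x, |f x| * |g x| ∂μ <= (t * a ^ 2 + t⁻¹ * b ^ 2) / 2 := by
    intro t ht
    calc _ <= ∫ x, (t / 2 * f x ^ 2 + t⁻¹ / 2 * g x ^ 2) ∂μ := by
          refine integral_mono hI ((hf.const_mul _).add (hg.const_mul _)) fun x => ?_
          simp only
          rw [<- sq_abs (f x), <- sq_abs (g x)]
          have : t / 2 * |f x| ^ 2 + t⁻¹ / 2 * |g x| ^ 2 - |f x| * |g x| = (t * |f x| - |g x|) ^ 2 / (2 * t) := by field_simp; ring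
          have h3 : 0 <= (t * |f x| - |g x|) ^ 2 / (2 * t) := by positivity
          linarith
      _ = t / 2 * ∫ x, f x ^ 2 ∂μ + t⁻¹ / 2 * ∫ x, g x ^ 2 ∂μ := by
          rw [integral_add (hf.const_mul _) (hg.const_mul _), integral_const_mul, integral_const_mul]
      _ <= t / 2 * a ^ 2 + t⁻¹ / 2 * b ^ 2 := by gcongr
      _ = _ := by ring
  rcases ha.eq_or_lt with rfl | ha'
  · have := key ((b ^ 2 + 1) / e) (by positivity)
    simp only [inv_div] at this
    have h5 : e / (b ^ 2 + 1) * b ^ 2 <= e := by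
      rw [div_mul_eq_mul_div, div_le_iff₀ (by positivity)]; nlinarith
    nlinarith
  rcases hb.eq_or_lt with rfl | hb'
  · have := key (e / (a ^ 2 + 1)) (by positivity)
    have h5 : e / (a ^ 2 + 1) * a ^ 2 <= e := by
      rw [div_mul_eq_mul_div, div_le_iff₀ (by positivity)]; nlinarith
    nlinarith
  · have := key (b / a) (by positivity)
    have e2 : (b / a * a ^ 2 + (b / a)⁻¹ * b ^ 2) / 2 = a * b := by field_simp; ring
    linarith
lemma good_abs {μ : Measure (ι -> RR)} {Kg : ℕ} {ρ : RR} (hG : Good Kg ρ μ) {f g : MP ι} (hf : f.totalDegree <= Kg) (hg : g.totalDegree <= Kg) :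
    (Integrable (fun x => |eval x f| * |eval x g|) μ ∧ ∫ x, |eval x f| * |eval x g| ∂μ <= 2 * (nr f * nr g)) ∧
    (Integrable (fun x => |eval x f| * |eval x g|) (stdGaussianPi ι) ∧ ∫ x, |eval x f| * |eval x g| ∂(stdGaussianPi ι) <= nr f * nr g) := by
  have h0 := nr_nonneg f
  have h0' := nr_nonneg g
  have h2 : √(2:RR) ^ 2 = 2 := sq_sqrt (by norm_num)
  constructor
  · have := cs_int μ (cont_poly f).aestronglyMeasurable (cont_poly g).aestronglyMeasurable (hG f hf).2.2.1 (hG g hg).2.2.1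
      (a := √2 * nr f) (b := √2 * nr g) (by positivity) (by positivity) (by rw [mul_pow, h2]; exact (hG f hf).2.2.2) (by rw [mul_pow, h2]; exact (hG g hg).2.2.2)
    refine ⟨this.1, this.2.trans (le_of_eq ?_)⟩
    linear_combination (nr f * nr g) * h2
  · exact cs_int _ (cont_poly f).aestronglyMeasurable (cont_poly g).aestronglyMeasurable (good_gauss f).1 (good_gauss g).1
      h0 h0' (good_gauss f).2.le (good_gauss g).2.le
lemma DD_bd {μ : Measure (ι -> RR)} {Kg : ℕ} {ρ : RR} (hG : Good Kg ρ μ) {f g : MP ι} (hf : f.totalDegree <= Kg) (hg : g.totalDegree <= Kg)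
    {F : (ι -> RR) -> ℂ} (hFb : ∀ x, ‖F x‖ <= |eval x f| * |eval x g|) : ‖DD μ F‖ <= 3 * (nr f * nr g) := by
  obtain ⟨⟨h1, h2⟩, ⟨h3, h4⟩⟩ := good_abs hG hf hg
  have a1 := norm_integral_le_of_norm_le h1 (Filter.Eventually.of_forall hFb)
  have a2 := norm_integral_le_of_norm_le h3 (Filter.Eventually.of_forall hFb)
  unfold DD
  exact (norm_sub_le _ _).trans (by linarith)
lemma nr_one : nr (1 : MP ι) = 1 := by
  have := nr_C (ι := ι) 1; rw [C_1] at this; simpa using this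
lemma int_of_good {μ : Measure (ι -> RR)} {Kg : ℕ} {ρ : RR} (hG : Good Kg ρ μ) {F : (ι -> RR) -> ℂ} (hF : Continuous F) (hF1 : ∀ x, ‖F x‖ <= 1)
    {g : MP ι} (hg : g.totalDegree <= Kg) : Integrable (fun x => F x * (eval x g : RR)) μ ∧ Integrable (fun x => F x * (eval x g : RR)) (stdGaussianPi ι) := by
  have hc : Continuous (fun x => F x * ((eval x g : RR) : ℂ)) := hF.mul (continuous_ofReal.comp (cont_poly g))
  have hb : ∀ x, ‖F x * ((eval x g : RR) : ℂ)‖ <= ‖eval x g‖ := fun x => by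
    rw [norm_mul, norm_real]; exact mul_le_of_le_one_left (norm_nonneg _) (hF1 x)
  exact ⟨(hG g hg).1.mono hc.aestronglyMeasurable (Filter.Eventually.of_forall hb), (int_poly g).mono hc.aestronglyMeasurable (Filter.Eventually.of_forall hb)⟩
lemma taylor_bd {μ : Measure (ι -> RR)} {Kg : ℕ} {ρ : RR} (hG : Good Kg ρ μ) {F : (ι -> RR) -> ℂ} (hF : Continuous F)
    (hF1 : ∀ x, ‖F x‖ <= 1) {m K T : ℕ} (hT : 1 <= T) {L q : MP ι} (hL : L.totalDegree <= m) (hq : q.totalDegree <= K) (hK : K + m * T <= Kg)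
    {ε' : RR} (hε : 0 <= ε') (h : ∀ g : MP ι, g.totalDegree <= K + m * T -> ‖DD μ (fun x => F x * (eval x g : RR))‖ <= ε' * nr g)
    (hLT : Ex (L ^ (2 * T)) <= ((T / 6 : RR) ^ T) ^ 2) :
    ‖DD μ (fun x => F x * (eval x q : RR) * ec (Ic * (eval x L : RR)))‖ <=
      (ε' * (T * (Kc (K + m * T) * (1 + (T:RR) ^ T))) + 3 * (1/2) ^ T) * nr q := by
  have hdj : ∀ j ≤ T, (L ^ j).totalDegree <= m * T := fun j hj =>
    (totalDegree_pow _ _).trans (by rw [mul_comm m]; exact Nat.mul_le_mul hj hL)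
  have hd : ∀ j ≤ T, (q * L ^ j).totalDegree <= K + m * T := fun j hj => (totalDegree_mul _ _).trans (Nat.add_le_add hq (hdj j hj))
  have nq := nr_nonneg q
  have hnT : nr (L ^ T) <= (T / 6 : RR) ^ T := by
    refine abs_le_of_sq_le_sq' ?_ (by positivity) |>.2
    rw [nr_sq, <- pow_add, <- two_mul]; exact hLT
  have hnj : ∀ j ≤ T, nr (L ^ j) <= 1 + (T:RR) ^ T := by
    intro j hj
    refine abs_le_of_sq_le_sq' ?_ (by positivity) |>.2
    rw [nr_sq, <- pow_add, <- two_mul]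
    calc Ex (L ^ (2 * j)) <= Ex (1 + L ^ (2 * T)) := by
          refine Ex_mono fun x => ?_
          rw [map_add (eval x), map_pow, map_pow, map_one (eval x), pow_mul, pow_mul]
          rcases le_total (eval x L ^ 2) 1 with h1 | h1
          · have := pow_le_one₀ (n := j) (sq_nonneg (eval x L)) h1
            have := pow_nonneg (sq_nonneg (eval x L)) T
            linarith
          · have := pow_le_pow_right₀ h1 hj
            linarith
      _ <= 1 + ((T / 6 : RR) ^ T) ^ 2 := by rw [map_add, Ex_one]; linarith
      _ <= 1 + ((T:RR) ^ T) ^ 2 := by gcongr; linarith [(Nat.cast_nonneg T : (0:RR) <= T)]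
      _ <= _ := by nlinarith [show 0 <= (T:RR) ^ T by positivity]
  have hnm : ∀ j ≤ T, nr (q * L ^ j) <= Kc (K + m * T) * (1 + (T:RR) ^ T) * nr q := by
    intro j hj
    refine (nr_mul (K := K + m * T) (hq.trans (by omega)) ((hdj j hj).trans (by omega))).trans ?_
    have := Kc_ge (K + m * T)
    calc _ <= Kc (K + m * T) * nr q * (1 + (T:RR) ^ T) := by gcongr; exact hnj j hj
      _ = _ := by ring
  set S : (ι -> RR) -> ℂ := fun x => ∑ j ∈ range T, (Ic ^ j / (j.factorial : ℂ)) * (F x * (eval x (q * L ^ j) : RR)) with hS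
  have hdec : (fun x => F x * (eval x q : RR) * ec (Ic * (eval x L : RR))) = fun x => S x +
      F x * (eval x q : RR) * (ec (Ic * (eval x L : RR)) - ∑ j ∈ range T, (Ic * (eval x L : RR)) ^ j / (j.factorial : ℂ)) := by
    ext x
    rw [mul_sub, mul_sum, add_sub_left_comm, hS, <- sum_sub_distrib, Finset.sum_eq_zero, add_zero]
    intro j _
    rw [map_mul (eval x), map_pow]; push_cast; ring
  have hSI := fun j (hj : j ∈ range T) => int_of_good hG hF hF1 ((hd j (mem_range.1 hj).le).trans hK)
  have hRb : ∀ x, ‖F x * (eval x q : RR) * (ec (Ic * (eval x L : RR)) - ∑ j ∈ range T, (Ic * (eval x L : RR)) ^ j / (j.factorial : ℂ))‖ <=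
      |eval x q| * |eval x (C ((T.factorial : RR)⁻¹) * L ^ T)| := by
    intro x
    rw [norm_mul, norm_mul, norm_real, norm_eq_abs, map_mul (eval x), eval_C, map_pow, abs_mul, abs_pow, abs_of_pos (by positivity : (0:RR) < (T.factorial:RR)⁻¹)]
    refine mul_le_mul (mul_le_of_le_one_left (abs_nonneg _) (hF1 x)) ((exp_tay' T _).trans (le_of_eq ?_)) (norm_nonneg _) (abs_nonneg _)
    rw [div_eq_inv_mul]
  have hdq : q.totalDegree <= Kg := by omega
  have hdL : (C ((T.factorial : RR)⁻¹) * L ^ T).totalDegree <= Kg := (deg_C_mul _ _).trans ((hdj T le_rfl).trans (by omega))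
  have hR := DD_bd hG hdq hdL hRb
  have hRI : ∀ ν : Measure (ι -> RR), Integrable (fun x => |eval x q| * |eval x (C ((T.factorial : RR)⁻¹) * L ^ T)|) ν -> Integrable (fun x => F x * (eval x q : RR) * (ec (Ic * (eval x L : RR)) - ∑ j ∈ range T, (Ic * (eval x L : RR)) ^ j / (j.factorial : ℂ))) ν := by
    intro ν hν
    have c1 := cont_poly q
    have c2 := cont_poly L
    refine hν.mono' (by fun_prop) (Filter.Eventually.of_forall hRb)
  obtain ⟨⟨i1, _⟩, ⟨i2, _⟩⟩ := good_abs hG hdq hdL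
  have hSI1 : Integrable S μ := integrable_finsetSum _ fun j hj => (hSI j hj).1.const_mul _
  have hSI2 : Integrable S (stdGaussianPi ι) := integrable_finsetSum _ fun j hj => (hSI j hj).2.const_mul _
  have hDDS : DD μ S = ∑ j ∈ range T, (Ic ^ j / (j.factorial : ℂ)) * DD μ (fun x => F x * (eval x (q * L ^ j) : RR)) := by
    unfold DD
    rw [hS, integral_finsetSum _ fun j hj => (hSI j hj).1.const_mul _, integral_finsetSum _ fun j hj => (hSI j hj).2.const_mul _, <- sum_sub_distrib]
    refine sum_congr rfl fun j _ => ?_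
    rw [integral_const_mul, integral_const_mul, mul_sub]
  have hSb : ‖DD μ S‖ <= T * (ε' * (Kc (K + m * T) * (1 + (T:RR) ^ T) * nr q)) := by
    rw [hDDS]
    refine (norm_sum_le _ _).trans ((sum_le_card_nsmul _ _ (ε' * (Kc (K + m * T) * (1 + (T:RR) ^ T) * nr q)) fun j hj => ?_).trans (by simp))
    have hj := (mem_range.1 hj).le
    rw [norm_mul, norm_div, norm_pow, Complex.norm_I, one_pow, Complex.norm_natCast]
    have hf1 : (1:RR) / j.factorial <= 1 := by
      rw [div_le_one (by positivity)]; exact_mod_cast Nat.succ_le_of_lt j.factorial_pos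
    calc _ <= 1 * (ε' * nr (q * L ^ j)) := mul_le_mul hf1 (h _ (hd j hj)) (norm_nonneg _) zero_le_one
      _ <= _ := by rw [one_mul]; exact mul_le_mul_of_nonneg_left (hnm j hj) hε
  have hfac : (T.factorial : RR)⁻¹ * (T / 6 : RR) ^ T <= (1/2) ^ T := by
    have h1 := Real.pow_div_factorial_le_exp (T:RR) (Nat.cast_nonneg T) T
    have h2 : er T <= 3 ^ T := by
      rw [<- Real.exp_one_rpow, rpow_natCast]; gcongr; exact Real.exp_one_lt_three.le
    calc _ = ((T:RR) ^ T / T.factorial) * (1/6) ^ T := by rw [div_eq_mul_one_div (T:RR) 6, mul_pow]; ring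
      _ <= 3 ^ T * (1/6) ^ T := by gcongr; exact h1.trans h2
      _ = _ := by rw [<- mul_pow]; norm_num
  have hRn : nr (C ((T.factorial : RR)⁻¹) * L ^ T) <= (1/2) ^ T := by
    rw [nr_C_mul, abs_of_pos (by positivity)]
    exact le_trans (by gcongr) hfac
  have hsplit : DD μ (fun x => F x * (eval x q : RR) * ec (Ic * (eval x L : RR))) = DD μ S + DD μ (fun x => 
      F x * (eval x q : RR) * (ec (Ic * (eval x L : RR)) - ∑ j ∈ range T, (Ic * (eval x L : RR)) ^ j / (j.factorial : ℂ))) := by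
    rw [hdec]; unfold DD
    rw [integral_add hSI1 (hRI _ i1), integral_add hSI2 (hRI _ i2)]; ring
  rw [hsplit]
  refine (norm_add_le _ _).trans ((add_le_add hSb hR).trans ?_)
  have := mul_le_mul_of_nonneg_left hRn nq
  rw [add_mul]
  refine add_le_add (le_of_eq (by ring)) (by linarith)
lemma Lsum_bd {σ : Type} [Fintype σ] (z : σ -> RR) (P : σ -> MP ι) {T : ℕ} {B Λ : RR}
    (hB : 0 <= B) (hP : ∀ i, Ex (P i ^ (2 * T)) <= B) (hz : (∑ i, |z i|) ^ 2 <= Λ) (hT : 1 <= T) : Ex ((∑ i, C (z i) * P i) ^ (2 * T)) <= Λ ^ T * B := by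
  set S := ∑ i, |z i| with hS
  have hS0 : 0 <= S := sum_nonneg fun i _ => abs_nonneg _
  have hΛ : 0 <= Λ := (sq_nonneg _).trans hz
  rcases hS0.eq_or_lt with h | h
  · have : ∀ i, z i = 0 := fun i => abs_eq_zero.1 ((Finset.sum_eq_zero_iff_of_nonneg (fun i _ => abs_nonneg (z i))).1 (hS.symm.trans h.symm) i (mem_univ i))
    simp only [this, C_0, zero_mul, Finset.sum_const_zero]
    rw [zero_pow (by omega), map_zero]; positivity
  calc _ <= Ex (∑ i, C (S ^ (2 * T) * (|z i| / S)) * P i ^ (2 * T)) := by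
        refine Ex_mono fun x => ?_
        have hj := Real.pow_arith_mean_le_arith_mean_pow univ (fun i => |z i| / S) (fun i => |eval x (P i)|) (fun i _ => by positivity)
          (by rw [<- sum_div, <- hS, div_self h.ne']) (fun i _ => abs_nonneg _) (2 * T)
        rw [map_pow, map_sum]
        simp only [map_mul (eval x), map_sum, map_pow (eval x), eval_C]
        have e1 : (∑ i, z i * eval x (P i)) ^ (2 * T) <= (S * ∑ i, |z i| / S * |eval x (P i)|) ^ (2 * T) := by
          rw [<- (even_two_mul T).pow_abs]
          refine pow_le_pow_left₀ (abs_nonneg _) ((abs_sum_le_sum_abs _ _).trans (le_of_eq ?_)) _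
          rw [mul_sum]; refine sum_congr rfl fun i _ => ?_
          rw [abs_mul]; field_simp
        refine e1.trans ?_
        rw [mul_pow]
        refine (mul_le_mul_of_nonneg_left hj (by positivity)).trans (le_of_eq ?_)
        rw [mul_sum]; refine sum_congr rfl fun i _ => ?_
        rw [(even_two_mul T).pow_abs]; ring
    _ <= ∑ i, S ^ (2 * T) * (|z i| / S) * B := by
        rw [map_sum]; refine sum_le_sum fun i _ => ?_
        rw [Ex_C_mul]; exact mul_le_mul_of_nonneg_left (hP i) (by positivity)
    _ = (S ^ 2) ^ T * B := by
        rw [<- sum_mul, <- mul_sum, <- sum_div, <- hS, div_self h.ne', pow_mul]; ring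
    _ <= _ := by gcongr
lemma one_sub_prod {α : Type} (S : Finset α) (f : α -> RR) (hf : ∀ i, 0 <= f i ∧ f i <= 1) {a : RR} (ha : 0 <= a ∧ a <= 1) :
    1 - a * ∏ i ∈ S, f i <= (1 - a) + ∑ i ∈ S, (1 - f i) := by
  classical
  induction S using Finset.induction_on with
  | empty => simp
  | insert i S hi ih =>
    rw [prod_insert hi, sum_insert hi]
    have h0 : 0 <= ∏ i ∈ S, f i := prod_nonneg fun i _ => (hf i).1
    have h1 : ∏ i ∈ S, f i <= 1 := prod_le_one (fun i _ => (hf i).1) fun i _ => (hf i).2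
    have h2 : a * ∏ i ∈ S, f i <= 1 := mul_le_one₀ ha.2 h0 h1
    nlinarith [hf i]
lemma nf_eq (s : RR) (J : ℕ) (c t : RR) : nf s J c t = ec (Ic * ((c * t ^ 2 : RR) : ℂ)) * chi s J t := by
  unfold nf; push_cast; ring_nf
lemma pt_id {σL σH : Type} [Fintype σL] [Fintype σH] {τ : σH -> Type} [∀ i, Fintype (τ i)] (s : RR) (J : ℕ)
    (c a : σL -> RR) (z y y' c0 : σH -> RR) (cc t : ∀ i, τ i -> RR) (hy : ∀ i, y i = y' i + ∑ e, cc i e * t i e ^ 2 + c0 i) (κ q : ℂ) :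
    ((κ * ∏ p : Σ i, τ i, (chi s J (t p.1 p.2) : ℂ)) * ∏ i, nf s J (c i) (a i)) * q * ec (Ic * ∑ i, (z i : ℂ) * y i)
    = (ec (Ic * ((∑ i, z i * c0 i : RR) : ℂ)) * (κ * ∏ i : σL ⊕ (Σ i, τ i),
      nf s J (Sum.elim c (fun p => z p.1 * cc p.1 p.2) i) (Sum.elim a (fun p => t p.1 p.2) i))) * q * ec (Ic * ((∑ i, z i * y' i : RR) : ℂ)) := by
  rw [Fintype.prod_sum_type]
  simp only [Sum.elim_inl, Sum.elim_inr]
  have h1 : ∏ p : Σ i, τ i, nf s J (z p.1 * cc p.1 p.2) (t p.1 p.2) = ec (Ic * ((∑ i, z i * ∑ e, cc i e * t i e ^ 2 : RR) : ℂ)) * ∏ p : Σ i, τ i, (chi s J (t p.1 p.2) : ℂ) := by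
    simp only [nf_eq]
    rw [prod_mul_distrib, <- Complex.exp_sum, <- mul_sum, <- Complex.ofReal_sum]
    congr 4
    rw [Fintype.sum_sigma]
    refine sum_congr rfl fun i _ => ?_
    rw [mul_sum]; exact sum_congr rfl fun e _ => by ring
  have h2 : ec (Ic * ∑ i, (z i : ℂ) * y i) = ec (Ic * ((∑ i, z i * c0 i : RR) : ℂ)) *
      ec (Ic * ((∑ i, z i * ∑ e, cc i e * t i e ^ 2 : RR) : ℂ)) * ec (Ic * ((∑ i, z i * y' i : RR) : ℂ)) := by
    rw [<- exp_add, <- exp_add, <- mul_add, <- mul_add, <- ofReal_add, <- ofReal_add, <- sum_add_distrib, <- sum_add_distrib]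
    congr 2
    push_cast
    refine sum_congr rfl fun i _ => ?_
    rw [hy i]; push_cast; ring
  rw [h1, h2]; ring
lemma chi_bd {μ : Measure (ι -> RR)} [IsProbabilityMeasure μ] {Kg : ℕ} {ρ : RR} (hG : Good Kg ρ μ) {s : RR} (hs : 0 <= s) {J m : ℕ} (hJ : 1 <= J) (hK : J * m <= Kg)
    {q : MP ι} (hq : q.totalDegree <= m) (hn : nr q <= 1) :
    ∫ x, (1 - chi s J (eval x q)) ∂μ <= 2 * (s * ((m+1)^2 * (2*J)^m)) ^ J ∧ ∫ x, (1 - chi s J (eval x q)) ∂(stdGaussianPi ι) <= 2 * (s * ((m+1)^2 * (2*J)^m)) ^ J := by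
  have hh : nr (q ^ J) ^ 2 <= ((m+1)^2 * (2*J)^m) ^ J := by
    rw [nr_sq, <- pow_add, <- two_mul]
    refine (hyper hJ hq).trans (pow_le_pow_left₀ (by rw [<- nr_sq]; positivity) ?_ J)
    rw [<- nr_sq]
    refine mul_le_of_le_one_right (by positivity) (pow_le_one₀ (nr_nonneg _) hn)
  have hd : (q ^ J).totalDegree <= Kg := (totalDegree_pow _ _).trans ((Nat.mul_le_mul_left J hq).trans hK)
  have gen : ∀ ν : Measure (ι -> RR), IsProbabilityMeasure ν -> Integrable (fun x => eval x (q ^ J) ^ 2) ν -> ∫ x, eval x (q ^ J) ^ 2 ∂ν <= 2 * nr (q ^ J) ^ 2 ->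
      ∫ x, (1 - chi s J (eval x q)) ∂ν <= 2 * (s * ((m+1)^2 * (2*J)^m)) ^ J := by
    intro ν _ h1 h2
    calc _ <= ∫ x, s ^ J * eval x (q ^ J) ^ 2 ∂ν := by
          refine integral_mono_of_nonneg (Filter.Eventually.of_forall fun x => ?_) (h1.const_mul _) (Filter.Eventually.of_forall fun x => ?_)
          · have := (chi_mem hs J (eval x q)).2; simp only [Pi.zero_apply]; linarith
          · simp only [map_pow]; exact chi_sub hs J _
      _ <= s ^ J * (2 * nr (q ^ J) ^ 2) := by rw [integral_const_mul]; gcongr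
      _ <= s ^ J * (2 * ((m+1)^2 * (2*J)^m) ^ J) := by gcongr
      _ = _ := by rw [mul_pow s]; ring
  refine ⟨gen μ inferInstance (hG _ hd).2.2.1 (hG _ hd).2.2.2, gen _ inferInstance (good_gauss _).1 ?_⟩
  rw [(good_gauss _).2]; nlinarith [sq_nonneg (nr (q ^ J))]
def CL (μ : Measure (ι -> RR)) (s : RR) (J m : ℕ) (N : ℕ -> ℕ) (G ε δ : RR) (K : ℕ) : Prop :=
  ∀ (σ : Type) [Fintype σ] (r : σ -> ℕ) (Q : σ -> MP ι), (∀ i, r i <= m ∧ (Q i).totalDegree <= r i ∧ nr (Q i) <= 1) ->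
    (∀ j ≤ m, ∑ i, (if r i = j then (1:RR) else 0) <= N j) ->
    ∃ κ : (ι -> RR) -> RR, Continuous κ ∧ (∀ x, 0 <= κ x ∧ κ x <= 1) ∧ ∫ x, (1 - κ x) ∂μ <= δ ∧ ∫ x, (1 - κ x) ∂(stdGaussianPi ι) <= δ ∧
      ∀ c : σ -> RR, ∑ i, c i ^ 2 <= G -> ∀ q : MP ι, q.totalDegree <= K ->
        ‖DD μ (fun x => ((κ x : ℂ) * ∏ i, nf s J (c i) (eval x (Q i))) * (eval x q : RR))‖ <= ε * nr q
lemma zbd {σ : Type} [Fintype σ] {s : RR} (hs : 0 < s) {J : ℕ} (hJ : 1 <= J) (hJs : J * s <= 1) (c z : σ -> RR) {R M G : RR} (hM : (Fintype.card σ : RR) <= M) (hG : ∑ i, c i ^ 2 <= G)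
    (hR : ∑ i, vv s J (c i) * z i ^ 2 <= R) : (∑ i, |z i|) ^ 2 <= R * (4 * (M + G) / s) := by
  have hp : ∀ i, 0 < (J:RR) ^ 2 * s ^ 2 + c i ^ 2 := fun i => by
    have : (0:RR) < J := by exact_mod_cast hJ
    positivity
  have hvp : ∀ i, 0 < vv s J (c i) := fun i => by have := hp i; unfold vv; positivity
  have hR0 : 0 <= R := le_trans (sum_nonneg fun i _ => mul_nonneg (hvp i).le (sq_nonneg _)) hR
  calc (∑ i, |z i|) ^ 2 <= (∑ i, vv s J (c i) * z i ^ 2) * ∑ i, (vv s J (c i))⁻¹ := by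
        refine Finset.sum_sq_le_sum_mul_sum_of_sq_le_mul _ (fun i _ => mul_nonneg (hvp i).le (sq_nonneg _)) (fun i _ => (inv_pos.2 (hvp i)).le) fun i _ => ?_
        rw [sq_abs]; have := (hvp i).ne'; exact le_of_eq (by field_simp)
    _ <= R * (4 * (M + G) / s) := by
        refine mul_le_mul hR ?_ (sum_nonneg fun i _ => (inv_pos.2 (hvp i)).le) hR0
        calc ∑ i, (vv s J (c i))⁻¹ <= ∑ i, (4 / s * (1 + c i ^ 2)) := by
              refine sum_le_sum fun i _ => ?_
              unfold vv
              rw [inv_div, div_mul_eq_mul_div]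
              have : (J:RR) ^ 2 * s ^ 2 <= 1 := by rw [<- mul_pow]; exact pow_le_one₀ (by positivity) hJs
              gcongr
          _ = 4 / s * (Fintype.card σ + ∑ i, c i ^ 2) := by
              rw [<- mul_sum, sum_add_distrib]; simp
          _ <= 4 / s * (M + G) := by gcongr
          _ = _ := by ring
set_option maxHeartbeats 1000000 in
theorem core_step {μ : Measure (ι -> RR)} [IsProbabilityMeasure μ] {Kg : ℕ} {ρ : RR} (hGd : Good Kg ρ μ) {s : RR} (hs : 0 < s) {J : ℕ} (hJ : 1 <= J)
    (hJs : J * s <= 1) {m : ℕ} {KR : RR} (hKR : 1 <= KR) {N N' : ℕ -> ℕ} {G G' ε ε' δ δ' R h W : RR} {K K' T : ℕ} (hT : 1 <= T)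
    (hRL : ∀ Q : MP ι, Q.totalDegree <= m+1 -> nr Q <= 1 -> ∃ (τ : Type) (_ : Fintype τ) (c : τ -> RR) (q : τ -> MP ι) (r : τ -> ℕ) (Q' : MP ι) (c0 : RR),
      Q = Q' + ∑ e, C (c e) * q e ^ 2 + C c0 ∧ (∀ e, r e < m+1 ∧ (q e).totalDegree <= r e ∧ nr (q e) <= 1) ∧ ∑ e, c e ^ 2 <= 7 ∧ Q'.totalDegree <= m+1 ∧
      Ex (Q' ^ (2*T)) <= (KR * T) ^ T ∧ ∀ j, ∑ e, (if r e = j then (1:RR) else 0) <= KR * (T:RR) ^ (2 * lam (m+1) (m+1-j) - 1))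
    (hCL : CL μ s J m N' G' ε' δ' K')
    (hN : ∀ j ≤ m, (N j : RR) + N (m+1) * (KR * (T:RR) ^ (2 * lam (m+1) (m+1-j) - 1)) <= N' j)
    (h0 : 0 <= h) (hχ : ∀ q : MP ι, q.totalDegree <= m -> nr q <= 1 ->
      ∫ x, (1 - chi s J (eval x q)) ∂μ <= h ∧ ∫ x, (1 - chi s J (eval x q)) ∂(stdGaussianPi ι) <= h)
    (hδ : δ' + (∑ j ∈ range (m+1), (N' j : RR)) * h <= δ)
    (hΛ : 36 * KR * (R * (4 * (N (m+1) + G) / s)) <= T) (hG' : G + 7 * (R * (4 * (N (m+1) + G) / s)) <= G')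
    (hK : K + (m+1) * T <= K') (hK' : K' <= Kg) (hW : 2 ^ J * √(2 + 2 * √G / s) <= W) (hW1 : 1 <= W) (hε' : 0 <= ε')
    (hε : (3 * er (-R/2) + 3 * (1/2) ^ T + ε' * (T * (Kc (K + (m+1) * T) * (1 + (T:RR) ^ T)))) * W ^ (N (m+1)) <= ε) :
    CL μ s J (m+1) N G ε δ K := by
  intro σ _ r Q hQ hr
  classical
  set σL := {i // r i < m+1} with hσL
  set σH := {i // ¬ r i < m+1} with hσH
  choose τ fτ cc q rr Q' c0 e1 e2 e3 e4 e5 e6 using fun i : σH => hRL (Q i) ((hQ i).2.1.trans (hQ i).1) (hQ i).2.2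
  have hrH : ∀ i : σH, r i = m+1 := fun i => by have := (hQ i).1; have := i.2; omega
  have hsplit : ∀ f : σ -> RR, (∑ i : σL, f i) + ∑ i : σH, f i = ∑ i, f i := fun f => Fintype.sum_subtype_add_sum_subtype _ f
  have hcardH : (Fintype.card σH : RR) <= N (m+1) := by
    refine le_trans ?_ (hr (m+1) le_rfl)
    rw [<- hsplit, show (∑ i : σH, if r i = m+1 then (1:RR) else 0) = Fintype.card σH by simp [hrH]]
    exact le_add_of_nonneg_left (sum_nonneg fun i _ => by split_ifs <;> norm_num)
  have hcount : ∀ j ≤ m, ∑ i : σL ⊕ (Σ i, τ i), (if Sum.elim (fun i : σL => r i) (fun p => rr p.1 p.2) i = j then (1:RR) else 0) <= N' j := by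
    intro j hj
    rw [Fintype.sum_sum_type, Fintype.sum_sigma]
    simp only [Sum.elim_inl, Sum.elim_inr]
    refine le_trans (add_le_add (b := (N j : RR)) (d := (N (m+1) : RR) * (KR * (T:RR) ^ (2 * lam (m+1) (m+1-j) - 1))) ?_ ?_) (hN j hj)
    · refine le_trans ?_ (hr j (by omega))
      rw [<- hsplit]
      exact le_add_of_nonneg_right (sum_nonneg fun i _ => by split_ifs <;> norm_num)
    · calc _ <= ∑ i : σH, KR * (T:RR) ^ (2 * lam (m+1) (m+1-j) - 1) := sum_le_sum fun i _ => e6 i j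
        _ = Fintype.card σH * (KR * (T:RR) ^ (2 * lam (m+1) (m+1-j) - 1)) := by simp
        _ <= _ := by gcongr
  obtain ⟨κ, k1, k2, k3, k4, k5⟩ := hCL (σL ⊕ (Σ i, τ i)) (Sum.elim (fun i : σL => r i) (fun p => rr p.1 p.2)) (Sum.elim (fun i : σL => Q i) (fun p => q p.1 p.2))
    (by
      rintro (i | p)
      · exact ⟨Nat.lt_succ_iff.1 i.2, (hQ i).2⟩
      · exact ⟨Nat.lt_succ_iff.1 (e2 p.1 p.2).1, (e2 p.1 p.2).2⟩) hcount
  have hcardT : (Fintype.card (Σ i, τ i) : RR) <= ∑ j ∈ range (m+1), (N' j : RR) := by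
    refine le_trans ?_ (sum_le_sum fun j hj => hcount j (Nat.lt_succ_iff.1 (mem_range.1 hj)))
    rw [sum_comm, Fintype.sum_sum_type]
    have hp : ∀ p : (Σ i, τ i), ∑ j ∈ range (m+1), (if rr p.1 p.2 = j then (1:RR) else 0) = 1 := fun p => by
      simp [(e2 p.1 p.2).1]
    have hp2 : (Fintype.card (Σ i, τ i) : RR) = ∑ p : (Σ i, τ i), ∑ j ∈ range (m+1), (if rr p.1 p.2 = j then (1:RR) else 0) := by
      rw [sum_congr rfl fun p _ => hp p, sum_const, Finset.card_univ, nsmul_eq_mul, mul_one]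
    rw [hp2]
    exact le_add_of_nonneg_left (sum_nonneg fun i _ => sum_nonneg fun j _ => by split_ifs <;> norm_num)
  set X : (Σ i, τ i) -> (ι -> RR) -> RR := fun p x => chi s J (eval x (q p.1 p.2)) with hX
  have hXm : ∀ p x, 0 <= X p x ∧ X p x <= 1 := fun p x => chi_mem hs.le J _
  have hXc : ∀ p, Continuous (X p) := fun p => (chi_cont s J).comp (cont_poly _)
  have hκm : ∀ x, 0 <= κ x * ∏ p, X p x ∧ κ x * ∏ p, X p x <= 1 := fun x => by
    have h0 : 0 <= ∏ p, X p x := prod_nonneg fun i _ => (hXm i x).1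
    have h1 : ∏ p, X p x <= 1 := prod_le_one (fun i _ => (hXm i x).1) fun i _ => (hXm i x).2
    exact ⟨mul_nonneg (k2 x).1 h0, mul_le_one₀ (k2 x).2 h0 h1⟩
  have hκc : Continuous fun x => κ x * ∏ p, X p x := k1.mul (continuous_finsetProd _ fun p _ => hXc p)
  have hint : ∀ ν : Measure (ι -> RR), IsProbabilityMeasure ν -> ∀ f : (ι -> RR) -> RR, Continuous f -> (∀ x, 0 <= f x ∧ f x <= 1) -> Integrable (fun x => 1 - f x) ν := by
    intro ν _ f hf hf1
    refine Integrable.mono' (integrable_const (1:RR)) (continuous_const.sub hf).aestronglyMeasurable (Filter.Eventually.of_forall fun x => ?_)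
    rw [norm_of_nonneg (by linarith [hf1 x])]; linarith [hf1 x]
  have hδ2 : ∀ ν : Measure (ι -> RR), IsProbabilityMeasure ν -> ∫ x, (1 - κ x) ∂ν <= δ' -> (∀ p, ∫ x, (1 - X p x) ∂ν <= h) -> ∫ x, (1 - κ x * ∏ p, X p x) ∂ν <= δ := by
    intro ν _ i1 i2
    have I2 := integrable_finsetSum (μ := ν) univ (fun p _ => hint ν inferInstance (X p) (hXc p) (hXm p))
    calc _ <= ∫ x, ((1 - κ x) + ∑ p, (1 - X p x)) ∂ν :=
          integral_mono (hint ν inferInstance _ hκc hκm) ((hint ν inferInstance κ k1 k2).add I2) fun x => one_sub_prod _ _ (fun p => hXm p x) (k2 x)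
      _ = ∫ x, (1 - κ x) ∂ν + ∑ p, ∫ x, (1 - X p x) ∂ν := by
          rw [integral_add (hint ν inferInstance κ k1 k2) I2, integral_finsetSum _ (fun p _ => hint ν inferInstance (X p) (hXc p) (hXm p))]
      _ <= δ' + ∑ p : (Σ i, τ i), h := add_le_add i1 (sum_le_sum fun p _ => i2 p)
      _ = δ' + Fintype.card (Σ i, τ i) * h := by simp
      _ <= _ := by refine le_trans ?_ hδ; gcongr
  have hχ' := fun p : (Σ i, τ i) => hχ (q p.1 p.2) ((e2 p.1 p.2).2.1.trans (Nat.lt_succ_iff.1 (e2 p.1 p.2).1)) (e2 p.1 p.2).2.2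
  refine ⟨fun x => κ x * ∏ p, X p x, hκc, hκm, hδ2 μ inferInstance k3 fun p => (hχ' p).1, hδ2 _ inferInstance k4 fun p => (hχ' p).2, ?_⟩
  intro c hc g hg
  have nq := nr_nonneg g
  have hcH : ∑ i : σH, c i ^ 2 <= G := by
    refine le_trans ?_ hc; rw [<- hsplit]; exact le_add_of_nonneg_left (sum_nonneg fun i _ => sq_nonneg _)
  have hcL : ∑ i : σL, c i ^ 2 <= G := by
    refine le_trans ?_ hc; rw [<- hsplit]; exact le_add_of_nonneg_right (sum_nonneg fun i _ => sq_nonneg _)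
  choose ω w1 w2 w3 w4 using fun i : σH => node hs J (c i)
  set E0 := 3 * er (-R/2) + 3 * (1/2) ^ T + ε' * (T * (Kc (K + (m+1) * T) * (1 + (T:RR) ^ T))) with hE0
  have hKc0 : 0 <= Kc (K + (m+1) * T) := by unfold Kc; positivity
  have hE0p : 0 <= E0 := by positivity
  set F0 : (ι -> RR) -> ℂ := fun x => ((κ x : ℂ) * ∏ p, (X p x : ℂ)) * ∏ i : σL, nf s J (c i) (eval x (Q i)) with hF0
  have hF0c : Continuous F0 := by
    refine ((continuous_ofReal.comp k1).mul (continuous_finsetProd _ fun p _ => continuous_ofReal.comp (hXc p))).mul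
      (continuous_finsetProd _ fun i _ => (nf_cont s J _).comp (cont_poly _))
  have hF01 : ∀ x, ‖F0 x‖ <= 1 := by
    intro x
    rw [hF0]; simp only
    rw [norm_mul, <- Complex.ofReal_prod, <- Complex.ofReal_mul, norm_real, norm_of_nonneg (hκm x).1, norm_prod]
    exact mul_le_one₀ (hκm x).2 (prod_nonneg fun _ _ => norm_nonneg _) (prod_le_one (fun _ _ => norm_nonneg _) fun i _ => nf_norm hs.le _ _ _)
  have hgK : g.totalDegree <= Kg := hg.trans (by nlinarith)
  obtain ⟨I1, I2⟩ := int_of_good hGd hF0c hF01 hgK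
  have hnodeW : ∀ i : σH, ∫ ζ, ‖ω i ζ‖ * er (vv s J (c i) * ζ ^ 2 / 2) <= W := by
    intro i
    refine (w4 i).trans (le_trans ?_ hW)
    have : |c i| <= √G := Real.abs_le_sqrt ((single_le_sum (f := fun i => c i ^ 2) (fun i _ => sq_nonneg _) (mem_univ i.1)).trans hc)
    gcongr
  have hv : ∀ i : σH, 0 <= vv s J (c i) := fun i => by unfold vv; positivity
  have key := superpos_bd μ ω w1 (fun i => vv s J (c i)) hv w3 hnodeW (fun i x => eval x (Q i)) (fun i => (cont_poly _).measurable)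
    (fun x => F0 x * (eval x g : RR)) I1 I2 (E := E0 * nr g) (by positivity) ?_
  · refine le_trans (le_of_eq ?_) (key.trans ?_)
    · congr 2; ext x
      rw [hF0]; simp only [w2]
      rw [<- Fintype.prod_subtype_mul_prod_subtype (fun i => r i < m+1)]
      push_cast; ring
    · calc E0 * nr g * W ^ Fintype.card σH <= E0 * nr g * W ^ (N (m+1)) := by
            refine mul_le_mul_of_nonneg_left (pow_le_pow_right₀ hW1 (by exact_mod_cast hcardH)) (by positivity)
        _ = E0 * W ^ (N (m+1)) * nr g := by ring
        _ <= _ := by gcongr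
  intro z
  rw [<- sum_div]
  rcases le_or_gt (∑ i : σH, vv s J (c i) * z i ^ 2) R with hz | hz
  · have hzb := zbd hs hJ hJs (fun i : σH => c i) z hcardH hcH hz
    have hid : (fun x => F0 x * (eval x g : RR) * ec (Ic * ∑ i : σH, (z i : ℂ) * (eval x (Q i) : RR))) = fun x =>
        (ec (Ic * ((∑ i, z i * c0 i : RR) : ℂ)) * (κ x * ∏ i : σL ⊕ (Σ i, τ i), nf s J (Sum.elim (fun i : σL => c i) (fun p => z p.1 * cc p.1 p.2) i)
          (eval x (Sum.elim (fun i : σL => Q i) (fun p => q p.1 p.2) i)))) * (eval x g : RR) * ec (Ic * (eval x (∑ i, C (z i) * Q' i) : RR)) := by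
      ext x
      have := pt_id s J (fun i : σL => c i) (fun i : σL => eval x (Q i)) z (fun i => eval x (Q i)) (fun i => eval x (Q' i)) c0 cc (fun i e => eval x (q i e))
        (by
          intro i
          conv_lhs => rw [e1 i]
          simp only [map_add (eval x), map_sum, map_mul (eval x), map_pow (eval x), eval_C]) (κ x) (eval x g : RR)
      rw [hF0]; simp only [hX]
      rw [this]
      have h1 : eval x (∑ i, C (z i) * Q' i) = ∑ i, z i * eval x (Q' i) := by simp only [map_sum, map_mul (eval x), eval_C]
      rw [h1]
      have h2 : ∀ i : σL ⊕ (Σ i, τ i), Sum.elim (fun i : σL => eval x (Q i)) (fun p => eval x (q p.1 p.2)) i = eval x (Sum.elim (fun i : σL => Q i) (fun p => q p.1 p.2) i) := by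
        rintro (i | p) <;> rfl
      simp only [h2]
    rw [hid]
    set u := ec (Ic * ((∑ i, z i * c0 i : RR) : ℂ)) with hu
    have hun : ‖u‖ = 1 := by rw [hu, mul_comm, norm_exp_ofReal_mul_I]
    set c' : σL ⊕ (Σ i, τ i) -> RR := Sum.elim (fun i : σL => c i) (fun p => z p.1 * cc p.1 p.2) with hc'
    have hc'G : ∑ i, c' i ^ 2 <= G' := by
      rw [Fintype.sum_sum_type, Fintype.sum_sigma]
      simp only [hc', Sum.elim_inl, Sum.elim_inr]
      refine le_trans (add_le_add hcL ?_) hG'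
      calc ∑ i, ∑ e, (z i * cc i e) ^ 2 <= ∑ i, |z i| ^ 2 * 7 := by
            refine sum_le_sum fun i _ => ?_
            simp only [mul_pow]
            rw [<- mul_sum, sq_abs]; exact mul_le_mul_of_nonneg_left (e3 i) (sq_nonneg _)
        _ <= 7 * (∑ i, |z i|) ^ 2 := by
            rw [<- sum_mul, mul_comm]
            refine mul_le_mul_of_nonneg_left (sum_pow_le _ _ (fun i _ => abs_nonneg _) (by norm_num)) (by norm_num)
        _ <= _ := by linarith
    have hFc : Continuous fun x => u * (κ x * ∏ i : σL ⊕ (Σ i, τ i), nf s J (c' i) (eval x (Sum.elim (fun i : σL => Q i) (fun p => q p.1 p.2) i))) :=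
      continuous_const.mul ((continuous_ofReal.comp k1).mul (continuous_finsetProd _ fun i _ => (nf_cont s J _).comp (cont_poly _)))
    have hF1 : ∀ x, ‖u * (κ x * ∏ i : σL ⊕ (Σ i, τ i), nf s J (c' i) (eval x (Sum.elim (fun i : σL => Q i) (fun p => q p.1 p.2) i)))‖ <= 1 := by
      intro x
      rw [norm_mul, hun, one_mul, norm_mul, norm_real, norm_of_nonneg (k2 x).1, norm_prod]
      exact mul_le_one₀ (k2 x).2 (prod_nonneg fun _ _ => norm_nonneg _) (prod_le_one (fun _ _ => norm_nonneg _) fun i _ => nf_norm hs.le _ _ _)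
    have tb := taylor_bd hGd hFc hF1 (m := m+1) (K := K) hT (L := ∑ i, C (z i) * Q' i) (q := g) (totalDegree_finsetSum_le fun i _ => (deg_C_mul _ _).trans (e4 i)) hg
      (hK.trans hK') hε' (by
        intro f hf
        have := k5 c' hc'G f (hf.trans hK)
        refine le_trans (le_of_eq ?_) this
        unfold DD
        simp only [mul_assoc u]
        rw [integral_const_mul, integral_const_mul, <- mul_sub, norm_mul, hun, one_mul]) (by
        refine (Lsum_bd z Q' (by positivity) e5 hzb hT).trans ?_
        rw [<- mul_pow, <- pow_mul, mul_comm T 2, pow_mul]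
        refine pow_le_pow_left₀ (mul_nonneg ((sq_nonneg _).trans hzb) (by positivity)) ?_ T
        have hT0 : (0:RR) <= T := by positivity
        nlinarith)
    refine tb.trans ?_
    have hone : 1 <= er ((∑ i : σH, vv s J (c i) * z i ^ 2) / 2) := by
      refine one_le_exp (div_nonneg (sum_nonneg fun i _ => mul_nonneg (hv i) (sq_nonneg _)) (by norm_num))
    refine le_trans ?_ (le_mul_of_one_le_right (by positivity) hone)
    refine mul_le_mul_of_nonneg_right ?_ nq
    rw [hE0]; have := exp_pos (-R/2); linarith
  · have h1 : ‖DD μ (fun x => F0 x * (eval x g : RR) * ec (Ic * ∑ i : σH, (z i : ℂ) * (eval x (Q i) : RR)))‖ <= 3 * (nr g * nr (1 : MP ι)) := by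
      refine DD_bd hGd hgK (by rw [totalDegree_one]; omega) fun x => ?_
      have : Ic * ∑ i : σH, (z i : ℂ) * (eval x (Q i) : RR) = ((∑ i : σH, z i * eval x (Q i) : RR) : ℂ) * Ic := by push_cast; ring
      rw [norm_mul, norm_mul, this, norm_exp_ofReal_mul_I, norm_real, map_one (eval x), abs_one]
      simpa using mul_le_of_le_one_left (abs_nonneg _) (hF01 x)
    rw [nr_one, mul_one] at h1
    refine h1.trans ?_
    have h2 : 3 * er (-R/2) <= E0 := by
      rw [hE0]; have : 0 <= 3 * (1/2:RR) ^ T + ε' * (T * (Kc (K + (m+1) * T) * (1 + (T:RR) ^ T))) := by positivity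
      linarith
    have h3 : 1 <= er (-R/2) * er ((∑ i : σH, vv s J (c i) * z i ^ 2) / 2) := by
      rw [<- Real.exp_add]; refine one_le_exp ?_; linarith
    calc 3 * nr g <= 3 * nr g * (er (-R/2) * er ((∑ i : σH, vv s J (c i) * z i ^ 2) / 2)) := le_mul_of_one_le_right (by positivity) h3
      _ = 3 * er (-R/2) * nr g * er ((∑ i : σH, vv s J (c i) * z i ^ 2) / 2) := by ring
      _ <= _ := by gcongr
lemma CL_base {μ : Measure (ι -> RR)} [IsProbabilityMeasure μ] {Kg : ℕ} {ρ : RR} (hGd : Good Kg ρ μ) {s : RR} (hs : 0 < s) (J : ℕ) (N : ℕ -> ℕ) (G : RR) {ε : RR} {K : ℕ}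
    (hK : K <= Kg) (hρ : ρ <= ε) : CL μ s J 0 N G ε 0 K := by
  intro σ _ r Q hQ _
  refine ⟨fun _ => 1, continuous_const, fun x => ⟨zero_le_one, le_rfl⟩, by simp, by simp, fun c _ q hq => ?_⟩
  have h1 : ∀ i x, eval x (Q i) = coeff 0 (Q i) := by
    intro i x
    have h2 := hQ i
    have : Q i = C (coeff 0 (Q i)) := totalDegree_eq_zero_iff_eq_C.1 (by omega)
    conv_lhs => rw [this]
    rw [eval_C]
  simp only [h1, Complex.ofReal_one, one_mul]
  unfold DD
  rw [integral_const_mul, integral_const_mul, <- mul_sub, norm_mul, norm_prod, integral_complex_ofReal, integral_complex_ofReal, <- Complex.ofReal_sub, norm_real, norm_eq_abs]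
  refine (mul_le_of_le_one_left (abs_nonneg _) (prod_le_one (fun _ _ => norm_nonneg _) fun i _ => nf_norm hs.le _ _ _)).trans ?_
  exact ((hGd q (hq.trans hK)).2.1).trans (mul_le_mul_of_nonneg_right hρ (nr_nonneg _))
def aa (d l : ℕ) : ℕ -> ℕ
  | 0 => 1
  | j+1 => 1 + aa d l j + (if d - j = 3 then 5 else 3) * (aa d l j + (if j = 0 then 2*l+1 else aa d l j) + (d+6))
def gg (d l j : ℕ) : ℕ := if j = 0 then 2*l+1 else aa d l j
def tt (d l j : ℕ) : ℕ := aa d l j + gg d l j + (d+6)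
def bb (d l : ℕ) : ℕ -> ℕ
  | 0 => 0
  | j+1 => tt d l j + 1
lemma aa_succ (d l j : ℕ) : aa d l (j+1) = 1 + aa d l j + (if d - j = 3 then 5 else 3) * tt d l j := rfl
lemma aa_pos (d l j : ℕ) : 1 <= aa d l j := by cases j <;> simp [aa]; omega
lemma gg_succ (d l j : ℕ) : gg d l (j+1) = aa d l (j+1) := by simp [gg]
lemma aa_le_gg (d l j : ℕ) : aa d l j <= gg d l j := by
  cases j with
  | zero => simp [aa, gg]
  | succ j => rw [gg_succ]
lemma aa_ge (d l j : ℕ) : 1 + aa d l j + 3 * tt d l j <= aa d l (j+1) := by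
  rw [aa_succ]; split_ifs <;> omega
lemma aa_mono (d l : ℕ) : Monotone (aa d l) := monotone_nat_of_le_succ fun j => by have := aa_ge d l j; omega
lemma aa_seven (d l j : ℕ) : 1 + 7 * aa d l j <= aa d l (j+1) := by
  have h1 := aa_ge d l j
  have h2 := aa_le_gg d l j
  have : tt d l j = aa d l j + gg d l j + (d+6) := rfl
  omega
lemma aa_r (d l j r : ℕ) : 1 + aa d l j + (4*(r+2)+1) * tt d l j <= aa d l (j+(r+2)) := by
  induction r with
  | zero => have := aa_seven d l (j+1); have := aa_ge d l j; simp only [zero_add]; rw [show j+2 = j+1+1 by ring]; omega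
  | succ r ih =>
    have := aa_seven d l (j+(r+2))
    rw [show j + (r+1+2) = j+(r+2)+1 by ring]
    nlinarith
lemma aa_lam (d l j r : ℕ) (hr : 1 <= r) : 1 + aa d l j + (2 * lam (d-j) r - 1) * tt d l j <= aa d l (j+r) := by
  obtain ⟨r, rfl⟩ : ∃ r', r = r'+1 := ⟨r-1, by omega⟩
  cases r with
  | zero => rw [zero_add, aa_succ]; unfold lam; split_ifs <;> simp_all
  | succ r =>
    have := aa_r d l j r
    have e : 2 * lam (d-j) (r+1+1) - 1 = 4*(r+2)+1 := by unfold lam; simp only [Nat.add_eq_right]; rw [if_neg (by omega)]; omega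
    rw [e]; exact this
lemma bb_le (d l j : ℕ) : bb d l j <= aa d l j := by
  cases j with
  | zero => simp [bb]
  | succ j => have := aa_ge d l j; simp only [bb]; have : tt d l j = aa d l j + gg d l j + (d+6) := rfl; omega
lemma tt_growth (d l : ℕ) : ∀ j, tt d l (j+1) + 1 <= (if d - j = 3 then 11 else 7) * (tt d l j + 1) := by
  intro j
  have h1 : tt d l (j+1) = aa d l (j+1) + aa d l (j+1) + (d+6) := by rw [tt, gg_succ]
  have h2 := aa_succ d l j
  have h3 : 2 * aa d l j + (d+6) <= tt d l j := by have := aa_le_gg d l j; unfold tt; omega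
  rw [h1]; split_ifs at h2 ⊢ <;> omega
lemma tt_bd (d l : ℕ) : ∀ j, (3 <= d - j -> tt d l j + 1 <= 7 ^ j * (2*l+d+9)) ∧ 7 * (tt d l j + 1) <= 7 ^ j * (11 * (2*l+d+9)) := by
  intro j
  induction j with
  | zero => simp [tt, aa, gg]; omega
  | succ j ih =>
    have := tt_growth d l j
    rw [pow_succ]
    generalize hX : 7 ^ j * (2*l+d+9) = X at ih
    have e1 : 7 ^ j * 7 * (2*l+d+9) = 7 * X := by rw [<- hX]; ring
    have e2 : 7 ^ j * (11 * (2*l+d+9)) = 11 * X := by rw [<- hX]; ring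
    have e3 : 7 ^ j * 7 * (11 * (2*l+d+9)) = 77 * X := by rw [<- hX]; ring
    rw [e1, e3]; rw [e2] at ih
    split_ifs at this <;> constructor <;> intros <;> omega
lemma eps_num {E T U' c v u : ℕ} {R X : RR} (h1 : 2 * (E:RR) <= R) (h2 : E <= T) (h3 : c + E <= U') (hX : X <= 2 ^ c) (hE : v + u + 3 = E) :
    (3 * er (-R/2) + 3 * (1/2) ^ T + (1/2) ^ U' * X) * 2 ^ v <= (1/2:RR) ^ u := by
  have a1 : er (-R/2) <= (1/2) ^ E := by
    calc er (-R/2) <= er ((E:RR) * (-1)) := exp_le_exp.2 (by linarith)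
      _ = er (-1) ^ E := by rw [exp_nat_mul]
      _ <= _ := by
        refine pow_le_pow_left₀ (exp_pos _).le ?_ _
        rw [Real.exp_neg, one_div]
        exact inv_anti₀ (by norm_num) (by have := add_one_le_exp (1:RR); linarith)
  have a2 : (1/2:RR) ^ T <= (1/2) ^ E := pow_le_pow_of_le_one (by norm_num) (by norm_num) h2
  have a3 : (1/2:RR) ^ U' * X <= (1/2) ^ E := by
    calc (1/2:RR) ^ U' * X <= (1/2) ^ U' * 2 ^ c := by gcongr
      _ <= (1/2) ^ (c+E) * 2 ^ c := mul_le_mul_of_nonneg_right (pow_le_pow_of_le_one (by norm_num) (by norm_num) h3) (by positivity)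
      _ = (1/2) ^ E := by rw [pow_add, mul_right_comm, <- mul_pow]; norm_num
  calc _ <= (7 * (1/2) ^ E) * 2 ^ v := by gcongr; linarith
    _ = 7/8 * (1/2:RR) ^ u * ((1/2) ^ v * 2 ^ v) := by rw [<- hE]; ring
    _ <= _ := by rw [<- mul_pow]; norm_num
lemma Kc_two (n : ℕ) : Kc n <= 2 ^ (4*n) := by
  unfold Kc
  have : (n:RR) + 1 <= 2 ^ n := by exact_mod_cast Nat.lt_two_pow_self
  calc ((n:RR)+1)^2 * 4^n <= (2^n)^2 * 4^n := by gcongr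
    _ = _ := by rw [show (4:RR) = 2^2 by norm_num, <- pow_mul, <- pow_mul, <- pow_add]; congr 1; ring
noncomputable def Dd (d l Y : ℕ) : RR := (d * (d+1) * (Y:RR) ^ (aa d l d)) * (2 * (1/4) ^ Y)
lemma bb_top (d l n : ℕ) (hn : 1 <= n) : bb d l n = tt d l (n-1) + 1 := by
  obtain ⟨m, rfl⟩ : ∃ m, n = m+1 := ⟨n-1, by omega⟩
  rfl
lemma sq_le {x : RR} (h : 1 <= x) : √x <= x := Real.sqrt_le_iff.2 ⟨by linarith, by nlinarith⟩
lemma nat_eps {Y a t b j M d : ℕ} (hba : b <= a) (hat : a + 2 <= t) (hj : j + 1 <= d) (hM : M <= d) (hY : 6*d + 20 + 5 * t <= Y) (hbt : b <= t) :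
    (3 * er (-((Y:RR) ^ (a+2))/2) + 3 * (1/2) ^ (Y^t) + (1/2) ^ (Y^(t+2)) * ((Y^t : ℕ) * (Kc (Y^b + M * Y^t) * (1 + ((Y^t : ℕ):RR) ^ (Y^t))))) * ((8:RR)^Y) ^ ((j+1) * Y^a) <= (1/2:RR) ^ (Y^(b+1)) := by
  have hY1 : 1 <= Y := by omega
  have e8 : ((8:RR)^Y) ^ ((j+1) * Y^a) = 2 ^ (3 * (Y * ((j+1) * Y^a))) := by
    rw [show (8:RR) = 2^3 by norm_num, <- pow_mul, <- pow_mul]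
  rw [e8]
  have p1 : Y^(b+1) <= Y^(a+1) := Nat.pow_le_pow_right hY1 (by omega)
  have p2 : Y * ((j+1) * Y^a) <= d * Y^(a+1) := by rw [pow_succ]; nlinarith [Nat.mul_le_mul_right (Y^a*Y) hj]
  have p3 : 1 <= Y^(a+1) := Nat.one_le_pow _ _ hY1
  have hE : 3 * (Y * ((j+1) * Y^a)) + Y^(b+1) + 3 <= (3*d+4) * Y^(a+1) := by nlinarith
  have p4 : (6*d+8) * Y^(a+1) <= Y^(a+2) := by rw [pow_succ Y (a+1), mul_comm]; exact Nat.mul_le_mul_left _ (by omega)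
  have p5 : Y^(a+2) <= Y^t := Nat.pow_le_pow_right hY1 hat
  refine eps_num (c := Y^t + 4 * (Y^b + M*Y^t) + (1 + Y * t * Y^t)) (E := 3 * (Y * ((j+1) * Y^a)) + Y^(b+1) + 3) ?_ (by nlinarith) ?_ ?_ rfl
  · have : 2 * (3 * (Y * ((j+1) * Y^a)) + Y^(b+1) + 3) <= Y^(a+2) := by nlinarith
    exact_mod_cast this
  · have q1 : Y^b <= Y^t := Nat.pow_le_pow_right hY1 hbt
    have q2 : M * Y^t <= d * Y^t := Nat.mul_le_mul_right _ hM
    have q3 : 1 <= Y^t := Nat.one_le_pow _ _ hY1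
    have q4 : 3 * (Y * ((j+1) * Y^a)) + Y^(b+1) + 3 <= Y^t := by nlinarith
    calc _ <= (7 + 4*d + t * Y) * Y^t := by nlinarith
      _ <= (Y * Y) * Y^t := Nat.mul_le_mul_right _ (by nlinarith)
      _ = _ := by ring
  · have r1 : ((Y^t : ℕ):RR) <= 2 ^ (Y^t) := by exact_mod_cast Nat.lt_two_pow_self.le
    have r2 : 1 + ((Y^t : ℕ):RR) ^ (Y^t) <= 2 ^ (1 + Y * t * Y^t) := by
      have : ((Y^t : ℕ):RR) ^ (Y^t) <= 2 ^ (Y * t * Y^t) := by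
        rw [pow_mul 2 (Y*t), pow_mul 2 Y]; push_cast
        have : (Y:RR) <= 2 ^ Y := by exact_mod_cast Nat.lt_two_pow_self.le
        gcongr
      have h1 : (1:RR) <= 2 ^ (Y * t * Y^t) := one_le_pow₀ (by norm_num)
      rw [pow_add]; linarith
    rw [pow_add, pow_add, mul_assoc]
    refine mul_le_mul r1 (mul_le_mul (Kc_two _) r2 (by positivity) (by positivity)) (by unfold Kc; positivity) (by positivity)
lemma ym_le {d l Y m : ℕ} (hYn : 1 <= Y) (hm : m <= Y) (hd : 1 <= d) (h2 : 2 <= Y) : Y * m <= Y ^ bb d l d := by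
  calc Y * m <= Y * Y := Nat.mul_le_mul_left _ hm
    _ = Y^2 := by ring
    _ <= _ := Nat.pow_le_pow_right hYn (by rw [bb_top d l d hd]; unfold tt; omega)
lemma chi_q {μ : Measure (ι -> RR)} [IsProbabilityMeasure μ] {Kg Y d m : ℕ} {ρ : RR} (hG : Good Kg ρ μ) (hYn : 1 <= Y) (hYd : 4^(d+2) * (d+1)^2 <= Y) (hm : m <= d) (hK : Y * m <= Kg)
    {q : MP ι} (hq : q.totalDegree <= m) (hn : nr q <= 1) :
    ∫ x, (1 - chi (1/(Y:RR)^(d+2)) Y (eval x q)) ∂μ <= 2 * (1/4)^Y ∧ ∫ x, (1 - chi (1/(Y:RR)^(d+2)) Y (eval x q)) ∂(stdGaussianPi ι) <= 2 * (1/4)^Y := by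
  have hYr : (1:RR) <= Y := by exact_mod_cast hYn
  have hY0 : (0:RR) < Y := by linarith
  have hx := chi_bd hG (s := 1/(Y:RR)^(d+2)) (by positivity) hYn hK hq hn
  have h6 : 2 * (1/(Y:RR)^(d+2) * (((m:RR)+1)^2 * (2*(Y:RR))^m)) ^ Y <= 2 * (1/4)^Y := by
    gcongr
    rw [div_mul_eq_mul_div, one_mul, div_le_iff₀ (by positivity), mul_pow]
    have : (m:RR) <= d := by exact_mod_cast hm
    have h7 : 4^(d+2) * ((d:RR)+1)^2 <= Y := by exact_mod_cast hYd
    have h8 : (2:RR)^m <= 4^d := (pow_le_pow_right₀ (by norm_num) hm).trans (by gcongr; norm_num)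
    calc ((m:RR)+1)^2 * (2^m * (Y:RR)^m) <= ((d:RR)+1)^2 * (4^d * (Y:RR)^m) := by gcongr
      _ = 1/16 * (4^(d+2) * ((d:RR)+1)^2) * (Y:RR)^m := by ring
      _ <= 1/16 * Y * (Y:RR)^m := by gcongr
      _ <= 1/4 * (Y:RR)^(m+1) := by rw [pow_succ]; nlinarith [pow_pos hY0 m]
      _ <= _ := mul_le_mul_of_nonneg_left (pow_le_pow_right₀ hYr (by omega)) (by norm_num)
  exact ⟨hx.1.trans h6, hx.2.trans h6⟩
set_option maxHeartbeats 1000000 in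
theorem ladder (d l : ℕ) (hd : 1 <= d) : ∃ Y0 : ℕ, ∀ Y ≥ Y0, ∀ (ι : Type) [Fintype ι] (μ : Measure (ι -> RR)) [IsProbabilityMeasure μ] (Kg : ℕ) (ρ : RR),
    Good Kg ρ μ -> Y ^ (bb d l d) <= Kg -> ρ <= (1/2) ^ (Y ^ (bb d l d + 1)) -> ∀ m ≤ d,
    CL μ (1/(Y:RR)^(d+2)) Y m (fun i => (d-m+1) * Y ^ (aa d l (d-i))) ((Y:RR) ^ (gg d l (d-m))) ((1/2) ^ (Y ^ (bb d l (d-m) + 1))) (m * Dd d l Y) (Y ^ (bb d l (d-m))) := by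
  choose KR hKR1 hKR using fun m : ℕ => RL (m+1) (by omega)
  obtain ⟨B, hB⟩ : ∃ B : ℕ, ∀ m ≤ d, KR m <= B := by
    refine ⟨⌈∑ m ∈ range (d+1), KR m⌉₊, fun m hm => le_trans ?_ (Nat.le_ceil _)⟩
    exact single_le_sum (f := KR) (fun i _ => by linarith [hKR1 i]) (mem_range.2 (by omega))
  have hev : ∀ᶠ Y : ℕ in Filter.atTop, 4 * (Y:RR) ^ (gg d l d + gg d l 0 + d + 2) <= 4 ^ Y := by
    have h1 := (tendsto_pow_const_div_const_pow_of_one_lt (gg d l d + gg d l 0 + d + 2) (r := (4:RR)) (by norm_num)).eventually (gt_mem_nhds (show (0:RR) < 1/4 by norm_num))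
    filter_upwards [h1] with Y h
    rw [div_lt_iff₀ (by positivity)] at h; linarith
  obtain ⟨Y1, hY1⟩ := Filter.eventually_atTop.1 hev
  refine ⟨Y1 + 144 * (B+1) * (d+2) + 4^(d+2) * (d+1)^2 + 6*d + 20 + 5 * tt d l d + 5 * tt d l 0, fun Y hY ι _ μ _ Kg ρ hG hKg hρ m => ?_⟩
  have hW := hY1 Y (by omega)
  have hYB : 144 * (B+1) * (d+2) <= Y := by omega
  have hYd : 4^(d+2) * (d+1)^2 <= Y := by omega
  have hYt : ∀ j ≤ d, 6*d + 20 + 5 * tt d l j <= Y := fun j hj => by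
    have : tt d l j <= tt d l d + tt d l 0 := by
      rcases Nat.eq_zero_or_pos j with rfl | h
      · omega
      · have h1 := aa_mono d l hj; unfold tt gg; rw [if_neg (by omega), if_neg (by omega)]; omega
    omega
  have hgg : ∀ j ≤ d, gg d l j <= gg d l d + gg d l 0 := fun j hj => by
    rcases Nat.eq_zero_or_pos j with rfl | h
    · omega
    · have h1 := aa_mono d l hj; unfold gg; rw [if_neg (by omega), if_neg (by omega)]; omega
  clear hY hY1 hev
  have hYn : 1 <= Y := by have := hYt 0 (by omega); omega
  have hYr : (1:RR) <= Y := by exact_mod_cast hYn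
  have hY0 : (0:RR) < Y := by linarith
  have hs : (0:RR) < 1/(Y:RR)^(d+2) := by positivity
  induction m with
  | zero =>
    intro _
    simp only [Nat.cast_zero, zero_mul, Nat.sub_zero]
    exact CL_base hG hs _ _ _ hKg hρ
  | succ m ih =>
    intro hm
    have ih' := ih (by omega)
    obtain ⟨j, hj⟩ : ∃ j, d - (m+1) = j := ⟨_, rfl⟩
    have hj' : d - m = j + 1 := by omega
    have hjd : d - j = m + 1 := by omega
    rw [hj'] at ih'
    rw [hj]
    have aag := aa_le_gg d l j
    have htt : tt d l j = aa d l j + gg d l j + (d+6) := rfl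
    have hage := aa_ge d l j
    have hap := aa_pos d l j
    have ht := hYt j (by omega)
    have hbb : bb d l (j+1) = tt d l j + 1 := rfl
    have hbl := bb_le d l j
    have hmono : ∀ {a b : ℕ}, a <= b -> (Y:RR)^a <= (Y:RR)^b := fun h => pow_le_pow_right₀ hYr h
    have hKB := hB m (by omega)
    have hK1 := hKR1 m
    have hL : 36 * KR m * ((Y:RR) ^ (aa d l j + 2) * (4 * ((((j+1) * Y ^ (aa d l (d-(m+1))) : ℕ):RR) + (Y:RR) ^ (gg d l j)) / (1/(Y:RR)^(d+2)))) <= ((Y ^ tt d l j : ℕ) : RR) := by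
      rw [hj]
      push_cast
      have h1 := hmono aag
      have h2 : ((j:RR)+1) * (Y:RR) ^ aa d l j + (Y:RR) ^ gg d l j <= (d+2) * (Y:RR) ^ gg d l j := by
        have : (j:RR) + 1 <= d := by exact_mod_cast (by omega : j+1 <= d)
        have h3 : 0 < (Y:RR)^ gg d l j := by positivity
        nlinarith
      have h4 : 144 * (B:RR) * (d+2) <= Y := by
        have : 144 * B * (d+2) <= Y := by nlinarith
        exact_mod_cast this
      calc _ = 144 * KR m * (((j:RR)+1) * (Y:RR) ^ aa d l j + (Y:RR) ^ gg d l j) * (Y:RR)^(aa d l j + 2) * (Y:RR)^(d+2) := by field_simp; ring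
        _ <= 144 * B * ((d+2) * (Y:RR) ^ gg d l j) * (Y:RR)^(aa d l j + 2) * (Y:RR)^(d+2) := by gcongr
        _ = 144 * B * (d+2) * ((Y:RR) ^ gg d l j * (Y:RR)^(aa d l j + 2) * (Y:RR)^(d+2)) := by ring
        _ <= Y * ((Y:RR) ^ gg d l j * (Y:RR)^(aa d l j + 2) * (Y:RR)^(d+2)) := by gcongr
        _ = (Y:RR)^(1 + gg d l j + (aa d l j + 2) + (d+2)) := by ring
        _ <= _ := hmono (by omega)
    have hL0 : 0 <= ((Y:RR) ^ (aa d l j + 2) * (4 * ((((j+1) * Y ^ (aa d l (d-(m+1))) : ℕ):RR) + (Y:RR) ^ (gg d l j)) / (1/(Y:RR)^(d+2)))) := by positivity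
    refine core_step (R := (Y:RR)^(aa d l j + 2)) (T := Y ^ tt d l j) (KR := KR m) (h := 2 * (1/4)^Y) (W := 8^Y) hG hs hYn ?_ hK1 (Nat.one_le_pow _ _ hYn) ?_ ih' ?_ (by positivity) ?_ ?_ ?_ ?_ ?_ ?_ ?_ (one_le_pow₀ (by norm_num)) (by positivity) ?_
    · rw [mul_one_div, div_le_one (by positivity)]; exact le_self_pow₀ hYr (by omega)
    · exact fun Q h1 h2 => hKR m ι _ (Nat.one_le_pow _ _ hYn) Q h1 h2
    · intro i hi
      have h1 := aa_lam d l j (m+1-i) (by omega)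
      rw [hjd, show j + (m+1-i) = d - i by omega] at h1
      rw [hj]
      push_cast
      have h4 : ((j:RR)+1) * KR m <= Y := by
        have : ((j:RR)+1) * KR m <= (d:RR) * B := by
          have : (j:RR) + 1 <= d := by exact_mod_cast (by omega : j+1 <= d)
          gcongr
        refine this.trans ?_
        have : d * B <= Y := by nlinarith
        exact_mod_cast this
      have h5 : ((j:RR)+1) * (Y:RR)^aa d l j * (KR m * ((Y:RR)^tt d l j)^(2 * lam (m+1) (m+1-i) - 1)) <= (Y:RR)^aa d l (d-i) := by
        calc _ = ((j:RR)+1) * KR m * ((Y:RR)^aa d l j * ((Y:RR)^tt d l j)^(2 * lam (m+1) (m+1-i) - 1)) := by ring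
          _ <= Y * ((Y:RR)^aa d l j * ((Y:RR)^tt d l j)^(2 * lam (m+1) (m+1-i) - 1)) := by gcongr
          _ = (Y:RR)^(1 + aa d l j + (2 * lam (m+1) (m+1-i) - 1) * tt d l j) := by rw [<- pow_mul]; ring
          _ <= _ := hmono h1
      linarith
    · intro q hq hn
      exact chi_q hG hYn hYd (by omega) (le_trans (ym_le hYn (by omega) hd (by omega)) hKg) hq hn
    · rw [Nat.cast_succ, add_mul, one_mul]
      refine add_le_add le_rfl ?_
      unfold Dd
      refine mul_le_mul_of_nonneg_right ?_ (by positivity)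
      calc _ <= ∑ i ∈ range (m+1), ((d:RR)+1) * (Y:RR)^aa d l d := by
            refine sum_le_sum fun i _ => ?_
            push_cast [hj']
            have : (j:RR)+1 <= d := by exact_mod_cast (by omega : j+1 <= d)
            have h1 : (Y:RR)^aa d l (d-i) <= (Y:RR)^aa d l d := hmono (aa_mono d l (by omega))
            gcongr
        _ = ((m:RR)+1) * (((d:RR)+1) * (Y:RR)^aa d l d) := by simp
        _ <= _ := by
            have : (m:RR)+1 <= d := by exact_mod_cast hm
            rw [mul_assoc (d:RR)]; gcongr
    · exact hL
    · have h1 : 7 * ((Y:RR) ^ (aa d l j + 2) * (4 * ((((j+1) * Y ^ (aa d l (d-(m+1))) : ℕ):RR) + (Y:RR) ^ (gg d l j)) / (1/(Y:RR)^(d+2)))) <= (Y:RR)^tt d l j / 2 := by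
        push_cast at hL hL0 ⊢
        nlinarith
      have h2 : (Y:RR)^gg d l j <= (Y:RR)^tt d l j / 2 := by
        have : (Y:RR)^(gg d l j + 1) <= (Y:RR)^tt d l j := hmono (by omega)
        rw [pow_succ] at this
        have h2 : (2:RR) <= Y := by exact_mod_cast (by omega : 2 <= Y)
        nlinarith [pow_pos hY0 (gg d l j)]
      have h3 : (Y:RR)^tt d l j <= (Y:RR)^gg d l (j+1) := hmono (by rw [gg_succ]; omega)
      linarith
    · rw [hbb, pow_succ]
      have h1 : Y^bb d l j <= Y^tt d l j := Nat.pow_le_pow_right hYn (by omega)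
      calc _ <= (1 + d) * Y^tt d l j := by nlinarith [Nat.mul_le_mul_right (Y^tt d l j) hm]
        _ <= Y * Y^tt d l j := Nat.mul_le_mul_right _ (by omega)
        _ = _ := by ring
    · refine le_trans (Nat.pow_le_pow_right hYn ?_) hKg
      have hbm : Monotone (bb d l) := monotone_nat_of_le_succ fun i => by
        have := bb_le d l i; have := aa_le_gg d l i; show _ <= tt d l i + 1; unfold tt; omega
      exact hbm (by omega)
    · have h1 : √(2 + 2 * √((Y:RR)^gg d l j) / (1/(Y:RR)^(d+2))) <= 4^Y := by
        refine le_trans ?_ hW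
        have ha : (1:RR) <= (Y:RR)^gg d l j := one_le_pow₀ hYr
        have hb : √((Y:RR)^gg d l j) <= (Y:RR)^gg d l j := sq_le ha
        have hc : (1:RR) <= (Y:RR)^(d+2) := one_le_pow₀ hYr
        rw [div_div_eq_mul_div, div_one]
        have hd1 : 2 + 2 * √((Y:RR)^gg d l j) * (Y:RR)^(d+2) <= 4 * (Y:RR)^(gg d l d + gg d l 0 + d + 2) := by
          have h1 : (1:RR) <= (Y:RR)^(gg d l d + gg d l 0 + d + 2) := one_le_pow₀ hYr
          have h2 : √((Y:RR)^gg d l j) * (Y:RR)^(d+2) <= (Y:RR)^(gg d l d + gg d l 0 + d + 2) := by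
            calc _ <= (Y:RR)^gg d l j * (Y:RR)^(d+2) := by gcongr
              _ = (Y:RR)^(gg d l j + (d+2)) := (pow_add _ _ _).symm
              _ <= _ := hmono (by have := hgg j (by omega); omega)
          linarith
        refine (sqrt_le_sqrt hd1).trans (sq_le ?_)
        have h1 : (1:RR) <= (Y:RR)^(gg d l d + gg d l 0 + d + 2) := one_le_pow₀ hYr
        linarith
      calc _ <= (2:RR)^Y * 4^Y := by gcongr
        _ = _ := by rw [<- mul_pow]; norm_num
    · have := nat_eps (Y := Y) (a := aa d l j) (t := tt d l j) (b := bb d l j) (j := j) (M := m+1) (d := d) hbl (by omega) (by omega) hm ht (by omega)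
      rw [hj]; exact this
lemma int_bdd (μ : Measure (ι -> RR)) [IsProbabilityMeasure μ] {f : (ι -> RR) -> RR} (hf : Continuous f) (h : ∀ x, 0 <= f x ∧ f x <= 1) : Integrable f μ :=
  Integrable.of_bound hf.aestronglyMeasurable 1 (Filter.Eventually.of_forall fun x => by rw [norm_eq_abs, abs_of_nonneg (h x).1]; exact (h x).2)
theorem main_char (d l : ℕ) (hd : 1 <= d) : ∃ Y0 : ℕ, ∀ Y ≥ Y0, ∀ (ι : Type) [Fintype ι] (μ : Measure (ι -> RR)) [IsProbabilityMeasure μ] (Kg : ℕ) (ρ : RR),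
    Good Kg ρ μ -> Y ^ (bb d l d) <= Kg -> ρ <= (1/2) ^ (Y ^ (bb d l d + 1)) -> ∀ p : MP ι, p.totalDegree <= d -> nr p <= 1 ->
    ∃ κ : (ι -> RR) -> RR, Continuous κ ∧ (∀ x, 0 <= κ x ∧ κ x <= 1) ∧ ∫ x, (1 - κ x) ∂μ <= (1/2)^Y ∧
      ∀ u : RR, |u| <= (Y:RR)^l -> ‖DD μ (fun x => (κ x : ℂ) * ec (Ic * ((u * eval x p : RR) : ℂ)))‖ <= (1/2)^Y := by
  obtain ⟨Y1, hY1⟩ := ladder d l hd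
  have hev : ∀ᶠ Y : ℕ in Filter.atTop, 4 + 2 * d * d * (d+1) * (Y:RR) ^ (aa d l d) <= 2 ^ Y := by
    have h1 := (tendsto_pow_const_div_const_pow_of_one_lt (aa d l d + 1) (r := (2:RR)) (by norm_num)).eventually (gt_mem_nhds (show (0:RR) < 1 by norm_num))
    filter_upwards [h1, Filter.eventually_ge_atTop (4 + 2 * d * d * (d+1))] with Y h h2
    rw [div_lt_iff₀ (by positivity), pow_succ] at h
    have h3 : (4:RR) + 2 * d * d * (d+1) <= Y := by exact_mod_cast h2
    have h5 : (1:RR) <= Y := le_trans (by have : (0:RR) <= 2 * d * d * (d+1) := by positivity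
                                          linarith) h3
    have h4 : (1:RR) <= (Y:RR) ^ (aa d l d) := one_le_pow₀ h5
    nlinarith
  obtain ⟨Y2, hY2⟩ := Filter.eventually_atTop.1 hev
  refine ⟨Y1 + Y2 + 4^(d+2) * (d+1)^2 + d + 2, fun Y hY ι _ μ _ Kg ρ hG hKg hρ p hp hn => ?_⟩
  have hL := hY1 Y (by omega) ι μ Kg ρ hG hKg hρ d le_rfl
  have hW := hY2 Y (by omega)
  have hYn : 1 <= Y := by omega
  have hYr : (1:RR) <= Y := by exact_mod_cast hYn
  obtain ⟨⟨a1, a2⟩, ⟨b1, b2⟩⟩ := half_node (r := d) hp (B := 1) (by simp) hn nr_one.le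
  have hid := half_id p 1
  rw [mul_one] at hid
  generalize C (1/2) * (p + 1) = q1 at *
  generalize C (1/2) * (p - 1) = q2 at *
  have hs : (0:RR) <= 1/(Y:RR)^(d+2) := by positivity
  have hc1 := chi_q hG hYn (by omega : 4^(d+2) * (d+1)^2 <= Y) le_rfl ((ym_le (l := l) hYn (by omega) hd (by omega)).trans hKg) a1 a2
  have hc2 := chi_q hG hYn (by omega : 4^(d+2) * (d+1)^2 <= Y) le_rfl ((ym_le (l := l) hYn (by omega) hd (by omega)).trans hKg) b1 b2
  generalize hse : 1/(Y:RR)^(d+2) = s at *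
  obtain ⟨κ, k1, k2, k3, -, k5⟩ := hL Bool (fun _ => d) (fun b => if b then q1 else q2) (by
    intro b; cases b <;> simp [*]) (by
    intro j hj
    have h2 : (2:RR) <= Y := by exact_mod_cast (by omega : 2 <= Y)
    have h3 := pow_le_pow_right₀ hYr (aa_pos d l (d-j))
    rw [pow_one] at h3
    simp only [Fintype.sum_bool, Nat.sub_self, zero_add, one_mul]
    push_cast
    split_ifs <;> linarith)
  have hχc : ∀ q : MP ι, Continuous fun x => chi s Y (eval x q) := fun q => (chi_cont s Y).comp (cont_poly q)
  have hχm : ∀ (q : MP ι) x, 0 <= chi s Y (eval x q) ∧ chi s Y (eval x q) <= 1 := fun q x => chi_mem hs _ _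
  refine ⟨fun x => κ x * (chi s Y (eval x q1) * chi s Y (eval x q2)), k1.mul ((hχc q1).mul (hχc q2)), fun x => ?_, ?_, fun u hu => ?_⟩
  · obtain ⟨e1, e2⟩ := k2 x; obtain ⟨e3, e4⟩ := hχm q1 x; obtain ⟨e5, e6⟩ := hχm q2 x
    exact ⟨by positivity, mul_le_one₀ e2 (by positivity) (mul_le_one₀ e4 e5 e6)⟩
  · have i1 : ∀ f : (ι -> RR) -> RR, Continuous f -> (∀ x, 0 <= f x ∧ f x <= 1) -> Integrable (fun x => 1 - f x) μ := fun f hf h => (integrable_const _).sub (int_bdd μ hf h)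
    have i2 := i1 _ k1 k2
    have i3 := i1 _ (hχc q1) (hχm q1)
    have i4 := i1 _ (hχc q2) (hχm q2)
    have : ∫ x, (1 - κ x * (chi s Y (eval x q1) * chi s Y (eval x q2))) ∂μ <= ∫ x, ((1 - κ x) + ((1 - chi s Y (eval x q1)) + (1 - chi s Y (eval x q2)))) ∂μ := by
      refine integral_mono ?_ (i2.add (i3.add i4)) fun x => ?_
      · refine i1 _ (k1.mul ((hχc q1).mul (hχc q2))) fun x => ?_
        obtain ⟨e1, e2⟩ := k2 x; obtain ⟨e3, e4⟩ := hχm q1 x; obtain ⟨e5, e6⟩ := hχm q2 x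
        exact ⟨by positivity, mul_le_one₀ e2 (by positivity) (mul_le_one₀ e4 e5 e6)⟩
      · obtain ⟨e1, e2⟩ := k2 x; obtain ⟨e3, e4⟩ := hχm q1 x; obtain ⟨e5, e6⟩ := hχm q2 x
        show 1 - _ * (_ * _) <= _
        generalize chi s Y (eval x q1) = a at *
        generalize chi s Y (eval x q2) = b at *
        have f1 : (1-a)*(1-b) ≥ 0 := mul_nonneg (by linarith) (by linarith)
        have f2 : (1-κ x)*(1-a*b) ≥ 0 := mul_nonneg (by linarith) (by nlinarith)
        nlinarith
    rw [integral_add (g := fun x => (1 - chi s Y (eval x q1)) + (1 - chi s Y (eval x q2))) i2 (i3.add i4), integral_add i3 i4] at this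
    refine this.trans ((add_le_add k3 (add_le_add hc1.1 hc2.1)).trans ?_)
    unfold Dd
    calc _ = (4 + 2 * d * d * (d+1) * (Y:RR) ^ (aa d l d)) * (1/4)^Y := by ring
      _ <= 2^Y * (1/4)^Y := by gcongr
      _ = _ := by rw [<- mul_pow]; norm_num
  · have h := k5 (fun b => if b then u else -u) (by
      simp only [Fintype.sum_bool, Nat.sub_self]
      have h0 : gg d l 0 = 2*l+1 := rfl
      have h2 : (2:RR) <= Y := by exact_mod_cast (by omega : 2 <= Y)
      have h3 : u^2 <= ((Y:RR)^l)^2 := by rw [<- sq_abs]; gcongr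
      rw [h0, pow_succ (Y:RR), pow_mul']
      simp only [if_true, Bool.false_eq_true, if_false]
      nlinarith [sq_nonneg u]) 1 (by simp)
    rw [nr_one, mul_one, Nat.sub_self] at h
    have h0 : bb d l 0 = 0 := rfl
    rw [h0, zero_add, pow_one] at h
    convert h using 3
    funext x
    simp only [Fintype.prod_bool, if_true, Bool.false_eq_true, if_false, nf_eq, map_one, Complex.ofReal_one, mul_one]
    have : u * eval x p = u * eval x q1 ^ 2 + -u * eval x q2 ^ 2 := by
      rw [hid, map_sub (eval x), map_pow (eval x), map_pow (eval x)]; ring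
    rw [this, ofReal_add, mul_add, exp_add]
    push_cast; ring
lemma gam_map : stdGaussianPi ι = (stdGaussian (EuclideanSpace RR ι)).map (EuclideanSpace.equiv ι RR : EuclideanSpace RR ι →L[RR] (ι -> RR)) := by
  rw [<- map_pi_eq_stdGaussian, Measure.map_map (by fun_prop) (by fun_prop)]
  exact Measure.map_id.symm
lemma gam_rot {c s : RR} (h : c ^ 2 + s ^ 2 = 1) :
    ((stdGaussianPi ι).prod (stdGaussianPi ι)).map (fun z => c • z.1 + s • z.2) = stdGaussianPi ι := by
  have hG : IsGaussian (stdGaussianPi ι) := by rw [gam_map]; infer_instance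
  obtain ⟨θ, h1, h2⟩ : ∃ θ, Real.cos θ = c ∧ Real.sin θ = s := by
    refine ⟨Complex.arg ⟨c, s⟩, ?_, ?_⟩
    · have hn : ‖(⟨c, s⟩ : ℂ)‖ = 1 := by rw [Complex.norm_def, Complex.normSq_mk, <- sq, <- sq, h, sqrt_one]
      rw [Complex.cos_arg (by intro h0; rw [h0] at hn; simp at hn), hn, div_one]
    · have hn : ‖(⟨c, s⟩ : ℂ)‖ = 1 := by rw [Complex.norm_def, Complex.normSq_mk, <- sq, <- sq, h, sqrt_one]
      rw [Complex.sin_arg, hn, div_one]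
  have := IsGaussian.map_rotation_eq_self_of_forall_strongDual_eq_zero (μ := stdGaussianPi ι) (fun L => by
    rw [gam_map, integral_map (by fun_prop) (by fun_prop)]
    exact integral_strongDual_stdGaussian (L.comp (EuclideanSpace.equiv ι RR : EuclideanSpace RR ι →L[RR] (ι -> RR)))) θ
  have h3 := congrArg (fun m => m.map Prod.fst) this
  beta_reduce at h3
  rw [Measure.map_map (by fun_prop) (by fun_prop)] at h3
  have e : (fun z : (ι -> RR) × (ι -> RR) => c • z.1 + s • z.2) = Prod.fst ∘ (ContinuousLinearMap.rotation θ) := by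
    funext z; simp [ContinuousLinearMap.rotation_apply, h1, h2]
  rw [e, h3, Measure.map_fst_prod]; simp
noncomputable def ff (p : MP ι) (w : RR) : RR := (stdGaussianPi ι).real {x | |eval x p| <= w}
lemma ff_mono (p : MP ι) {v w : RR} (h : v <= w) : ff p v <= ff p w :=
  measureReal_mono (fun _ hx => le_trans hx h)
lemma ff_nonneg (p : MP ι) (w : RR) : 0 <= ff p w := measureReal_nonneg
lemma ff_meas (p : MP ι) (w : RR) : MeasurableSet {x | |eval x p| <= w} :=
  measurableSet_le (cont_poly p).abs.measurable measurable_const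
lemma rat_rot {d : ℕ} {p : MP ι} (hp : p.totalDegree <= d) (m : RR) (x y : ι -> RR) : ∃ P : Polynomial RR, P.natDegree <= 2*d ∧
    ∀ t : RR, m^2 + t^2 ≠ 0 -> P.eval t = (m^2+t^2)^d * eval (((m^2-t^2)/(m^2+t^2)) • x + ((2*m*t)/(m^2+t^2)) • y) p := by
  have ha : ∀ α ∈ p.support, ∑ i, α i <= d := fun α hα => by
    refine le_trans ?_ ((le_totalDegree hα).trans hp)
    rw [Finsupp.sum_fintype _ _ (by simp)]
  refine ⟨∑ α ∈ p.support, PC (coeff α p) * ((PC (m^2) + PX^2)^(d - ∑ i, α i) *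
    ∏ i, ((PC (m^2) - PX^2) * PC (x i) + PC (2*m) * PX * PC (y i))^(α i)), ?_, fun t ht => ?_⟩
  · refine Polynomial.natDegree_sum_le_of_forall_le _ _ fun α hα => ?_
    refine (Polynomial.natDegree_C_mul_le _ _).trans (natDegree_mul_le.trans ?_)
    have h1 : ((PC (m^2) + PX^2 : Polynomial RR)^(d - ∑ i, α i)).natDegree <= (d - ∑ i, α i) * 2 :=
      Polynomial.natDegree_pow_le_of_le _ (by compute_degree)
    have h2 : (∏ i, ((PC (m^2) - PX^2) * PC (x i) + PC (2*m) * PX * PC (y i))^(α i)).natDegree <= ∑ i, α i * 2 :=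
      (Polynomial.natDegree_prod_le _ _).trans (sum_le_sum fun i _ => Polynomial.natDegree_pow_le_of_le _ (by compute_degree))
    rw [<- sum_mul] at h2
    have := ha α hα
    omega
  · rw [eval_finsetSum, eval_eq', mul_sum]
    refine sum_congr rfl fun α hα => ?_
    simp only [Polynomial.eval_mul, Polynomial.eval_C, Polynomial.eval_pow, Polynomial.eval_add, Polynomial.eval_X, Polynomial.eval_prod, Polynomial.eval_sub, Pi.add_apply, Pi.smul_apply, smul_eq_mul]
    have e1 : (m^2+t^2)^d = (m^2+t^2)^(d - ∑ i, α i) * ∏ i, (m^2+t^2)^(α i) := by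
      rw [Finset.prod_pow_eq_pow_sum, <- pow_add]; congr 1; have := ha α hα; omega
    have e2 : ∀ i, (m^2-t^2) * x i + 2*m*t*y i = (m^2+t^2) * ((m^2-t^2)/(m^2+t^2) * x i + (2*m*t)/(m^2+t^2) * y i) := fun i => by field_simp
    simp only [e2, mul_pow, prod_mul_distrib]
    rw [e1]; ring
lemma lag_bd {D m : ℕ} (P : Polynomial RR) (hP : P.natDegree <= D) (S : Finset ℕ) (hS : S.card = D+1) (hm : ∀ j ∈ S, j <= m) {w : RR} (hw : ∀ j ∈ S, |P.eval (j:RR)| <= w)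
    {t : RR} (h0 : 0 <= t) (h1 : t <= m) : |P.eval t| <= (D+1) * (m:RR)^D * w := by
  have hinj : Set.InjOn (fun j : ℕ => (j:RR)) S := fun a _ b _ h => Nat.cast_injective h
  have hdeg : P.degree < S.card := by
    rw [hS]; exact lt_of_le_of_lt (Polynomial.degree_le_of_natDegree_le hP) (by exact_mod_cast Nat.lt_succ_self D)
  conv_lhs => rw [Lagrange.eq_interpolate hinj hdeg]
  rw [Lagrange.interpolate_apply, eval_finsetSum]
  refine (abs_sum_le_sum_abs _ _).trans ?_
  have : ∀ j ∈ S, |(PC (P.eval (j:RR)) * Lagrange.basis S (fun j : ℕ => (j:RR)) j).eval t| <= (m:RR)^D * w := fun j hj => by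
    have hw0 := (abs_nonneg _).trans (hw j hj)
    rw [Polynomial.eval_mul, Polynomial.eval_C, abs_mul, mul_comm]
    refine mul_le_mul ?_ (hw j hj) (abs_nonneg _) (by positivity)
    rw [Lagrange.basis, Polynomial.eval_prod, Finset.abs_prod]
    have hc : (S.erase j).card = D := by rw [Finset.card_erase_of_mem hj, hS]; rfl
    rw [<- hc, <- Finset.prod_const]
    refine prod_le_prod (fun _ _ => abs_nonneg _) fun i hi => ?_
    obtain ⟨hij, hiS⟩ := Finset.mem_erase.1 hi
    simp only [Lagrange.basisDivisor, Polynomial.eval_mul, Polynomial.eval_C, Polynomial.eval_sub, Polynomial.eval_X]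
    have h3 : (1:RR) <= |(j:RR) - i| := by
      have : (1:ℤ) <= |(j:ℤ) - i| := Int.one_le_abs (by omega)
      exact_mod_cast this
    have h4 : |t - i| <= m := by
      have : (i:RR) <= m := by exact_mod_cast hm i hiS
      have : (0:RR) <= i := by positivity
      rw [abs_le]; constructor <;> linarith
    rw [abs_mul, abs_inv]
    calc |(j:RR)-i|⁻¹ * |t-i| <= 1 * m := mul_le_mul (inv_le_one_of_one_le₀ h3) h4 (abs_nonneg _) zero_le_one
      _ = m := one_mul _
  refine (sum_le_sum this).trans (le_of_eq ?_)
  rw [sum_const, hS, nsmul_eq_mul]; push_cast; ring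
lemma ff_step {d m : ℕ} {p : MP ι} (hp : p.totalDegree <= d) (hm : 1 <= m) {w : RR} (hw : 0 <= w) :
    ff p w <= 2*d/m + ff p ((2*d+1) * 2^d * (m:RR)^(2*d) * w) ^ 2 := by
  classical
  have hm0 : (0:RR) < m := by exact_mod_cast hm
  set w' := (2*d+1) * 2^d * (m:RR)^(2*d) * w with hw'
  set γ2 := (stdGaussianPi ι).prod (stdGaussianPi ι)
  let T : ℕ -> (ι -> RR) × (ι -> RR) -> (ι -> RR) := fun j z => (((m:RR)^2-(j:RR)^2)/((m:RR)^2+(j:RR)^2)) • z.1 + ((2*(m:RR)*j)/((m:RR)^2+(j:RR)^2)) • z.2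
  have hpos : ∀ t : RR, (m:RR)^2 + t^2 ≠ 0 := fun t => by positivity
  have hT : ∀ j, Measurable (T j) := fun j => by fun_prop
  let A : ℕ -> Set ((ι -> RR) × (ι -> RR)) := fun j => T j ⁻¹' {x | |eval x p| <= w}
  have hA : ∀ j, MeasurableSet (A j) := fun j => hT j (ff_meas p w)
  have hAm : ∀ j, γ2.real (A j) = ff p w := fun j => by
    have h1 := gam_rot (ι := ι) (c := ((m:RR)^2-(j:RR)^2)/((m:RR)^2+(j:RR)^2)) (s := (2*(m:RR)*j)/((m:RR)^2+(j:RR)^2)) (by have := hpos j; field_simp; ring)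
    unfold ff
    conv_rhs => rw [<- h1]
    rw [map_measureReal_apply (hT j) (ff_meas p w)]
  let B : Set ((ι -> RR) × (ι -> RR)) := {x | |eval x p| <= w'} ×ˢ {x | |eval x p| <= w'}
  have hB : MeasurableSet B := (ff_meas p w').prod (ff_meas p w')
  have hBm : γ2.real B = ff p w' ^ 2 := by rw [measureReal_prod_prod, sq]; rfl
  have key : ∀ z, ∑ j ∈ range m, (A j).indicator (fun _ => (1:RR)) z <= 2*d + m * B.indicator (fun _ => (1:RR)) z := by
    intro z
    have e : ∑ j ∈ range m, (A j).indicator (fun _ => (1:RR)) z = ((range m).filter (fun j => z ∈ A j)).card := by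
      simp only [Set.indicator_apply]; rw [Finset.sum_boole]
    rw [e]
    by_cases hz : z ∈ B
    · rw [indicator_of_mem hz]
      have : (((range m).filter (fun j => z ∈ A j)).card : RR) <= m := by
        exact_mod_cast (Finset.card_filter_le _ _).trans (card_range m).le
      have : (0:RR) <= 2*d := by positivity
      linarith
    · rw [indicator_of_notMem hz, mul_zero, add_zero]
      by_contra hcon
      push Not at hcon
      have hcon' : 2*d+1 <= ((range m).filter (fun j => z ∈ A j)).card := by exact_mod_cast hcon
      obtain ⟨S, hS1, hS2⟩ := Finset.exists_subset_card_eq hcon'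
      obtain ⟨P, hP1, hP2⟩ := rat_rot hp (m:RR) z.1 z.2
      have hb := fun t h0 h1 => lag_bd (m := m) P hP1 S hS2 (fun j hj => (mem_range.1 (Finset.mem_filter.1 (hS1 hj)).1).le) (w := (2*(m:RR)^2)^d * w) (fun j hj => by
        obtain ⟨h1, h2⟩ := Finset.mem_filter.1 (hS1 hj)
        have h3 : (j:RR) <= m := by exact_mod_cast (mem_range.1 h1).le
        rw [hP2 _ (hpos _), abs_mul, abs_of_nonneg (by positivity : (0:RR) <= ((m:RR)^2+(j:RR)^2)^d)]
        refine mul_le_mul (pow_le_pow_left₀ (by positivity) ?_ _) h2 (abs_nonneg _) (by positivity)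
        have := pow_le_pow_left₀ (by positivity) h3 2
        linarith) (t := t) h0 h1
      apply hz
      have hq : (0:RR) < (m:RR)^(2*d) := by positivity
      constructor
      · have h1 := hb 0 le_rfl hm0.le
        rw [hP2 _ (hpos _)] at h1
        have e2 : ((m:RR)^2 - 0^2)/((m:RR)^2+0^2) = 1 := by simp [hm0.ne']
        simp only [e2, mul_zero, zero_div, zero_smul, one_smul, add_zero] at h1
        rw [abs_mul, abs_of_nonneg (by positivity)] at h1
        show |_| <= w'
        rw [<- mul_le_mul_iff_right₀ hq, hw']
        refine le_trans (le_of_eq ?_) (h1.trans (le_of_eq ?_))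
        · congr 1; rw [pow_mul]; simp
        · rw [mul_pow, <- pow_mul]; push_cast; ring
      · have h1 := hb m hm0.le le_rfl
        rw [hP2 _ (hpos _)] at h1
        have e3 : 2*(m:RR)*m/((m:RR)^2+(m:RR)^2) = 1 := by field_simp; ring
        simp only [sub_self, zero_div, zero_smul, e3, one_smul, zero_add] at h1
        rw [abs_mul, abs_of_nonneg (by positivity)] at h1
        show |_| <= w'
        have h5 : |eval z.2 p| * 1 <= |eval z.2 p| * 2^d := mul_le_mul_of_nonneg_left (one_le_pow₀ (by norm_num)) (abs_nonneg _)
        rw [<- mul_le_mul_iff_right₀ hq, hw']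
        refine le_trans ?_ (h1.trans (le_of_eq ?_))
        · rw [<- two_mul, mul_pow, <- pow_mul]; nlinarith
        · rw [mul_pow, <- pow_mul]; push_cast; ring
  have hI : ∀ S : Set ((ι -> RR) × (ι -> RR)), MeasurableSet S -> Integrable (S.indicator (fun _ => (1:RR))) γ2 := fun S hS => (integrable_const _).indicator hS
  have h1 := integral_mono (μ := γ2) (integrable_finsetSum _ fun j _ => hI _ (hA j)) ((integrable_const _).add ((hI B hB).const_mul _)) key
  rw [integral_finsetSum _ fun j _ => hI _ (hA j), integral_add' (integrable_const _) ((hI B hB).const_mul _), integral_const_mul (m:RR), integral_indicator_const _ hB] at h1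
  simp only [integral_indicator_const _ (hA _), hAm, sum_const, card_range, nsmul_eq_mul, smul_eq_mul, mul_one, integral_const, probReal_univ, one_mul] at h1
  rw [hBm] at h1
  rw [<- mul_le_mul_iff_right₀ hm0]
  refine h1.trans (le_of_eq ?_)
  field_simp
lemma ff_pz {d : ℕ} {p : MP ι} (hp : p.totalDegree <= d) (hn : nr p = 1) : ff p (1/2) <= 1 - 1/(2 * Kc d ^ 2) := by
  have hK := Kc_ge d
  have h4 := hyper (T := 2) (by norm_num) hp
  have h2 : Ex (p*p) = 1 := by rw [<- nr_sq, hn, one_pow]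
  rw [h2, mul_one] at h4
  have hKe : ((d:RR)+1)^2 * (2*(2:ℕ):RR)^d = Kc d := by unfold Kc; norm_num
  rw [hKe] at h4
  set K := Kc d ^ 2 with hKd
  have hK0 : 0 < K := by rw [hKd]; exact pow_pos (by linarith) 2
  set S := {x : ι -> RR | |eval x p| <= 1/2}
  have hS : MeasurableSet S := ff_meas p (1/2)
  have hpt : ∀ x, eval x (p*p) <= 1/4 + (1/(4*K)) * eval x (p^(2*2)) + K * Sᶜ.indicator (fun _ => (1:RR)) x := by
    intro x
    rw [map_mul (eval x), map_pow (eval x)]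
    by_cases hx : x ∈ S
    · have h1 : |eval x p| <= 1/2 := hx
      rw [indicator_of_notMem (by simpa using hx)]
      have : eval x p * eval x p <= 1/4 := by rw [<- abs_mul_abs_self]; nlinarith [abs_nonneg (eval x p)]
      have : 0 <= 1/(4*K) * eval x p ^ (2*2) := mul_nonneg (by positivity) (Even.pow_nonneg (by decide) _)
      linarith
    · rw [indicator_of_mem hx]
      have : eval x p * eval x p <= (1/(4*K)) * eval x p ^ (2*2) + K * 1 := by
        generalize eval x p = a
        have : (1/(4*K)) * a^(2*2) + K*1 - a*a = (a^2 - 2*K)^2 / (4*K) := by field_simp; ring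
        have h2 : 0 <= (a^2 - 2*K)^2 / (4*K) := by positivity
        linarith
      linarith
  have hI : Integrable (Sᶜ.indicator (fun _ => (1:RR))) (stdGaussianPi ι) := (integrable_const _).indicator hS.compl
  have i1 : Integrable (fun x => (1/(4*K)) * eval x (p^(2*2))) (stdGaussianPi ι) := (int_poly _).const_mul _
  have h1 := integral_mono (μ := stdGaussianPi ι) (int_poly _) (((integrable_const (1/4:RR)).add i1).add (hI.const_mul K)) hpt
  rw [integral_add' ((integrable_const _).add i1) (hI.const_mul K), integral_add' (integrable_const _) i1, integral_const_mul (1/(4*K)), integral_const_mul K, integral_indicator_const _ hS.compl, <- Ex_def, <- Ex_def, h2, probReal_compl_eq_one_sub hS] at h1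
  simp only [integral_const, probReal_univ, smul_eq_mul, mul_one, one_mul] at h1
  have h5 : 1/(4*K) * Ex (p^(2*2)) <= 1/4 := by
    calc _ <= 1/(4*K) * K := by gcongr
      _ = 1/4 := by field_simp
  show (stdGaussianPi ι).real S <= _
  have h6 : 1/2 <= K * (1 - (stdGaussianPi ι).real S) := by linarith
  have h7 : 1/(2*K) <= 1 - (stdGaussianPi ι).real S := by
    rw [div_le_iff₀ (by positivity)]; linarith
  linarith
lemma ff_small (d : ℕ) {δ : RR} (hδ : 0 < δ) : ∃ w0 : RR, 0 < w0 ∧ ∀ (ι : Type) [Fintype ι] (p : MP ι), p.totalDegree <= d -> nr p = 1 -> ff p w0 <= δ := by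
  obtain ⟨c, hc0, hc1, hc⟩ : ∃ c : RR, 0 < c ∧ c <= 1/2 ∧ ∀ (ι : Type) [Fintype ι] (p : MP ι), p.totalDegree <= d -> nr p = 1 -> ff p (1/2) <= 1 - c := by
    have hK := Kc_ge d
    have : 1 <= Kc d ^ 2 := one_le_pow₀ hK
    refine ⟨1/(2 * Kc d ^ 2), by positivity, ?_, fun ι _ p h1 h2 => ff_pz h1 h2⟩
    rw [div_le_div_iff₀ (by positivity) (by norm_num)]; linarith
  have hj : ∀ j : ℕ, ∃ w0 : RR, 0 < w0 ∧ ∀ (ι : Type) [Fintype ι] (p : MP ι), p.totalDegree <= d -> nr p = 1 -> ff p w0 <= (1-c) * (1-c/2)^j := by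
    intro j
    induction j with
    | zero => exact ⟨1/2, by norm_num, by simpa using hc⟩
    | succ j ih =>
      obtain ⟨w, hw, h⟩ := ih
      set a := (1-c) * (1-c/2)^j with ha
      have hx : 0 < (1-c/2)^j := pow_pos (by linarith) j
      have ha0 : 0 < a := mul_pos (by linarith) hx
      have ha1 : a <= 1 - c := mul_le_of_le_one_right (by linarith) (pow_le_one₀ (by linarith) (by linarith))
      obtain ⟨m, hm⟩ := exists_nat_gt (2*d/(a*(c/2)))
      have hm0 : (0:RR) < m := lt_of_le_of_lt (by positivity) hm
      have hm1 : 1 <= m := by exact_mod_cast hm0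
      refine ⟨w / ((2*d+1) * 2^d * (m:RR)^(2*d)), by positivity, fun ι _ p h1 h2 => ?_⟩
      have h3 := ff_step h1 hm1 (w := w / ((2*d+1) * 2^d * (m:RR)^(2*d))) (by positivity)
      rw [mul_div_cancel₀ _ (by positivity)] at h3
      have h4 := h ι p h1 h2
      have h5 : 2*d/(m:RR) <= a*(c/2) := by
        rw [div_lt_iff₀ (by positivity)] at hm
        rw [div_le_iff₀ hm0]; linarith
      have h6 : ff p w ^ 2 <= a^2 := pow_le_pow_left₀ (ff_nonneg _ _) h4 2
      calc _ <= _ := h3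
        _ <= a*(c/2) + a^2 := add_le_add h5 h6
        _ <= a * (1-c/2) := by nlinarith
        _ = _ := by rw [ha]; ring
  obtain ⟨j, hj'⟩ := exists_pow_lt_of_lt_one hδ (show 1-c/2 < 1 by linarith)
  obtain ⟨w0, h0, h⟩ := hj j
  refine ⟨w0, h0, fun ι _ p h1 h2 => (h ι p h1 h2).trans ?_⟩
  have hx : 0 < (1-c/2)^j := pow_pos (by linarith) j
  nlinarith
theorem anti (d : ℕ) (hd : 1 <= d) : ∃ w0 c1 : RR, 0 < w0 ∧ 0 < c1 ∧ ∀ (ι : Type) [Fintype ι] (p : MP ι), p.totalDegree <= d -> nr p = 1 ->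
    ∀ y : RR, 0 < y -> y <= 1 -> ff p (w0 * y^(8*d)) <= c1 * y := by
  set E : RR := (2*d+1) * 2^d * 2^(2*d) with hE
  have hE1 : 1 <= E := by
    rw [hE]; have h1 : (1:RR) <= 2^d := one_le_pow₀ (by norm_num)
    have h2 : (1:RR) <= 2^(2*d) := one_le_pow₀ (by norm_num)
    have h3 : (1:RR) <= 2*d+1 := by have : (0:RR) <= d := by positivity
                                    linarith
    exact one_le_mul_of_one_le_of_one_le (one_le_mul_of_one_le_of_one_le h3 h1) h2
  set B : RR := 4*d with hB
  have hd1 : (1:RR) <= d := by exact_mod_cast hd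
  set s0 : RR := 1/(2*B*E^2) with hs0
  have hs00 : 0 < s0 := by positivity
  have hB0 : 0 < B := by positivity
  have hs01 : B * E^2 * s0 = 1/2 := by rw [hs0]; field_simp
  have hs02 : s0 <= 1/2 := by rw [hs0, div_le_div_iff₀ (by positivity) (by norm_num)]; nlinarith [one_le_pow₀ (n := 2) hE1]
  have hs03 : E * s0 <= 1/2 := by
    have h1 : 1 * E <= (B * E) * E := by gcongr; exact one_le_mul_of_one_le_of_one_le (by linarith) hE1
    have h2 := mul_le_mul_of_nonneg_right h1 hs00.le
    linarith [show B * E * E * s0 = B * E^2 * s0 by ring]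
  obtain ⟨w0, hw0, hsm⟩ := ff_small d (δ := B * s0^4) (by positivity)
  refine ⟨w0, B, hw0, by positivity, fun ι _ p hp hn => ?_⟩
  have main : ∀ N : ℕ, ∀ y : RR, s0^4 * (1/2)^N <= y -> y <= 1 -> ff p (w0 * y^(8*d)) <= B * y := by
    intro N
    have base : ∀ y : RR, s0^4 <= y -> y <= 1 -> ff p (w0 * y^(8*d)) <= B * y := fun y h1 h2 => by
      have hy0 : 0 <= y := le_trans (by positivity) h1
      refine (ff_mono p (mul_le_of_le_one_right hw0.le (pow_le_one₀ hy0 h2))).trans ((hsm ι p hp hn).trans ?_)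
      gcongr
    induction N with
    | zero => intro y h1; rw [pow_zero, mul_one] at h1; exact base y h1
    | succ N ih =>
      intro y h1 h2
      by_cases hy : s0^4 <= y
      · exact base y hy h2
      push Not at hy
      have hy0 : 0 < y := lt_of_lt_of_le (by positivity) h1
      obtain ⟨s, hs, rfl⟩ : ∃ s : RR, 0 < s ∧ s^4 = y := ⟨√(√y), by positivity, by
        rw [show (4:ℕ) = 2*2 by rfl, pow_mul, sq_sqrt (by positivity), sq_sqrt hy0.le]⟩
      have hss : s < s0 := lt_of_pow_lt_pow_left₀ 4 hs00.le hy
      have hEs : E * s <= 1/2 := le_trans (by gcongr) hs03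
      obtain ⟨m, hm1, hm2⟩ : ∃ m : ℕ, 1/s^4 <= m ∧ (m:RR) <= 2/s^4 := by
        refine ⟨⌈1/s^4⌉₊, Nat.le_ceil _, ?_⟩
        have h3 := (Nat.ceil_lt_add_one (show 0 <= 1/s^4 by positivity)).le
        have h4 : 1 <= 1/s^4 := by rw [le_div_iff₀ (by positivity)]; linarith
        calc _ <= _ := h3
          _ <= 1/s^4 + 1/s^4 := by linarith
          _ = _ := by ring
      have hm0 : (0:RR) < m := lt_of_lt_of_le (by positivity) hm1
      have h3 := ff_step hp (by exact_mod_cast hm0 : 1 <= m) (w := w0 * (s^4)^(8*d)) (by positivity)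
      have h4 : 2*d/(m:RR) <= B/2 * s^4 := by
        rw [div_le_iff₀ hm0, hB]
        rw [div_le_iff₀ (by positivity)] at hm1
        nlinarith
      have h5 : (2*d+1) * 2^d * (m:RR)^(2*d) * (w0 * (s^4)^(8*d)) <= w0 * (E * s^3)^(8*d) := by
        calc _ <= (2*d+1) * 2^d * (2/s^4)^(2*d) * (w0 * (s^4)^(8*d)) := by gcongr
          _ = w0 * (E * (s^3)^(8*d)) := by
            rw [hE, div_pow]
            have : (s^4)^(8*d) = (s^4)^(2*d) * (s^3)^(8*d) := by rw [<- pow_mul, <- pow_mul, <- pow_mul, <- pow_add]; congr 1; ring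
            rw [this]; field_simp
          _ <= w0 * (E^(8*d) * (s^3)^(8*d)) := by gcongr; exact le_self_pow₀ hE1 (by omega)
          _ = _ := by rw [mul_pow E]
      have h6 : ff p (w0 * (E * s^3)^(8*d)) <= B * (E * s^3) := by
        refine ih _ ?_ ?_
        · have : s^4 * 2 <= E * s^3 := by
            have : s^4 * 2 = 2 * s * s^3 := by ring
            rw [this]; gcongr; linarith
          calc _ = s0^4 * (1/2)^(N+1) * 2 := by ring
            _ <= s^4 * 2 := by gcongr
            _ <= _ := this
        · have : s^2 <= 1 := pow_le_one₀ hs.le (by linarith)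
          calc E * s^3 = E * s * s^2 := by ring
            _ <= 1/2 * 1 := by gcongr
            _ <= 1 := by norm_num
      have h7 : ff p ((2*d+1) * 2^d * (m:RR)^(2*d) * (w0 * (s^4)^(8*d))) ^ 2 <= (B * (E * s^3))^2 :=
        pow_le_pow_left₀ (ff_nonneg _ _) ((ff_mono p h5).trans h6) 2
      have h8 : (B * (E * s^3))^2 <= B/2 * s^4 := by
        have : B * E^2 * s <= 1/2 := le_trans (by gcongr) hs01.le
        calc (B * (E * s^3))^2 = (B * E^2 * s) * (B * s^4) * s := by ring
          _ <= 1/2 * (B * s^4) * 1 := by gcongr; linarith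
          _ = _ := by ring
      linarith
  intro y hy0 hy1
  obtain ⟨N, hN⟩ := exists_pow_lt_of_lt_one (show 0 < y / s0^4 by positivity) (show (1/2:RR) < 1 by norm_num)
  refine main N y ?_ hy1
  rw [lt_div_iff₀ (by positivity)] at hN; linarith
lemma gauss_dd (μ : Measure (ι -> RR)) [IsProbabilityMeasure μ] {κ : (ι -> RR) -> RR} (hκ : Continuous κ) (hκ1 : ∀ x, 0 <= κ x ∧ κ x <= 1) {L : RR} (hL : 0 < L) {Y : ℕ} {p : MP ι}
    (h : ∀ u : RR, |u| <= L -> ‖DD μ (fun x => (κ x : ℂ) * ec (Ic * ((u * eval x p : RR) : ℂ)))‖ <= (1/2)^Y) (v : RR) :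
    |∫ x, κ x * er (-(L^2/(8*(Y+1))) * (eval x p - v)^2) ∂μ - ∫ x, κ x * er (-(L^2/(8*(Y+1))) * (eval x p - v)^2) ∂(stdGaussianPi ι)| <= 2 * (1/2)^Y := by
  set b := L^2/(8*((Y:RR)+1)) with hb
  have hb0 : 0 < b := by positivity
  obtain ⟨ω, hω, h1, h2⟩ := term1 (b := (b:ℂ)) (by simpa using hb0)
  have h3 := h2 (1/(4*b)) (by rw [Complex.normSq_ofReal, ofReal_re]; exact le_of_eq (by field_simp))
  have hF : ∀ ν : Measure (ι -> RR), IsProbabilityMeasure ν -> Integrable (fun x => (κ x : ℂ)) ν := fun ν _ => (int_bdd ν hκ hκ1).ofReal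
  have hmain := superpos_bd μ (σ := Unit) (fun _ => ω) (fun _ => hω) (fun _ => 1/(4*b)) (fun _ => by positivity) (fun _ => h3.1) (fun _ => h3.2)
    (fun _ x => eval x p - v) (fun _ => ((cont_poly p).sub continuous_const).measurable) (fun x => (κ x : ℂ)) (hF _ inferInstance) (hF _ inferInstance) (E := (1/2)^Y) (by positivity) (by
      intro z
      simp only [univ_unique, sum_singleton]
      generalize z default = u
      by_cases hu : |u| <= L
      · have e : ∀ ν : Measure (ι -> RR), ∫ x, (κ x : ℂ) * ec (Ic * (u * ((eval x p - v : RR) : ℂ))) ∂ν = ec (((-(u*v) : RR) : ℂ) * Ic) * ∫ x, (κ x : ℂ) * ec (Ic * ((u * eval x p : RR) : ℂ)) ∂ν := by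
          intro ν
          rw [<- integral_const_mul]
          congr 1; funext x
          rw [mul_left_comm (ec _), <- exp_add]
          congr 2; push_cast; ring
        rw [DD, e, e, <- mul_sub, norm_mul, norm_exp_ofReal_mul_I, one_mul]
        refine (h u hu).trans (le_mul_of_one_le_right (by positivity) (one_le_exp (by positivity)))
      · push Not at hu
        have e : ∀ ν : Measure (ι -> RR), IsProbabilityMeasure ν -> ‖∫ x, (κ x : ℂ) * ec (Ic * (u * ((eval x p - v : RR) : ℂ))) ∂ν‖ <= 1 := by
          intro ν _
          refine (norm_integral_le_of_norm_le_const (C := 1) (Filter.Eventually.of_forall fun x => ?_)).trans (by simp)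
          rw [norm_mul, show Ic * (u * ((eval x p - v : RR) : ℂ)) = ((u * (eval x p - v) : RR) : ℂ) * Ic by push_cast; ring, norm_exp_ofReal_mul_I, mul_one, norm_real, norm_of_nonneg (hκ1 x).1]
          exact (hκ1 x).2
        refine (norm_sub_le _ _).trans ((add_le_add (e μ inferInstance) (e _ inferInstance)).trans ?_)
        have h5 : ((Y+1:ℕ):RR) <= 1/(4*b) * u^2/2 := by
          have : L^2 <= u^2 := by rw [<- sq_abs u]; gcongr
          rw [hb]
          calc ((Y+1:ℕ):RR) = 1/(4*(L^2/(8*((Y:RR)+1)))) * L^2/2 := by push_cast; field_simp; norm_num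
            _ <= _ := by gcongr
        have h6 : (2:RR)^(Y+1) <= er (1/(4*b) * u^2/2) := by
          refine le_trans ?_ (exp_le_exp.2 h5)
          rw [<- mul_one ((Y+1:ℕ):RR), exp_nat_mul]
          gcongr
          linarith [add_one_le_exp (1:RR)]
        calc (1:RR)+1 = (1/2)^Y * 2^(Y+1) := by rw [pow_succ, <- mul_assoc, <- mul_pow]; norm_num
          _ <= _ := by gcongr)
  simp only [univ_unique, Finset.prod_singleton, Fintype.card_unit, pow_one, (h1 _).2] at hmain
  have e : ∀ ν : Measure (ι -> RR), ∫ x, (κ x : ℂ) * ec (-(b:ℂ) * ((eval x p - v : RR) : ℂ)^2) ∂ν = ((∫ x, κ x * er (-b * (eval x p - v)^2) ∂ν : RR) : ℂ) := by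
    intro ν
    rw [<- integral_complex_ofReal]; congr 1; funext x; push_cast; rfl
  rw [DD, e, e, <- Complex.ofReal_sub, norm_real, norm_eq_abs] at hmain
  refine hmain.trans ?_
  rw [norm_real, norm_of_nonneg hb0.le, ofReal_re, mul_div_assoc, div_self hb0.ne', mul_one, mul_comm]
  gcongr
  exact sq_le (by norm_num)
noncomputable def GG (b w B t : RR) : RR := ∫ v in Icc (-w) B, √(b/pR) * er (-b * (t - v)^2)
lemma GG_int {b : RR} (hb : 0 < b) (t : RR) : Integrable (fun v => √(b/pR) * er (-b * (t - v)^2)) ∧ ∫ v, √(b/pR) * er (-b * (t - v)^2) = 1 := by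
  have h := (integrable_exp_neg_mul_sq hb).comp_sub_left t
  refine ⟨h.const_mul _, ?_⟩
  rw [integral_const_mul, integral_sub_left_eq_self (fun v => er (-b * v^2)) volume t, integral_gaussian, <- sqrt_mul (by positivity)]
  rw [show b / pR * (pR / b) = 1 by field_simp [Real.pi_ne_zero], sqrt_one]
lemma GG_mem {b : RR} (hb : 0 < b) (w B t : RR) : 0 <= GG b w B t ∧ GG b w B t <= 1 := by
  obtain ⟨h1, h2⟩ := GG_int hb t
  refine ⟨integral_nonneg fun v => by positivity, ?_⟩
  rw [<- h2]
  exact setIntegral_le_integral h1 (Filter.Eventually.of_forall fun v => by positivity)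
lemma GG_tail {b w : RR} (hb : 0 < b) (hw : 0 <= w) (t : RR) {S : Set RR} (hS : MeasurableSet S) (h : ∀ v ∈ S, w <= |t - v|) :
    ∫ v in S, √(b/pR) * er (-b * (t - v)^2) <= 2 * er (-(b*w^2/2)) := by
  obtain ⟨h1, _⟩ := GG_int hb t
  obtain ⟨h3, h4⟩ := GG_int (half_pos hb) t
  have hs : √(b/pR) <= 2 * √(b/2/pR) := by
    rw [show (2:RR) = √4 by rw [show (4:RR) = 2^2 by norm_num, sqrt_sq (by norm_num)], <- sqrt_mul (by norm_num)]
    refine sqrt_le_sqrt ?_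
    have : √(4:RR) = 2 := by rw [show (4:RR) = 2^2 by norm_num, sqrt_sq (by norm_num)]
    rw [this, show 4 * (b/2/pR) = 2 * (b/pR) by ring]
    linarith [show 0 < b/pR by positivity]
  calc _ <= ∫ v in S, 2 * er (-(b*w^2/2)) * (√(b/2/pR) * er (-(b/2) * (t - v)^2)) := by
        refine setIntegral_mono_on h1.integrableOn (h3.const_mul _).integrableOn hS fun v hv => ?_
        have h5 : w^2 <= (t-v)^2 := by rw [<- sq_abs (t-v)]; exact pow_le_pow_left₀ hw (h v hv) 2
        calc _ <= 2 * √(b/2/pR) * (er (-(b*w^2/2)) * er (-(b/2) * (t - v)^2)) := by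
              rw [<- Real.exp_add]; gcongr; nlinarith
          _ = _ := by ring
    _ <= 2 * er (-(b*w^2/2)) * 1 := by
        rw [integral_const_mul, <- h4]
        exact mul_le_mul_of_nonneg_left (setIntegral_le_integral h3 (Filter.Eventually.of_forall fun v => by positivity)) (by positivity)
    _ = _ := mul_one _
lemma GG_fub (ν : Measure (ι -> RR)) [IsProbabilityMeasure ν] {κ : (ι -> RR) -> RR} (hκ : Continuous κ) (hκ1 : ∀ x, 0 <= κ x ∧ κ x <= 1) {b : RR} (hb : 0 < b) (w B : RR) (p : MP ι) :
    Integrable (fun x => κ x * GG b w B (eval x p)) ν ∧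
    Integrable (fun v => √(b/pR) * ∫ x, κ x * er (-b * (eval x p - v)^2) ∂ν) (volume.restrict (Icc (-w) B)) ∧
    ∫ x, κ x * GG b w B (eval x p) ∂ν = ∫ v in Icc (-w) B, √(b/pR) * ∫ x, κ x * er (-b * (eval x p - v)^2) ∂ν := by
  have hc := cont_poly p
  have hint : Integrable (Function.uncurry fun (x : ι -> RR) (v : RR) => √(b/pR) * (κ x * er (-b * (eval x p - v)^2))) (ν.prod (volume.restrict (Icc (-w) B))) := by
    refine Integrable.of_bound (C := √(b/pR)) (Continuous.aestronglyMeasurable ?_) (Filter.Eventually.of_forall fun ⟨x, v⟩ => ?_)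
    · have := hc.comp (continuous_fst (X := ι -> RR) (Y := RR))
      have h2 := hκ.comp (continuous_fst (X := ι -> RR) (Y := RR))
      simp only [Function.comp_def] at this h2
      simp only [Function.uncurry_def]
      fun_prop
    · have h0 := hκ1 x
      have h1 : er (-b * (eval x p - v)^2) <= 1 := Real.exp_le_one_iff.2 (by nlinarith [sq_nonneg (eval x p - v)])
      simp only [Function.uncurry]
      rw [norm_of_nonneg (mul_nonneg (sqrt_nonneg _) (mul_nonneg h0.1 (exp_pos _).le))]
      refine mul_le_of_le_one_right (sqrt_nonneg _) (mul_le_one₀ h0.2 (exp_pos _).le h1)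
  have e1 : ∀ x, κ x * GG b w B (eval x p) = ∫ v in Icc (-w) B, √(b/pR) * (κ x * er (-b * (eval x p - v)^2)) := by
    intro x; rw [GG, <- integral_const_mul]; congr 1; funext v; ring
  simp only [e1, <- integral_const_mul]
  exact ⟨hint.integral_prod_left, hint.integral_prod_right, integral_integral_swap hint⟩
lemma up_bd {μ : Measure (ι -> RR)} [IsProbabilityMeasure μ] {Kg Y l d : ℕ} {ρ : RR} (hG : Good Kg ρ μ) (hdK : d <= Kg) (hY : 1 <= Y) {κ : (ι -> RR) -> RR} (hκ : Continuous κ) (hκ1 : ∀ x, 0 <= κ x ∧ κ x <= 1)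
    (hl : 12 * (Y:RR) <= (Y:RR)^l * (Y:RR)^l) {p : MP ι} (hp : p.totalDegree <= d) (hn : nr p = 1) (hk : ∫ x, (1 - κ x) ∂μ <= (1/2)^Y)
    (h : ∀ u : RR, |u| <= (Y:RR)^l -> ‖DD μ (fun x => (κ x : ℂ) * ec (Ic * ((u * eval x p : RR) : ℂ)))‖ <= (1/2)^Y) :
    μ.real {x | 0 <= eval x p} <= (stdGaussianPi ι).real {x | 0 <= eval x p} + ff p (12*Y/(Y:RR)^l) + (19 * ((Y:RR)^l)^2 * (1/2)^Y + 8/((Y:RR)^l)^2) := by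
  have hY1 : (1:RR) <= Y := by exact_mod_cast hY
  set L := (Y:RR)^l with hLd
  have hL1 : 1 <= L := one_le_pow₀ hY1
  have hL0 : 0 < L := by linarith
  have hdd := gauss_dd μ hκ hκ1 hL0 h
  set b := L^2/(8*((Y:RR)+1)) with hb
  have hb0 : 0 < b := by positivity
  set w := 6*Y/L with hw
  have hw0 : 0 < w := by positivity
  have hbw : (Y:RR) <= b*w^2/2 := by
    have : b*w^2/2 = Y * (9*Y/(4*(Y+1))) := by rw [hb, hw]; field_simp; ring
    rw [this]; refine le_mul_of_one_le_right (by positivity) ?_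
    rw [le_div_iff₀ (by positivity)]; linarith
  have hwL : w <= L/2 := by rw [hw, div_le_div_iff₀ hL0 (by norm_num)]; linarith
  set e := 2 * (1/2:RR)^Y with he
  have he0 : 0 < e := by positivity
  have hexp : 2 * er (-(b*w^2/2)) <= e := by
    rw [he]; gcongr
    calc er (-(b*w^2/2)) <= er ((Y:RR) * (-1)) := exp_le_exp.2 (by linarith)
      _ = er (-1) ^ Y := exp_nat_mul _ _
      _ <= _ := by
        gcongr
        rw [Real.exp_neg, <- one_div]
        exact one_div_le_one_div_of_le (by norm_num) (by linarith [add_one_le_exp (1:RR)])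
  set γ := stdGaussianPi ι with hγ
  have hfμ := GG_fub μ hκ hκ1 hb0 w L p
  have hfγ := GG_fub γ hκ hκ1 hb0 w L p
  have hm : ∀ c : RR, MeasurableSet {x : ι -> RR | c <= eval x p} := fun c => (isClosed_le continuous_const (cont_poly p)).measurableSet
  have hD : ∫ x, κ x * GG b w L (eval x p) ∂μ - ∫ x, κ x * GG b w L (eval x p) ∂γ <= 14 * L^2 * (1/2)^Y := by
    rw [hfμ.2.2, hfγ.2.2, <- integral_sub hfμ.2.1 hfγ.2.1]
    refine (le_abs_self _).trans ?_
    rw [<- norm_eq_abs]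
    have hsq : √(b/pR) <= L := by
      rw [<- sqrt_sq hL0.le]; refine sqrt_le_sqrt ?_
      rw [hb, div_div]
      exact div_le_self (by positivity) (by nlinarith [Real.pi_gt_three])
    refine (norm_setIntegral_le_of_norm_le_const (C := L * (2 * (1/2)^Y)) (by simp) fun v _ => ?_).trans ?_
    · rw [<- mul_sub, norm_mul, norm_of_nonneg (sqrt_nonneg _)]
      exact mul_le_mul hsq (hdd v) (norm_nonneg _) hL0.le
    · rw [Real.volume_real_Icc, max_eq_left (by linarith)]
      calc _ <= L * (2 * (1/2)^Y) * (2 * L) := by gcongr; linarith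
        _ = 4 * (L^2 * (1/2)^Y) := by ring
        _ <= 14 * (L^2 * (1/2)^Y) := by gcongr; norm_num
        _ = _ := by ring
  have hga : ∫ x, κ x * GG b w L (eval x p) ∂γ <= γ.real {x | 0 <= eval x p} + ff p (12*Y/L) + e := by
    have hle : ∀ x, κ x * GG b w L (eval x p) <= {x | 0 <= eval x p}.indicator (fun _ => (1:RR)) x + {x | |eval x p| <= 12*Y/L}.indicator (fun _ => (1:RR)) x + e := by
      intro x
      have hg := GG_mem hb0 w L (eval x p)
      have h1 : κ x * GG b w L (eval x p) <= GG b w L (eval x p) := mul_le_of_le_one_left hg.1 (hκ1 x).2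
      have i1 : 0 <= {x | 0 <= eval x p}.indicator (fun _ => (1:RR)) x := Set.indicator_nonneg (fun _ _ => zero_le_one) x
      have i2 : 0 <= {x | |eval x p| <= 12*Y/L}.indicator (fun _ => (1:RR)) x := Set.indicator_nonneg (fun _ _ => zero_le_one) x
      by_cases c1 : 0 <= eval x p
      · rw [indicator_of_mem (show x ∈ {x | 0 <= eval x p} from c1)]; linarith
      by_cases c2 : |eval x p| <= 12*Y/L
      · rw [indicator_of_mem (show x ∈ {x | |eval x p| <= 12*Y/L} from c2)]; linarith
      push Not at c1 c2
      rw [abs_of_neg c1] at c2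
      have h12 : 12*Y/L = 2*w := by rw [hw]; ring
      have := GG_tail hb0 hw0.le (eval x p) (S := Icc (-w) L) measurableSet_Icc fun v hv => by
        rw [abs_of_neg (by linarith [hv.1] : eval x p - v < 0)]; linarith [hv.1]
      have h3 : GG b w L (eval x p) <= e := this.trans hexp
      linarith
    have j1 : Integrable ({x | 0 <= eval x p}.indicator (fun _ => (1:RR))) γ := (integrable_const _).indicator (hm 0)
    have j2 : Integrable ({x | |eval x p| <= 12*Y/L}.indicator (fun _ => (1:RR))) γ := (integrable_const _).indicator (ff_meas p _)
    have := integral_mono (μ := γ) hfγ.1 ((j1.add j2).add (integrable_const e)) hle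
    rw [integral_add' (j1.add j2) (integrable_const e), integral_add' j1 j2, integral_indicator_const _ (hm 0), integral_indicator_const _ (ff_meas p _)] at this
    simpa [ff] using this
  have hmu : μ.real {x | 0 <= eval x p} <= ∫ x, κ x * GG b w L (eval x p) ∂μ + (1/2)^Y + 8/L^2 + e := by
    have hgp := hG p (hp.trans hdK)
    have hle : ∀ x, {x | 0 <= eval x p}.indicator (fun _ => (1:RR)) x <= κ x * GG b w L (eval x p) + (1 - κ x) + 4/L^2 * eval x p ^ 2 + e := by
      intro x
      have hg := GG_mem hb0 w L (eval x p)
      have hk0 := hκ1 x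
      have i0 : 0 <= κ x * GG b w L (eval x p) := mul_nonneg hk0.1 hg.1
      have i1 : 0 <= 4/L^2 * eval x p ^ 2 := by positivity
      by_cases c1 : 0 <= eval x p
      · rw [indicator_of_mem (show x ∈ {x | 0 <= eval x p} from c1)]
        by_cases c2 : eval x p <= L/2
        · obtain ⟨k1, k2⟩ := GG_int hb0 (eval x p)
          have k3 := integral_add_compl (measurableSet_Icc (a := -w) (b := L)) k1
          rw [k2] at k3
          have k4 := GG_tail hb0 hw0.le (eval x p) (S := (Icc (-w) L)ᶜ) measurableSet_Icc.compl fun v hv => by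
            by_contra hc
            push Not at hc
            rw [abs_lt] at hc
            exact hv ⟨by linarith, by linarith⟩
          have k5 : 1 - e <= GG b w L (eval x p) := by unfold GG; linarith
          have : (1 - κ x) * (1 - GG b w L (eval x p)) ≥ 0 := mul_nonneg (by linarith) (by linarith)
          nlinarith
        · push Not at c2
          have : 1 <= 4/L^2 * eval x p ^ 2 := by
            calc 1 = 4/L^2 * (L/2)^2 := by field_simp; norm_num
              _ <= _ := by gcongr
          linarith
      · rw [indicator_of_notMem (show x ∉ {x | 0 <= eval x p} from c1)]; linarith
    have j1 : Integrable ({x | 0 <= eval x p}.indicator (fun _ => (1:RR))) μ := (integrable_const _).indicator (hm 0)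
    have j2 : Integrable (fun x => 1 - κ x) μ := (integrable_const _).sub (int_bdd μ hκ hκ1)
    have j3 : Integrable (fun x => 4/L^2 * eval x p ^ 2) μ := hgp.2.2.1.const_mul _
    have := integral_mono (μ := μ) j1 (((hfμ.1.add j2).add j3).add (integrable_const e)) hle
    rw [integral_add' ((hfμ.1.add j2).add j3) (integrable_const e), integral_add' (hfμ.1.add j2) j3, integral_add' hfμ.1 j2, integral_indicator_const _ (hm 0), integral_const_mul (4/L^2)] at this
    have h8 : 4/L^2 * ∫ x, eval x p ^ 2 ∂μ <= 8/L^2 := by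
      have := hgp.2.2.2
      rw [hn] at this
      calc _ <= 4/L^2 * (2*1^2) := by gcongr
        _ = _ := by ring
    simp only [smul_eq_mul, mul_one, integral_const, probReal_univ, one_mul] at this
    linarith
  have hf : 14 * L^2 * (1/2)^Y + (1/2)^Y + e + e <= 19 * L^2 * (1/2)^Y := by
    have : 1 * (1/2:RR)^Y <= L^2 * (1/2)^Y := by gcongr; exact one_le_pow₀ hL1
    rw [he]; linarith
  linarith
lemma smooth (d l : ℕ) (hd : 1 <= d) (hl : 1 <= l) : ∃ Y0 : ℕ, ∀ Y ≥ Y0, ∀ (ι : Type) [Fintype ι] (μ : Measure (ι -> RR)) [IsProbabilityMeasure μ] (Kg : ℕ) (ρ : RR),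
    Good Kg ρ μ -> Y ^ (bb d l d) <= Kg -> ρ <= (1/2) ^ (Y ^ (bb d l d + 1)) -> ∀ p : MP ι, p.totalDegree <= d -> nr p = 1 ->
    |μ.real {x | 0 <= eval x p} - (stdGaussianPi ι).real {x | 0 <= eval x p}| <= 2 * ff p (12*Y/(Y:RR)^l) + 9/(Y:RR)^l := by
  obtain ⟨Y1, hY1⟩ := main_char d l hd
  have hev : ∀ᶠ Y : ℕ in Filter.atTop, 19 * (Y:RR) ^ (4*l) <= 2 ^ Y := by
    have h1 := (tendsto_pow_const_div_const_pow_of_one_lt (4*l) (r := (2:RR)) (by norm_num)).eventually (gt_mem_nhds (show (0:RR) < 1/19 by norm_num))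
    filter_upwards [h1] with Y h
    rw [div_lt_iff₀ (by positivity)] at h; linarith
  obtain ⟨Y2, hY2⟩ := Filter.eventually_atTop.1 hev
  refine ⟨Y1 + Y2 + d + 12, fun Y hY ι _ μ _ Kg ρ hG hKg hρ p hp hn => ?_⟩
  have hx := hY2 Y (by omega)
  have h12 : (12:RR) <= Y := by exact_mod_cast (by omega : 12 <= Y)
  have hYL : (Y:RR) <= (Y:RR)^l := le_self_pow₀ (by linarith) (by omega)
  have hdK : d <= Kg := le_trans (le_trans (by omega) (Nat.le_self_pow (by rw [bb_top d l d hd]; omega) Y)) hKg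
  have hone : ∀ q : MP ι, q.totalDegree <= d -> nr q = 1 -> μ.real {x | 0 <= eval x q} <= (stdGaussianPi ι).real {x | 0 <= eval x q} + ff q (12*Y/(Y:RR)^l) + 9/(Y:RR)^l := by
    intro q hq hqn
    obtain ⟨κ, k1, k2, k3, k4⟩ := hY1 Y (by omega) ι μ Kg ρ hG hKg hρ q hq hqn.le
    refine (up_bd hG hdK (by omega) k1 k2 (by nlinarith) hq hqn k3 k4).trans ?_
    gcongr
    rw [pow_mul'] at hx
    generalize (Y:RR)^l = L at *
    have hL : 1 <= L := by linarith
    have e1 : 19 * L^2 * (1/2)^Y <= 1/L^2 := by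
      rw [le_div_iff₀ (by positivity), one_div, inv_pow, mul_right_comm, <- div_eq_mul_inv, div_le_one (by positivity)]
      linarith [show 19*L^2*L^2 = 19*L^4 by ring]
    have e2 : 9/L^2 <= 9/L := by gcongr; exact le_self_pow₀ hL (by norm_num)
    linarith [show 1/L^2 + 8/L^2 = 9/L^2 by ring]
  have a1 := hone p hp hn
  have a2 := hone (-p) (by rwa [totalDegree_neg]) (by rw [nr_neg, hn])
  have hff : ff (-p) (12*Y/(Y:RR)^l) = ff p (12*Y/(Y:RR)^l) := by unfold ff; simp
  have hm : MeasurableSet {x : ι -> RR | 0 <= eval x p} := (isClosed_le continuous_const (cont_poly p)).measurableSet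
  have b1 : 1 <= μ.real {x | 0 <= eval x p} + μ.real {x | 0 <= eval x (-p)} := by
    rw [<- probReal_univ (μ := μ)]
    refine le_trans (measureReal_mono ?_) (measureReal_union_le _ _)
    intro x _
    rcases le_total 0 (eval x p) with h | h
    · exact Or.inl h
    · right; simpa using h
  have b2 : (stdGaussianPi ι).real {x | 0 <= eval x p} + (stdGaussianPi ι).real {x | 0 <= eval x (-p)} <= 1 + ff p (12*Y/(Y:RR)^l) := by
    have : (stdGaussianPi ι).real {x | 0 <= eval x (-p)} <= (stdGaussianPi ι).real ({x | 0 <= eval x p}ᶜ) + ff p (12*Y/(Y:RR)^l) := by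
      refine le_trans (measureReal_mono ?_) (measureReal_union_le _ _)
      intro x hx
      have hx' : eval x p <= 0 := by simpa using hx
      rcases eq_or_lt_of_le hx' with h | h
      · right; show |eval x p| <= _; rw [h, abs_zero]; positivity
      · left; exact not_le.2 h
    rw [probReal_compl_eq_one_sub hm] at this
    linarith
  have := ff_nonneg p (12*Y/(Y:RR)^l)
  rw [hff] at a2
  rw [abs_le]; constructor <;> linarith
lemma sgn_int (μ : Measure (ι -> RR)) [IsProbabilityMeasure μ] (p : MP ι) : ∫ x, sgn (eval x p) ∂μ = 2 * μ.real {x | 0 <= eval x p} - 1 := by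
  have hm : MeasurableSet {x : ι -> RR | 0 <= eval x p} := (isClosed_le continuous_const (cont_poly p)).measurableSet
  have e : ∀ x, sgn (eval x p) = {x | 0 <= eval x p}.indicator (fun _ => (2:RR)) x - 1 := by
    intro x
    by_cases h : 0 <= eval x p
    · rw [indicator_of_mem (show x ∈ {x | 0 <= eval x p} from h), sgn, if_pos h]; norm_num
    · rw [indicator_of_notMem (show x ∉ {x | 0 <= eval x p} from h), sgn, if_neg h]; norm_num
  simp only [e]
  rw [integral_sub ((integrable_const _).indicator hm) (integrable_const _), integral_indicator_const _ hm]
  simp; ring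
lemma root_ex (b k : ℕ) : ∃ Y : ℕ, Y^(b+2) <= k ∧ k < (Y+1)^(b+2) := by
  refine ⟨Nat.findGreatest (fun Y => Y^(b+2) <= k) k, Nat.findGreatest_spec (P := fun Y => Y^(b+2) <= k) (m := 0) (Nat.zero_le _) (by simp), ?_⟩
  by_contra h
  push Not at h
  have h2 := (Nat.le_self_pow (n := b+2) (by omega) (Nat.findGreatest (fun Y => Y^(b+2) <= k) k + 1)).trans h
  exact Nat.findGreatest_is_greatest (P := fun Y => Y^(b+2) <= k) (Nat.lt_succ_self _) h2 h
lemma eta_bd {n k : ℕ} {A η ρ : RR} (hn : 1 <= n) (hk : 2 <= k) (hA : 5 <= A) (hη : η <= (n:RR) ^ (-(A*k)) * (k:RR) ^ (-(A*k))) (hρ : (1/2:RR)^k <= ρ) :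
    ((k:RR)+1) * ((n:RR) * (k+1))^k * η <= ρ := by
  have hn1 : (1:RR) <= n := by exact_mod_cast hn
  have hk2 : (2:RR) <= k := by exact_mod_cast hk
  have e1 : ∀ (x : RR) (m : ℕ), 1 <= x -> (m:RR) <= A*k -> x ^ (-(A*k)) <= (x^m)⁻¹ := by
    intro x m hx hm
    rw [<- rpow_natCast, <- Real.rpow_neg (by linarith)]
    exact Real.rpow_le_rpow_of_exponent_le hx (by linarith)
  have hη2 : η <= ((n:RR)^k)⁻¹ * ((k:RR)^(5*k))⁻¹ := by
    refine hη.trans (mul_le_mul (e1 n k hn1 (by nlinarith)) (e1 k (5*k) (by linarith) (by push_cast; nlinarith)) (by positivity) (by positivity))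
  have h4 : ((k:RR)+1) * (k+1)^k <= (k:RR)^(4*k) := by
    calc _ = ((k:RR)+1)^(k+1) := by rw [pow_succ']
      _ <= ((k:RR)^2)^(2*k) := by
        refine (pow_le_pow_left₀ (by positivity) (by nlinarith : (k:RR)+1 <= (k:RR)^2) _).trans (pow_le_pow_right₀ (by nlinarith) (by omega))
      _ = _ := by rw [<- pow_mul]; congr 1; ring
  refine le_trans ?_ hρ
  calc _ <= ((k:RR)+1) * ((n:RR) * (k+1))^k * (((n:RR)^k)⁻¹ * ((k:RR)^(5*k))⁻¹) := by gcongr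
    _ = ((k:RR)+1) * (k+1)^k * ((k:RR)^(5*k))⁻¹ := by rw [mul_pow]; field_simp
    _ <= (k:RR)^(4*k) * ((k:RR)^(5*k))⁻¹ := by gcongr
    _ = ((k:RR)^k)⁻¹ := by rw [show 5*k = 4*k+k by ring, pow_add]; field_simp
    _ <= (1/2)^k := by rw [one_div, inv_pow]; gcongr
lemma exp_arith (d l : ℕ) (hd : 1 <= d) (hl : l = 22*(d+9)+300) : 2 * (bb d l d + 2) <= 7^d * (l-1) := by
  have h := (tt_bd d l (d-1)).2
  rw [<- bb_top d l d hd] at h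
  obtain ⟨e, rfl⟩ : ∃ e, d = e+1 := ⟨d-1, by omega⟩
  rw [Nat.add_sub_cancel] at h
  generalize bb (e+1) l (e+1) = b at *
  rw [pow_succ]
  have h7 : 1 <= 7^e := Nat.one_le_pow _ _ (by norm_num)
  generalize 7^e = q at *
  obtain ⟨m, rfl⟩ : ∃ m, l = m+1 := ⟨l-1, by omega⟩
  rw [Nat.add_sub_cancel]
  have hm : m = 22*(e+10)+299 := by omega
  subst hm
  nlinarith
end FP
open FP in
theorem fooling_PTFs (d : ℕ) (hd : 1 ≤ d) :
    ∃ A : ℝ, 1 ≤ A ∧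
      ∀ (n : ℕ), 1 ≤ n →
      ∀ ε : ℝ, ε ∈ Set.Ioo (0 : ℝ) 1 →
      ∀ k : ℕ, A * ε ^ (-((4 * d * 7 ^ d : ℕ) : ℝ)) ≤ (k : ℝ) →
      ∀ η : ℝ, 0 < η → η ≤ (n : ℝ) ^ (-(A * k)) * (k : ℝ) ^ (-(A * k)) →
      ∀ μ : Measure (Fin n → ℝ), IsProbabilityMeasure μ →
        MomentMatches k η μ →
      ∀ p : MvPolynomial (Fin n) ℝ, p.totalDegree ≤ d →
        |(∫ x, sgn (MvPolynomial.eval x p) ∂μ) -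
            ∫ y, sgn (MvPolynomial.eval y p) ∂(stdGaussianPi (Fin n))| ≤ ε / 2 := by
  obtain ⟨w0, c1, hw0, hc1, hanti⟩ := anti d hd
  obtain ⟨l, hl⟩ : ∃ l, l = 22*(d+9)+300 := ⟨_, rfl⟩
  obtain ⟨Y0, hsm⟩ := smooth d l hd (by omega)
  have hexp := exp_arith d l hd hl
  generalize hb : bb d l d = b at *
  set M : ℝ := 16*c1 + 1 with hM
  set H : ℝ := 72 + 12*M^(8*d)/w0 with hH
  have hH72 : 72 ≤ H := by rw [hH]; linarith [show 0 < 12*M^(8*d)/w0 by positivity]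
  have hHM : 12*M^(8*d) ≤ w0 * H := by
    have : w0 * H = w0*72 + 12*M^(8*d) := by rw [hH]; field_simp
    rw [this]; linarith [mul_pos hw0 (show (0:ℝ) < 72 by norm_num)]
  have hHp : 1 ≤ H^7^d := one_le_pow₀ (by linarith)
  set A : ℝ := 2^(2*(b+2)) * H^7^d + ((Y0+4:ℕ):ℝ)^(b+2) + 5 with hA
  have hA1 : 2^(2*(b+2)) * H^7^d ≤ A := by rw [hA]; linarith [show (0:ℝ) ≤ ((Y0+4:ℕ):ℝ)^(b+2) by positivity]
  have hA2 : ((Y0+4:ℕ):ℝ)^(b+2) ≤ A := by rw [hA]; linarith [show (0:ℝ) ≤ 2^(2*(b+2)) * H^7^d by positivity]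
  have hA5 : 5 ≤ A := by
    rw [hA]; linarith [show (0:ℝ) ≤ 2^(2*(b+2)) * H^7^d by positivity, show (0:ℝ) ≤ ((Y0+4:ℕ):ℝ)^(b+2) by positivity]
  refine ⟨A, by linarith, fun n hn ε hε k hk η hη0 hη μ _ hμ p hp => ?_⟩
  obtain ⟨hε0, hε1⟩ := hε
  rw [Real.rpow_neg hε0.le, Real.rpow_natCast, pow_mul] at hk
  set t := ε^(4*d) with ht
  have ht0 : 0 < t := by positivity
  have ht1 : t ≤ 1 := pow_le_one₀ hε0.le hε1.le
  have hAk : A ≤ k * t^7^d := by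
    rw [← div_eq_mul_inv, div_le_iff₀ (by positivity)] at hk; exact hk
  have hkA : A ≤ k := hAk.trans (mul_le_of_le_one_right (by positivity) (pow_le_one₀ ht0.le ht1))
  have hk2 : 2 ≤ k := by exact_mod_cast (by linarith : (2:ℝ) ≤ k)
  obtain ⟨Y, hYk, hkY⟩ := root_ex b k
  have hY0 : Y0 + 4 ≤ Y := by
    have h1 : ((Y0+4)^(b+2) : ℕ) ≤ k := by exact_mod_cast hA2.trans hkA
    have := lt_of_pow_lt_pow_left₀ (b+2) (Nat.zero_le _) (h1.trans_lt hkY)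
    omega
  have hY4 : (4:ℝ) ≤ Y := by exact_mod_cast (by omega : 4 ≤ Y)
  -- the key inequality
  have key : H ≤ t^2 * (Y:ℝ)^(l-1) := by
    refine le_of_pow_le_pow_left₀ (n := 7^d) (by positivity) (by positivity) ?_
    have h1 : (k:ℝ) ≤ (2*Y)^(b+2) := by
      refine le_trans (by exact_mod_cast hkY.le : (k:ℝ) ≤ ((Y:ℝ)+1)^(b+2)) ?_
      gcongr; linarith
    have h2 : A ≤ A^2 := by nlinarith
    have h3 : A^2 ≤ (k * t^7^d)^2 := by gcongr
    have h4 : (2:ℝ)^(2*(b+2)) * H^7^d ≤ 2^(2*(b+2)) * (t^2 * (Y:ℝ)^(l-1))^7^d := by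
      calc _ ≤ (k * t^7^d)^2 := hA1.trans (h2.trans h3)
        _ ≤ ((2*Y)^(b+2) * t^7^d)^2 := by gcongr
        _ = 2^(2*(b+2)) * ((t^2)^7^d * (Y:ℝ)^(2*(b+2))) := by ring
        _ ≤ 2^(2*(b+2)) * ((t^2)^7^d * (Y:ℝ)^(7^d*(l-1))) := by gcongr; linarith
        _ = _ := by rw [mul_pow, ← pow_mul (Y:ℝ), mul_comm (7^d)]
    exact le_of_mul_le_mul_left h4 (by positivity)
  have hG : Good (Y^b) ((1/2)^(Y^(b+1))) μ := by
    refine good_of_mm (by simpa using hn) hη0.le hμ ?_ ?_ ?_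
    · refine le_trans ?_ hYk
      rw [pow_add, mul_comm]; exact Nat.mul_le_mul_left _ (by nlinarith)
    · rw [Fintype.card_fin]
      refine eta_bd hn hk2 hA5 hη (pow_le_pow_of_le_one (by norm_num) (by norm_num) (le_trans (Nat.pow_le_pow_right (by omega) (by omega)) hYk))
    · have h1 := Kc_two (Y^b)
      have h2 : 4 * Y^b ≤ Y^(b+1) := by rw [pow_succ, mul_comm]; exact Nat.mul_le_mul_left _ (by omega)
      calc _ ≤ (1/2)^(Y^(b+1)) * (2:ℝ)^(Y^(b+1)) := by
            gcongr; exact h1.trans (pow_le_pow_right₀ (by norm_num) h2)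
        _ = 1 := by rw [← mul_pow]; norm_num
  -- normalized case
  have fin : ∀ q : MvPolynomial (Fin n) ℝ, q.totalDegree ≤ d → nr q = 1 →
      |(∫ x, sgn (MvPolynomial.eval x q) ∂μ) - ∫ y, sgn (MvPolynomial.eval y q) ∂(stdGaussianPi (Fin n))| ≤ ε / 2 := by
    intro q hq hqn
    rw [sgn_int, sgn_int]
    have h1 := hsm Y (by omega) (Fin n) μ (Y^b) _ hG le_rfl le_rfl q hq hqn
    have hYl : (Y:ℝ)^l = Y * (Y:ℝ)^(l-1) := by rw [← pow_succ']; congr 1; omega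
    have hM1 : 1 ≤ M := by rw [hM]; linarith
    have hP : 0 < (Y:ℝ)^(l-1) := by positivity
    have h2 : 12*Y/(Y:ℝ)^l ≤ w0 * (ε/M)^(8*d) := by
      rw [hYl, div_pow, mul_div_assoc', mul_comm (Y:ℝ), mul_div_mul_right _ _ (by positivity), div_le_div_iff₀ hP (by positivity)]
      calc _ ≤ w0 * H := hHM
        _ ≤ w0 * (t^2 * (Y:ℝ)^(l-1)) := by gcongr
        _ = _ := by rw [ht, ← pow_mul]; ring_nf
    have h3 := (ff_mono q h2).trans (hanti (Fin n) q hq hqn (ε/M) (by positivity) ((div_le_self hε0.le hM1).trans hε1.le))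
    have h4 : c1 * (ε/M) ≤ ε/16 := by
      rw [mul_div_assoc', div_le_div_iff₀ (by positivity) (by norm_num)]; rw [hM]; nlinarith
    have h5 : 9/(Y:ℝ)^l ≤ ε/8 := by
      rw [hYl, div_le_div_iff₀ (by positivity) (by norm_num)]
      have : t^2 ≤ ε := by rw [ht, ← pow_mul]; exact pow_le_of_le_one hε0.le hε1.le (by omega)
      calc (9*8:ℝ) ≤ t^2 * (Y:ℝ)^(l-1) := by linarith
        _ ≤ ε * (1 * (Y:ℝ)^(l-1)) := by rw [one_mul]; gcongr
        _ ≤ _ := by gcongr; linarith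
    rw [show ∀ a b : ℝ, 2*a - 1 - (2*b - 1) = 2*(a-b) by intros; ring, abs_mul, abs_two]
    linarith
  by_cases h0 : nr p = 0
  · rw [eq_zero_of_nr h0]; simp; positivity
  · have hnp : 0 < nr p := lt_of_le_of_ne (nr_nonneg p) (Ne.symm h0)
    have := fin (MvPolynomial.C (nr p)⁻¹ * p) ((deg_C_mul _ _).trans hp) (by rw [nr_C_mul, abs_of_pos (inv_pos.2 hnp), inv_mul_cancel₀ h0])
    have e : ∀ x, sgn (MvPolynomial.eval x (MvPolynomial.C (nr p)⁻¹ * p)) = sgn (MvPolynomial.eval x p) := by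
      intro x
      rw [map_mul (MvPolynomial.eval x), MvPolynomial.eval_C, sgn, sgn]
      congr 1
      exact propext (mul_nonneg_iff_of_pos_left (inv_pos.2 hnp))
    simpa only [e] using this
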